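/- Fix a rate R > 0, a rational composition Q_X, a DMC W and a continuous GLD decoding metric g, and let ε > 0. For the RGV construction with distance function d(P_{XX'}) = −I_P(X;X') and threshold Δ = −(R+2δ): the rate condition holds with parameter δ, and for all sufficiently small δ > 0 the typical error exponent satisfies E_trc^rgv(R,Q_X,d,Δ) ≥ E_ex(R,Q_X) − ε. -/

import Mathlib

open Filter Finset
open scoped Classical

noncomputable section

namespace RGV

/-- A probability distribution on a finite type. -/
def IsDist {α : Type} [Fintype α] (p : α → ℝ) : Prop :=
  (∀ a, 0 ≤ p a) ∧ ∑ a, p a = 1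

/-- `p` is an `n`-type: all probabilities are integer multiples of `1/n`. -/
def IsTypeDist {α : Type} (n : ℕ) (p : α → ℝ) : Prop :=
  ∀ a, ∃ k : ℕ, p a * n = k

/-- Empirical distribution of a sequence. -/
def emp {α : Type} [Fintype α] (n : ℕ) (x : Fin n → α) : α → ℝ :=
  fun a => ((Finset.univ.filter fun i => x i = a).card : ℝ) / n

/-- Joint empirical distribution of a pair of sequences. -/
def emp2 {α β : Type} [Fintype α] [Fintype β] (n : ℕ) (x : Fin n → α) (y : Fin n → β) :
    α × β → ℝ :=
  fun ab => ((Finset.univ.filter fun i => x i = ab.1 ∧ y i = ab.2).card : ℝ) / n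

/-- The type class of a composition `Q`. -/
def typeClass {α : Type} [Fintype α] (n : ℕ) (Q : α → ℝ) : Finset (Fin n → α) :=
  Finset.univ.filter fun x => emp n x = Q

/-- The pair type class of a joint type `P`. -/
def typeClass2 {α : Type} [Fintype α] (n : ℕ) (P : α × α → ℝ) :
    Finset ((Fin n → α) × (Fin n → α)) :=
  Finset.univ.filter fun xx => emp2 n xx.1 xx.2 = P

/-- `P` is a joint distribution on `α × α` with both marginals equal to `Q`. -/
def Joint {α : Type} [Fintype α] (Q : α → ℝ) (P : α × α → ℝ) : Prop :=
  IsDist P ∧ (∀ a, ∑ b, P (a, b) = Q a) ∧ (∀ b, ∑ a, P (a, b) = Q b)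

/-- `d` is a distance function: continuous and symmetric. -/
def IsDistance {α : Type} [Fintype α] (d : (α × α → ℝ) → ℝ) : Prop :=
  Continuous d ∧ ∀ P : α × α → ℝ, d (fun p => P (p.2, p.1)) = d P

/-- Mutual information of a joint distribution (natural logarithms). -/
def mutInf {α β : Type} [Fintype α] [Fintype β] (P : α × β → ℝ) : ℝ :=
  ∑ p : α × β, P p * Real.log (P p / ((∑ b, P (p.1, b)) * (∑ a, P (a, p.2))))

/-- Positive part `[t]₊`. -/
def pos (t : ℝ) : ℝ := max t 0

/-- Number of codewords at blocklength `n` and rate `R`. -/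
def Mof (R : ℝ) (n : ℕ) : ℕ := ⌈Real.exp (n * R)⌉₊

/-- The feasible set for the `i`-th codeword given the previous ones. -/
def feasible {α : Type} [Fintype α] (n : ℕ) (Q : α → ℝ) (d : (α × α → ℝ) → ℝ) (Δ : ℝ)
    {M : ℕ} (c : Fin M → Fin n → α) (i : Fin M) : Finset (Fin n → α) :=
  (typeClass n Q).filter fun z => ∀ j, j < i → Δ < d (emp2 n z (c j))

/-- The probability that the RGV construction outputs the codebook `c`. -/
def rgvProb {α : Type} [Fintype α] (n : ℕ) (Q : α → ℝ) (d : (α × α → ℝ) → ℝ) (Δ : ℝ)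
    {M : ℕ} (c : Fin M → Fin n → α) : ℝ :=
  ∏ i : Fin M,
    if c i ∈ feasible n Q d Δ c i then ((feasible n Q d Δ c i).card : ℝ)⁻¹ else 0

/-- Expectation over the RGV ensemble. -/
def expect {α : Type} [Fintype α] (n : ℕ) (Q : α → ℝ) (d : (α × α → ℝ) → ℝ) (Δ : ℝ)
    (M : ℕ) (f : (Fin M → Fin n → α) → ℝ) : ℝ :=
  ∑ c : Fin M → Fin n → α, rgvProb n Q d Δ c * f c

/-- Probability of an event over the RGV ensemble. -/
def prob {α : Type} [Fintype α] (n : ℕ) (Q : α → ℝ) (d : (α × α → ℝ) → ℝ) (Δ : ℝ)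
    (M : ℕ) (S : (Fin M → Fin n → α) → Prop) : ℝ :=
  ∑ c : Fin M → Fin n → α, if S c then rgvProb n Q d Δ c else 0

/-- `W` is a (discrete memoryless) channel. -/
def IsChannel {α β : Type} [Fintype β] (W : α → β → ℝ) : Prop := ∀ a, IsDist (W a)

/-- The product (memoryless) extension of the channel. -/
def Wn {α β : Type} (n : ℕ) (W : α → β → ℝ) (x : Fin n → α) (y : Fin n → β) : ℝ :=
  ∏ i, W (x i) (y i)

/-- GLD error probability of a codebook. -/
def Pe {α β : Type} [Fintype α] [Fintype β] (n : ℕ) (W : α → β → ℝ)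
    (g : (α × β → ℝ) → ℝ) {M : ℕ} (c : Fin M → Fin n → α) : ℝ :=
  (M : ℝ)⁻¹ * ∑ m : Fin M, ∑ m' ∈ Finset.univ.erase m, ∑ y : Fin n → β,
    Wn n W (c m) y * Real.exp ((n : ℝ) * g (emp2 n (c m') y)) /
      ∑ m'' : Fin M, Real.exp ((n : ℝ) * g (emp2 n (c m'') y))

/-- Marginal `P_{XY}` induced by `P_{XX'}` and the conditional law `V = P_{Y|XX'}`. -/
def PXY {α β : Type} [Fintype α] [Fintype β] (P : α × α → ℝ) (V : α × α → β → ℝ) :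
    α × β → ℝ :=
  fun ay => ∑ b, P (ay.1, b) * V (ay.1, b) ay.2

/-- Marginal `P_{X'Y}`. -/
def PXpY {α β : Type} [Fintype α] [Fintype β] (P : α × α → ℝ) (V : α × α → β → ℝ) :
    α × β → ℝ :=
  fun bY => ∑ a, P (a, bY.1) * V (a, bY.1) bY.2

/-- Output marginal `P_Y`. -/
def PYof {α β : Type} [Fintype α] [Fintype β] (P : α × α → ℝ) (V : α × α → β → ℝ) :
    β → ℝ :=
  fun y => ∑ p : α × α, P p * V p y

/-- Conditional divergence `D(P_{Y|X} ‖ W | Q)`. -/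
def condDiv {α β : Type} [Fintype α] [Fintype β] (Q : α → ℝ) (W : α → β → ℝ)
    (P : α × α → ℝ) (V : α × α → β → ℝ) : ℝ :=
  ∑ a, ∑ y, PXY P V (a, y) * Real.log (PXY P V (a, y) / (Q a * W a y))

/-- Conditional mutual information `I(X';Y|X)`. -/
def cmi {α β : Type} [Fintype α] [Fintype β] (P : α × α → ℝ) (V : α × α → β → ℝ) : ℝ :=
  ∑ a, ∑ b, ∑ y, P (a, b) * V (a, b) y *
    Real.log (P (a, b) * V (a, b) y * (∑ b', P (a, b')) /
      (P (a, b) * PXY P V (a, y)))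

/-- The joint distribution on `α × β` induced by `P_Y` and a reverse channel `V'`. -/
def jointOf {α β : Type} (PY : β → ℝ) (V' : β → α → ℝ) : α × β → ℝ :=
  fun ay => PY ay.2 * V' ay.2 ay.1

/-- The quantity `α(R, P_Y)`. -/
def alphaF {α β : Type} [Fintype α] [Fintype β] (Q : α → ℝ) (g : (α × β → ℝ) → ℝ)
    (R : ℝ) (PY : β → ℝ) : ℝ :=
  sSup { v | ∃ V' : β → α → ℝ, (∀ y, IsDist (V' y)) ∧
    (∀ a, ∑ y, PY y * V' y a = Q a) ∧ mutInf (jointOf PY V') ≤ R ∧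
    v = g (jointOf PY V') - mutInf (jointOf PY V') } + R

/-- The exponent `Γ(P_{XX'}, R)`. -/
def Gamma {α β : Type} [Fintype α] [Fintype β] (Q : α → ℝ) (W : α → β → ℝ)
    (g : (α × β → ℝ) → ℝ) (P : α × α → ℝ) (R : ℝ) : ℝ :=
  sInf { v | ∃ V : α × α → β → ℝ, (∀ p, IsDist (V p)) ∧
    v = condDiv Q W P V + cmi P V +
      pos (max (g (PXY P V)) (alphaF Q g R (PYof P V)) - g (PXpY P V)) }

/-- The quantity `β(R, P_Y)`. -/
def betaF {α β : Type} [Fintype α] [Fintype β] (Q : α → ℝ) (g : (α × β → ℝ) → ℝ)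
    (R : ℝ) (PY : β → ℝ) : ℝ :=
  sSup { v | ∃ V' : β → α → ℝ, (∀ y, IsDist (V' y)) ∧
    (∀ a, ∑ y, PY y * V' y a = Q a) ∧
    v = g (jointOf PY V') + pos (R - mutInf (jointOf PY V')) }

/-- The exponent `Λ(P_{XX'}, R)`. -/
def Lambda {α β : Type} [Fintype α] [Fintype β] (Q : α → ℝ) (W : α → β → ℝ)
    (g : (α × β → ℝ) → ℝ) (P : α × α → ℝ) (R : ℝ) : ℝ :=
  sInf { v | ∃ V : α × α → β → ℝ, (∀ p, IsDist (V p)) ∧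
    v = condDiv Q W P V + cmi P V + betaF Q g R (PYof P V) - g (PXpY P V) }

/-- The candidate value of the typical random coding exponent of the RGV ensemble. -/
def EtrcVal {α β : Type} [Fintype α] [Fintype β] (Q : α → ℝ) (W : α → β → ℝ)
    (g : (α × β → ℝ) → ℝ) (d : (α × α → ℝ) → ℝ) (Δ R : ℝ) : ℝ :=
  sInf { v | ∃ P : α × α → ℝ, Joint Q P ∧ mutInf P ≤ 2 * R ∧ Δ < d P ∧
    v = Gamma Q W g P R + mutInf P - R }

/-- The expurgated exponent. -/
def Eex {α β : Type} [Fintype α] [Fintype β] (Q : α → ℝ) (W : α → β → ℝ)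
    (g : (α × β → ℝ) → ℝ) (R : ℝ) : ℝ :=
  sInf { v | ∃ P : α × α → ℝ, Joint Q P ∧ mutInf P ≤ R ∧
    v = Gamma Q W g P R + mutInf P - R }

/-- The expurgated exponent of the RGV ensemble. -/
def EexRgv {α β : Type} [Fintype α] [Fintype β] (Q : α → ℝ) (W : α → β → ℝ)
    (g : (α × β → ℝ) → ℝ) (d : (α × α → ℝ) → ℝ) (Δ R : ℝ) : ℝ :=
  sInf { v | ∃ P : α × α → ℝ, Joint Q P ∧ Δ < d P ∧ mutInf P ≤ R ∧
    v = Gamma Q W g P R + mutInf P - R }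

/-- The rate condition at blocklength `n` with parameter `δ`
(the minimum over an empty collection of joint types being `+∞`). -/
def RateCond {α : Type} [Fintype α] (n : ℕ) (Q : α → ℝ) (d : (α × α → ℝ) → ℝ)
    (Δ R δ : ℝ) : Prop :=
  ((R : ℝ) : EReal) ≤
    sInf { v : EReal | ∃ P : α × α → ℝ, Joint Q P ∧ IsTypeDist n P ∧ d P ≤ Δ ∧
      v = ((mutInf P : ℝ) : EReal) } - (((2 * δ : ℝ)) : EReal)

/-- Type enumerator: the number of ordered pairs of distinct codewords
with joint empirical distribution `P`. -/
def Nenum {α : Type} [Fintype α] (n : ℕ) (P : α × α → ℝ) {M : ℕ}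
    (c : Fin M → Fin n → α) : ℕ :=
  ((Finset.univ : Finset (Fin M × Fin M)).filter fun mm =>
    mm.1 ≠ mm.2 ∧ emp2 n (c mm.1) (c mm.2) = P).card

/-- Normalized log of a probability (exponential rate), valued in `EReal`. -/
def lrate (n : ℕ) (p : ℝ) : EReal :=
  if p ≤ 0 then ⊥ else ((Real.log p / n : ℝ) : EReal)

/-- Normalized iterated-log rate (double-exponential decay rate), valued in `EReal`. -/
def drate (n : ℕ) (p : ℝ) : EReal :=
  if p ≤ 0 then ⊤ else if 1 ≤ p then ⊥
  else ((Real.log (-Real.log p) / n : ℝ) : EReal)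

/-- `δ_n = e^{-nδ}/(1-e^{-nδ})`. -/
def deltan (n : ℕ) (δ : ℝ) : ℝ := Real.exp (-(n * δ)) / (1 - Real.exp (-(n * δ)))


/-- Blocklength sequence: the multiples of the denominator `D` of the composition. -/
def nseq (D t : ℕ) : ℕ := D * (t + 1)

/-- The normalized expected log error probability `-(1/n) E[log P_e(C_n)]`. -/
def Expnt {α β : Type} [Fintype α] [Fintype β] (n : ℕ) (Q : α → ℝ)
    (d : (α × α → ℝ) → ℝ) (Δ : ℝ) (W : α → β → ℝ) (g : (α × β → ℝ) → ℝ) (R : ℝ) : ℝ :=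
  -(expect n Q d Δ (Mof R n) (fun c => Real.log (Pe n W g c)) / n)

/-- Ratio of type class sizes `|T(P)| / |T(Q)|²`. -/
def Lsize {α : Type} [Fintype α] (n : ℕ) (Q : α → ℝ) (P : α × α → ℝ) : ℝ :=
  ((typeClass2 n P).card : ℝ) / ((typeClass n Q).card : ℝ) ^ 2

end RGV

namespace RGV

set_option linter.unusedSectionVars false

/-- Shannon entropy (natural logarithms). -/
def Ent {γ : Type} [Fintype γ] (p : γ → ℝ) : ℝ := ∑ a, Real.negMulLog (p a)

/-- Push-forward of a finitely supported weight function. -/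
def push {γ κ : Type} [Fintype γ] (f : γ → κ) (p : γ → ℝ) : κ → ℝ :=
  fun c => ∑ a, if f a = c then p a else 0

/-- Sequences with the same empirical distribution as `z`. -/
def cls {γ : Type} [Fintype γ] {n : ℕ} (z : Fin n → γ) : Finset (Fin n → γ) :=
  Finset.univ.filter fun z' => emp n z' = emp n z

section Counting

variable {γ κ : Type} [Fintype γ] [Fintype κ] {n : ℕ}

lemma emp_eq_iff {z z' : Fin n → γ} :
    emp n z = emp n z' ↔ ∀ a, (univ.filter fun i => z i = a).card =
      (univ.filter fun i => z' i = a).card := by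
  constructor
  · intro h a
    rcases Nat.eq_zero_or_pos n with rfl | hn
    · simp
    · have := congrFun h a
      simp only [emp] at this
      rw [div_left_inj' (by positivity)] at this
      exact_mod_cast this
  · intro h
    funext a
    simp [emp, h a]

lemma exists_perm_of_emp_eq {z z' : Fin n → γ} (h : emp n z' = emp n z) :
    ∃ σ : Equiv.Perm (Fin n), z' = z ∘ σ := by
  have hc := emp_eq_iff.1 h
  have e : ∀ c, Nonempty ({i // z' i = c} ≃ {i // z i = c}) := by
    intro c
    refine ⟨Fintype.equivOfCardEq ?_⟩
    rw [Fintype.card_subtype, Fintype.card_subtype]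
    exact hc c
  refine ⟨Equiv.ofFiberEquiv fun c => (e c).some, ?_⟩
  funext i
  exact (Equiv.ofFiberEquiv_map (fun c => (e c).some) i).symm

lemma emp_comp_perm (z : Fin n → γ) (σ : Equiv.Perm (Fin n)) : emp n (z ∘ σ) = emp n z := by
  rw [emp_eq_iff]
  intro a
  refine Finset.card_bij (fun i _ => σ i) ?_ ?_ ?_
  · simp
  · intro i _ j _ hij
    exact σ.injective hij
  · intro j hj
    exact ⟨σ.symm j, by simpa using hj, by simp⟩

lemma emp_comp (f : γ → κ) (z : Fin n → γ) : emp n (f ∘ z) = push f (emp n z) := by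
  funext c
  simp only [emp, push, Function.comp]
  have : (univ.filter fun i => f (z i) = c).card =
      ∑ a, if f a = c then (univ.filter fun i => z i = a).card else 0 := by
    rw [Finset.card_eq_sum_card_fiberwise (f := z) (t := univ) (by simp)]
    refine Finset.sum_congr rfl fun a _ => ?_
    split_ifs with h
    · congr 1
      ext i
      simp only [mem_filter, mem_univ, true_and]
      constructor
      · exact fun hi => hi.2
      · exact fun hi => ⟨by rw [hi, h], hi⟩
    · rw [Finset.card_eq_zero, Finset.filter_eq_empty_iff]
      intro i hi hia
      simp only [mem_filter, mem_univ, true_and] at hi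
      exact h (hia ▸ hi)
  rw [this]
  push_cast
  rw [Finset.sum_div]
  refine Finset.sum_congr rfl fun a _ => ?_
  split_ifs <;> simp

lemma emp_isDist (hn : 0 < n) (z : Fin n → γ) : IsDist (emp n z) := by
  refine ⟨fun a => by simp only [emp]; positivity, ?_⟩
  simp only [emp]
  rw [← Finset.sum_div, div_eq_one_iff_eq (by positivity)]
  have := Finset.card_eq_sum_card_fiberwise (s := (univ : Finset (Fin n))) (f := z) (t := univ)
    (by simp)
  simp only [card_univ, Fintype.card_fin] at this
  exact_mod_cast this.symm

/-- The orbit count: `|class| * ∏ k_a! = n!`. -/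
lemma card_cls_mul (z : Fin n → γ) :
    (cls z).card * ∏ a, (univ.filter fun i => z i = a).card.factorial = n.factorial := by
  have h1 : (univ : Finset (Equiv.Perm (Fin n))).card =
      ∑ z' ∈ cls z, (univ.filter fun σ : Equiv.Perm (Fin n) => z ∘ σ = z').card :=
    Finset.card_eq_sum_card_fiberwise (f := fun σ : Equiv.Perm (Fin n) => z ∘ σ) (by
      intro σ _
      simp [cls, emp_comp_perm])
  have h2 : ∀ z' ∈ cls z, (univ.filter fun σ : Equiv.Perm (Fin n) => z ∘ σ = z').card =
      ∏ a, (univ.filter fun i => z i = a).card.factorial := by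
    intro z' hz'
    obtain ⟨σ₀, rfl⟩ := exists_perm_of_emp_eq (by simpa [cls] using hz')
    have := DomMulAct.stabilizer_card z
    simp only [Fintype.card_subtype] at this
    rw [← this]
    refine Finset.card_bij (fun σ _ => σ * σ₀⁻¹) ?_ ?_ ?_
    · intro σ hσ
      simp only [mem_filter, mem_univ, true_and] at hσ ⊢
      funext i
      have := congrFun hσ (σ₀⁻¹ i)
      simpa using this
    · intro σ _ σ' _ h
      exact mul_right_cancel h
    · intro τ hτ
      simp only [mem_filter, mem_univ, true_and] at hτ
      refine ⟨τ * σ₀, ?_, by simp⟩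
      simp only [mem_filter, mem_univ, true_and]
      funext i
      exact congrFun hτ (σ₀ i)
  rw [Finset.sum_congr rfl h2, Finset.sum_const, smul_eq_mul] at h1
  rw [← h1, card_univ, Fintype.card_perm, Fintype.card_fin]

lemma log_factorial_ge (k : ℕ) : k * Real.log k - k ≤ Real.log k.factorial := by
  rcases Nat.eq_zero_or_pos k with rfl | hk
  · simp
  have h := Real.pow_div_factorial_le_exp (k : ℝ) (by positivity) k
  have hf : (0 : ℝ) < k.factorial := by positivity
  have h2 := Real.log_le_log (by positivity) h
  rw [Real.log_div (by positivity) (by positivity), Real.log_pow, Real.log_exp] at h2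
  linarith

lemma log_factorial_le (k : ℕ) :
    Real.log k.factorial ≤ k * Real.log k - k + 1 + Real.log (k + 1) := by
  have key : ∀ k : ℕ, Real.log (k + 1).factorial ≤
      (k + 1 : ℕ) * Real.log (k + 1 : ℕ) - (k + 1 : ℕ) + 1 + Real.log (k + 1 : ℕ) := by
    intro k
    induction k with
    | zero => simp
    | succ k ih =>
      rw [Nat.factorial_succ]
      push_cast at ih ⊢
      rw [Real.log_mul (by positivity) (by positivity)]
      have h := Real.one_sub_inv_le_log_of_pos (x := ((k : ℝ) + 1 + 1) / (k + 1)) (by positivity)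
      rw [Real.log_div (by positivity) (by positivity)] at h
      have h3 : (1 : ℝ) - (((k : ℝ) + 1 + 1) / (k + 1))⁻¹ = 1 / (k + 2) := by
        field_simp
        ring
      rw [h3] at h
      have h4 : 1 ≤ ((k : ℝ) + 2) * (Real.log (k + 1 + 1) - Real.log (k + 1)) := by
        rw [div_le_iff₀ (by positivity)] at h
        linarith
      nlinarith
  rcases k with _ | k
  · simp
  · refine (key k).trans ?_
    push_cast
    have : Real.log ((k : ℝ) + 1) ≤ Real.log (k + 1 + 1) := Real.log_le_log (by positivity) (by linarith)
    linarith

lemma mul_Ent_emp (hn : 0 < n) (z : Fin n → γ) :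
    n * Ent (emp n z) = n * Real.log n -
      ∑ a, ((univ.filter fun i => z i = a).card : ℝ) *
        Real.log (univ.filter fun i => z i = a).card := by
  have hs := (emp_isDist hn z).2
  have hn' : (n : ℝ) ≠ 0 := by positivity
  have hs' : ∑ a, ((univ.filter fun i => z i = a).card : ℝ) = n := by
    simp only [emp] at hs
    rw [← Finset.sum_div, div_eq_one_iff_eq hn'] at hs
    exact hs
  conv_rhs => rw [← hs', Finset.sum_mul]
  rw [hs', ← Finset.sum_sub_distrib, Ent, Finset.mul_sum]
  refine Finset.sum_congr rfl fun a _ => ?_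
  simp only [Real.negMulLog, emp]
  by_cases h : ((univ.filter fun i => z i = a).card : ℝ) = 0
  · simp [h]
  · rw [Real.log_div h hn']
    field_simp
    ring

lemma card_cls_pos (z : Fin n → γ) : 0 < (cls z).card :=
  Finset.card_pos.2 ⟨z, by simp [cls]⟩

lemma log_card_cls (hn : 0 < n) (z : Fin n → γ) :
    |Real.log (cls z).card - n * Ent (emp n z)| ≤
      (Fintype.card γ + 1) * (1 + Real.log (n + 1)) := by
  have h := card_cls_mul z
  have h2 : Real.log (cls z).card + ∑ a, Real.log (univ.filter fun i => z i = a).card.factorial =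
      Real.log n.factorial := by
    rw [← h]
    push_cast
    rw [Real.log_mul, Real.log_prod]
    · intro a _
      positivity
    · have := card_cls_pos z
      positivity
    · exact Finset.prod_ne_zero_iff.2 fun a _ => by positivity
  have hE := mul_Ent_emp hn z
  have hs : ∑ a, ((univ.filter fun i => z i = a).card : ℝ) = n := by
    have := Finset.card_eq_sum_card_fiberwise (s := (univ : Finset (Fin n))) (f := z) (t := univ)
      (by simp)
    simp only [card_univ, Fintype.card_fin] at this
    exact_mod_cast this.symm
  have hge := log_factorial_ge n
  have hle := log_factorial_le n
  have hlog : 0 ≤ Real.log ((n : ℝ) + 1) := Real.log_nonneg (by linarith [(Nat.cast_nonneg n : (0:ℝ) ≤ n)])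
  have hsge : ∑ a, (((univ.filter fun i => z i = a).card : ℝ) *
        Real.log (univ.filter fun i => z i = a).card - (univ.filter fun i => z i = a).card) ≤
      ∑ a, Real.log (univ.filter fun i => z i = a).card.factorial :=
    Finset.sum_le_sum fun a _ => log_factorial_ge _
  have hsle : ∑ a, Real.log (univ.filter fun i => z i = a).card.factorial ≤
      ∑ a, (((univ.filter fun i => z i = a).card : ℝ) *
        Real.log (univ.filter fun i => z i = a).card - (univ.filter fun i => z i = a).card +
        (1 + Real.log (n + 1))) := by
    refine Finset.sum_le_sum fun a _ => (log_factorial_le _).trans ?_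
    have hc : (univ.filter fun i => z i = a).card ≤ n := by
      simpa using Finset.card_le_univ (univ.filter fun i => z i = a)
    have : Real.log (((univ.filter fun i => z i = a).card : ℝ) + 1) ≤ Real.log (n + 1) :=
      Real.log_le_log (by positivity) (by exact_mod_cast Nat.succ_le_succ hc)
    linarith
  rw [Finset.sum_sub_distrib, hs] at hsge
  rw [Finset.sum_add_distrib, Finset.sum_sub_distrib, hs, Finset.sum_const, card_univ,
    nsmul_eq_mul] at hsle
  rw [abs_le]
  constructor <;> nlinarith [(Nat.cast_nonneg (Fintype.card γ) : (0:ℝ) ≤ Fintype.card γ)]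

/-- Logarithmic terms are eventually below any linear one. -/
lemma eventually_log_le (C η : ℝ) (hη : 0 < η) :
    ∀ᶠ n : ℕ in atTop, C * (1 + Real.log ((n : ℝ) + 1)) ≤ η * n := by
  have h1 : Tendsto (fun n : ℕ => Real.log ((n : ℝ) + 1) / n) atTop (nhds 0) := by
    have h := (Real.isLittleO_log_id_atTop.comp_tendsto
      (tendsto_atTop_add_const_right atTop (1 : ℝ) tendsto_natCast_atTop_atTop)).tendsto_div_nhds_zero
    have h' : Tendsto (fun n : ℕ => ((n : ℝ) + 1) / n) atTop (nhds (1 + 0)) := by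
      have : Tendsto (fun n : ℕ => (1 : ℝ) + 1 / n) atTop (nhds (1 + 0)) :=
        tendsto_const_nhds.add tendsto_one_div_atTop_nhds_zero_nat
      refine this.congr' ?_
      filter_upwards [eventually_gt_atTop 0] with n hn
      field_simp
    have := h.mul h'
    simp only [zero_mul] at this
    refine this.congr' ?_
    filter_upwards [eventually_gt_atTop 0] with n hn
    simp only [Function.comp, id]
    field_simp
  have h2 : Tendsto (fun n : ℕ => C * (1 / n + Real.log ((n : ℝ) + 1) / n)) atTop (nhds 0) := by
    simpa using (tendsto_one_div_atTop_nhds_zero_nat.add h1).const_mul C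
  filter_upwards [h2.eventually_lt_const hη, eventually_gt_atTop 0] with n h hn
  have hn' : (0 : ℝ) < n := by positivity
  rw [← add_div, ← mul_div_assoc, div_lt_iff₀ hn'] at h
  exact h.le

variable (γ) in
lemma eventually_card_cls (η : ℝ) (hη : 0 < η) :
    ∀ᶠ n : ℕ in atTop, ∀ z : Fin n → γ,
      Real.exp (n * (Ent (emp n z) - η)) ≤ (cls z).card ∧
      ((cls z).card : ℝ) ≤ Real.exp (n * (Ent (emp n z) + η)) := by
  filter_upwards [eventually_log_le (Fintype.card γ + 1) η hη, eventually_gt_atTop 0] with n h hn z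
  have hc : (0 : ℝ) < (cls z).card := by exact_mod_cast card_cls_pos z
  have := abs_le.1 ((log_card_cls hn z).trans h)
  constructor
  · rw [← Real.le_log_iff_exp_le hc]
    linarith
  · rw [← Real.log_le_iff_le_exp hc]
    linarith

variable (γ) in
lemma eventually_card_types (η : ℝ) (hη : 0 < η) :
    ∀ᶠ n : ℕ in atTop,
      (((univ : Finset (Fin n → γ)).image (emp n)).card : ℝ) ≤ Real.exp (n * η) := by
  filter_upwards [eventually_log_le (Fintype.card γ) η hη] with n h
  have h1 : (univ : Finset (Fin n → γ)).image (emp n) ⊆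
      Fintype.piFinset fun _ : γ => (range (n + 1)).image fun k : ℕ => (k : ℝ) / n := by
    intro p hp
    obtain ⟨z, _, rfl⟩ := Finset.mem_image.1 hp
    rw [Fintype.mem_piFinset]
    intro a
    refine Finset.mem_image.2 ⟨(univ.filter fun i => z i = a).card, ?_, rfl⟩
    rw [Finset.mem_range, Nat.lt_succ_iff]
    simpa using Finset.card_le_univ (univ.filter fun i => z i = a)
  have h2 : (((univ : Finset (Fin n → γ)).image (emp n)).card : ℝ) ≤
      ((n : ℝ) + 1) ^ Fintype.card γ := by
    have := (Finset.card_le_card h1).trans_eq (Fintype.card_piFinset _)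
    rw [Finset.prod_const, card_univ] at this
    have h3 : ((range (n + 1)).image fun k : ℕ => (k : ℝ) / n).card ≤ n + 1 := by
      simpa using Finset.card_image_le (s := range (n + 1)) (f := fun k : ℕ => (k : ℝ) / n)
    exact_mod_cast this.trans (Nat.pow_le_pow_left h3 _)
  refine h2.trans ?_
  rw [← Real.log_le_iff_le_exp (by positivity), Real.log_pow]
  have : (0 : ℝ) ≤ Fintype.card γ := by positivity
  nlinarith

variable (γ) in
/-- Summing a function of the type over all sequences. -/
lemma eventually_sum_types_le (η : ℝ) (hη : 0 < η) :
    ∀ᶠ n : ℕ in atTop, ∀ (f : (γ → ℝ) → ℝ) (C : ℝ), 0 ≤ C → (∀ p, 0 ≤ f p) →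
      (∀ z : Fin n → γ, Real.exp (n * Ent (emp n z)) * f (emp n z) ≤ C) →
      ∑ z : Fin n → γ, f (emp n z) ≤ Real.exp (n * η) * C := by
  filter_upwards [eventually_card_cls γ (η / 2) (by positivity),
    eventually_card_types γ (η / 2) (by positivity)] with n h1 h2 f C hC hf h
  rw [← Finset.sum_fiberwise_of_maps_to (g := emp n) (t := univ.image (emp n)) (by simp)]
  have h3 : ∀ p ∈ (univ : Finset (Fin n → γ)).image (emp n),
      ∑ z with emp n z = p, f (emp n z) ≤ Real.exp (n * (η / 2)) * C := by
    intro p hp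
    obtain ⟨z, _, rfl⟩ := Finset.mem_image.1 hp
    have : ∑ z' with emp n z' = emp n z, f (emp n z') = (cls z).card * f (emp n z) := by
      rw [Finset.sum_congr rfl (g := fun _ => f (emp n z))]
      · simp [cls]
      · intro z' hz'
        simp only [mem_filter, mem_univ, true_and] at hz'
        rw [hz']
    rw [this]
    calc ((cls z).card : ℝ) * f (emp n z)
        ≤ Real.exp (n * (Ent (emp n z) + η / 2)) * f (emp n z) :=
          mul_le_mul_of_nonneg_right (h1 z).2 (hf _)
      _ = Real.exp (n * (η / 2)) * (Real.exp (n * Ent (emp n z)) * f (emp n z)) := by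
          rw [mul_add, Real.exp_add]
          ring
      _ ≤ _ := by gcongr; exact h z
  refine (Finset.sum_le_card_nsmul _ _ _ h3).trans ?_
  rw [nsmul_eq_mul]
  calc _ ≤ Real.exp (n * (η / 2)) * (Real.exp (n * (η / 2)) * C) := by gcongr
    _ = _ := by
      rw [← mul_assoc, ← Real.exp_add]
      ring_nf

end Counting

section FixedCoordinate

variable {γ κ α β : Type} [Fintype γ] [Fintype κ] [Fintype α] [Fintype β] {n : ℕ}

lemma emp2_eq (x : Fin n → α) (y : Fin n → β) : emp2 n x y = emp n fun i => (x i, y i) := by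
  funext p
  simp [emp2, emp, Prod.ext_iff]

lemma push_push (f : γ → κ) {ι : Type} (h : κ → ι) (p : γ → ℝ) :
    push h (push f p) = push (h ∘ f) p := by
  funext c
  simp only [push, Function.comp]
  have : ∀ b : κ, (if h b = c then ∑ a, if f a = b then p a else 0 else 0) =
      ∑ a, if h b = c then (if f a = b then p a else 0) else 0 := by
    intro b
    split_ifs <;> simp
  simp_rw [this]
  rw [Finset.sum_comm]
  refine Finset.sum_congr rfl fun a _ => ?_
  rw [Finset.sum_eq_single (f a)]
  · simp
  · intro b _ hb
    simp [hb.symm]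
  · simp

lemma push_fst_apply (p : α × β → ℝ) (a : α) : push Prod.fst p a = ∑ b, p (a, b) := by
  simp only [push, Fintype.sum_prod_type]
  rw [Finset.sum_eq_single a]
  · simp
  · intro b _ hb
    simp [hb]
  · simp

lemma push_snd_apply (p : α × β → ℝ) (b : β) : push Prod.snd p b = ∑ a, p (a, b) := by
  simp [push, Fintype.sum_prod_type]

lemma push_fst_emp2 (x : Fin n → α) (y : Fin n → β) : push Prod.fst (emp2 n x y) = emp n x := by
  rw [emp2_eq, ← emp_comp]
  rfl

lemma push_snd_emp2 (x : Fin n → α) (y : Fin n → β) : push Prod.snd (emp2 n x y) = emp n y := by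
  rw [emp2_eq, ← emp_comp]
  rfl

lemma emp2_comp_perm (x : Fin n → α) (y : Fin n → β) (σ : Equiv.Perm (Fin n)) :
    emp2 n (x ∘ σ) (y ∘ σ) = emp2 n x y := by
  rw [emp2_eq, emp2_eq, ← emp_comp_perm (fun i => (x i, y i)) σ]
  rfl

/-- Sums of an invariant function over the other coordinate depend only on the type. -/
lemma sum_emp2_congr (F : (α × β → ℝ) → ℝ) {y y' : Fin n → β} (h : emp n y' = emp n y) :
    ∑ z : Fin n → α, F (emp2 n z y') = ∑ z : Fin n → α, F (emp2 n z y) := by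
  obtain ⟨σ, rfl⟩ := exists_perm_of_emp_eq h
  rw [← Equiv.sum_comp (Equiv.arrowCongr σ.symm (Equiv.refl α))]
  refine Finset.sum_congr rfl fun z _ => ?_
  rw [← emp2_comp_perm z y σ]
  rfl

lemma card_cls_mul_sum (F : (α × β → ℝ) → ℝ) (y : Fin n → β) :
    (cls y).card * ∑ z : Fin n → α, F (emp2 n z y) =
      ∑ w : Fin n → α × β, if push Prod.snd (emp n w) = emp n y then F (emp n w) else 0 := by
  rw [← Equiv.sum_comp (Equiv.arrowProdEquivProdArrow (Fin n) (fun _ => α) (fun _ => β)).symm,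
    Fintype.sum_prod_type_right]
  have h : ∀ y' : Fin n → β, (∑ z : Fin n → α,
      (fun w : Fin n → α × β => if push Prod.snd (emp n w) = emp n y then F (emp n w) else 0)
        ((Equiv.arrowProdEquivProdArrow (Fin n) (fun _ => α) (fun _ => β)).symm (z, y'))) =
      if y' ∈ cls y then ∑ z : Fin n → α, F (emp2 n z y) else 0 := by
    intro y'
    have h2 : ∀ z : Fin n → α, emp n
        ((Equiv.arrowProdEquivProdArrow (Fin n) (fun _ => α) (fun _ => β)).symm (z, y')) =
        emp2 n z y' := fun z => (emp2_eq z y').symm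
    simp only [h2, push_snd_emp2, cls, mem_filter, mem_univ, true_and]
    split_ifs with h3
    · exact sum_emp2_congr F h3
    · simp
  rw [Finset.sum_congr rfl fun y' _ => h y', Finset.sum_ite_mem, Finset.univ_inter,
    Finset.sum_const, nsmul_eq_mul]

/-- A sequence pair of a given type may be moved over a prescribed second coordinate. -/
lemma exists_emp2_eq {y : Fin n → β} {w : Fin n → α × β}
    (h : push Prod.snd (emp n w) = emp n y) : ∃ z : Fin n → α, emp2 n z y = emp n w := by
  have h' : emp n y = emp n (Prod.snd ∘ w) := by rw [emp_comp, h]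
  obtain ⟨σ, rfl⟩ := exists_perm_of_emp_eq h'
  refine ⟨(Prod.fst ∘ w) ∘ σ, ?_⟩
  rw [emp2_comp_perm, emp2_eq]
  rfl

variable (α β) in
lemma eventually_sum_fix_le (η : ℝ) (hη : 0 < η) :
    ∀ᶠ n : ℕ in atTop, ∀ (y : Fin n → β) (f : (α × β → ℝ) → ℝ) (C : ℝ), 0 ≤ C → (∀ p, 0 ≤ f p) →
      (∀ z : Fin n → α,
        Real.exp (n * (Ent (emp2 n z y) - Ent (emp n y))) * f (emp2 n z y) ≤ C) →
      ∑ z : Fin n → α, f (emp2 n z y) ≤ Real.exp (n * η) * C := by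
  filter_upwards [eventually_sum_types_le (α × β) (η / 2) (by positivity),
    eventually_card_cls β (η / 2) (by positivity)] with n h1 h2 y f C hC hf h
  have h3 := h1 (fun p => if push Prod.snd p = emp n y then f p else 0)
    (Real.exp (n * Ent (emp n y)) * C) (by positivity)
    (fun p => by split_ifs <;> simp [hf]) (by
      intro w
      split_ifs with hw
      · obtain ⟨z, hz⟩ := exists_emp2_eq hw
        rw [← hz]
        have := h z
        rw [mul_sub, Real.exp_sub, div_mul_eq_mul_div, div_le_iff₀ (Real.exp_pos _)] at this
        linarith
      · simp only [mul_zero]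
        positivity)
  rw [← card_cls_mul_sum] at h3
  have h4 := (h2 y).1
  have hS : 0 ≤ ∑ z : Fin n → α, f (emp2 n z y) := Finset.sum_nonneg fun z _ => hf _
  have h5 := (mul_le_mul_of_nonneg_right h4 hS).trans h3
  have h6 : Real.exp (n * η) * C = (Real.exp (n * (η / 2)) * (Real.exp (n * Ent (emp n y)) * C)) /
      Real.exp (n * (Ent (emp n y) - η / 2)) := by
    rw [eq_div_iff (Real.exp_pos _).ne', ← mul_assoc, mul_right_comm, ← Real.exp_add,
      ← Real.exp_add]
    ring_nf
  rw [h6, le_div_iff₀ (Real.exp_pos _)]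
  linarith

lemma card_cls_mul_card_fix (y : Fin n → β) (z : Fin n → α) :
    (cls y).card * (univ.filter fun z' : Fin n → α => emp2 n z' y = emp2 n z y).card =
      (cls fun i => (z i, y i)).card := by
  have h := card_cls_mul_sum (fun p => if p = emp2 n z y then (1 : ℝ) else 0) y
  have h2 : ∀ w : Fin n → α × β, (if push Prod.snd (emp n w) = emp n y then
      (if emp n w = emp2 n z y then (1 : ℝ) else 0) else 0) =
      if emp n w = emp n (fun i => (z i, y i)) then 1 else 0 := by
    intro w
    rw [emp2_eq]
    by_cases hw : emp n w = emp n (fun i => (z i, y i))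
    · rw [if_pos hw, if_pos]
      rw [hw, ← emp2_eq, push_snd_emp2]
    · simp [hw]
  simp only [h2, Finset.sum_boole] at h
  exact_mod_cast h

variable (α β) in
lemma eventually_card_fix_ge (η : ℝ) (hη : 0 < η) :
    ∀ᶠ n : ℕ in atTop, ∀ (y : Fin n → β) (z : Fin n → α),
      Real.exp (n * (Ent (emp2 n z y) - Ent (emp n y) - η)) ≤
        (univ.filter fun z' : Fin n → α => emp2 n z' y = emp2 n z y).card := by
  filter_upwards [eventually_card_cls (α × β) (η / 2) (by positivity),
    eventually_card_cls β (η / 2) (by positivity)] with n h1 h2 y z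
  have h3 : ((cls y).card : ℝ) *
      (univ.filter fun z' : Fin n → α => emp2 n z' y = emp2 n z y).card =
      (cls fun i => (z i, y i)).card := by exact_mod_cast card_cls_mul_card_fix y z
  have h4 := (h1 fun i => (z i, y i)).1
  have h5 := (h2 y).2
  rw [← emp2_eq, ← h3] at h4
  have h6 := h4.trans (mul_le_mul_of_nonneg_right h5 (Nat.cast_nonneg _))
  rw [← div_le_iff₀' (Real.exp_pos _), ← Real.exp_sub] at h6
  refine le_trans (Real.exp_le_exp.2 (le_of_eq ?_)) h6
  ring

/-- A sequence with prescribed letter counts. -/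
lemma exists_seq_of_counts (k : γ → ℕ) {N : ℕ} (hk : ∑ a, k a = N) :
    ∃ z : Fin N → γ, ∀ a, (univ.filter fun i => z i = a).card = k a := by
  have hc : Fintype.card (Fin N) = Fintype.card (Σ a, Fin (k a)) := by simp [hk]
  let e := Fintype.equivOfCardEq hc
  refine ⟨fun i => (e i).1, fun a => ?_⟩
  have : (univ.filter fun i => (e i).1 = a).card =
      (univ.filter fun s : Σ a, Fin (k a) => s.1 = a).card := by
    refine Finset.card_bij (fun i _ => e i) (by simp) (fun i _ j _ h => e.injective h) ?_
    intro s hs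
    exact ⟨e.symm s, by simpa using hs, by simp⟩
  rw [this]
  have h2 : (univ.filter fun s : Σ a, Fin (k a) => s.1 = a).card =
      (univ : Finset (Fin (k a))).card := by
    symm
    refine Finset.card_bij (fun j _ => ⟨a, j⟩) (by simp) (fun i _ j _ h => by simpa using h) ?_
    rintro ⟨b, j⟩ hs
    simp only [mem_filter, mem_univ, true_and] at hs
    subst hs
    exact ⟨j, by simp, rfl⟩
  rw [h2]
  simp

lemma exists_emp_eq (hn : 0 < n) {p : γ → ℝ} (hp : ∑ a, p a = 1) (ht : IsTypeDist n p) :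
    ∃ z : Fin n → γ, emp n z = p := by
  choose k hk using ht
  have hs : ∑ a, k a = n := by
    have : ((∑ a, k a : ℕ) : ℝ) = n := by
      push_cast
      simp_rw [← hk]
      rw [← Finset.sum_mul, hp, one_mul]
    exact_mod_cast this
  obtain ⟨z, hz⟩ := exists_seq_of_counts k hs
  refine ⟨z, ?_⟩
  funext a
  have : (n : ℝ) ≠ 0 := by positivity
  simp only [emp, hz, ← hk]
  field_simp

end FixedCoordinate

section Sequential

variable {X : Type} [Fintype X] (T : Finset X) (ok : X → X → Prop)

/-- Elements of `T` compatible with all entries of `c`. -/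
def seqFeas {k : ℕ} (c : Fin k → X) : Finset X := T.filter fun z => ∀ j, ok z (c j)

/-- Law of the sequential sampling of compatible elements of `T`. -/
def seqProb {k : ℕ} (c : Fin k → X) : ℝ :=
  ∏ i : Fin k, if c i ∈ T.filter (fun z => ∀ j, j < i → ok z (c j)) then
    ((T.filter fun z => ∀ j, j < i → ok z (c j)).card : ℝ)⁻¹ else 0

/-- Expectation under the sequential law. -/
def seqExp (k : ℕ) (f : (Fin k → X) → ℝ) : ℝ := ∑ c : Fin k → X, seqProb T ok c * f c

lemma seqProb_snoc {k : ℕ} (c : Fin k → X) (z : X) :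
    seqProb T ok (Fin.snoc c z : Fin (k + 1) → X) =
      seqProb T ok c * if z ∈ seqFeas T ok c then ((seqFeas T ok c).card : ℝ)⁻¹ else 0 := by
  have h1 : ∀ i : Fin k, (T.filter fun w => ∀ j, j < i.castSucc →
      ok w ((Fin.snoc c z : Fin (k + 1) → X) j)) = T.filter fun w => ∀ j, j < i → ok w (c j) := by
    intro i
    refine Finset.filter_congr fun w _ => ?_
    constructor
    · intro h j hj
      simpa using h j.castSucc (by simpa using hj)
    · intro h j hj
      induction j using Fin.lastCases with
      | last => exact absurd hj (by simp [Fin.le_last])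
      | cast j => simpa using h j (by simpa using hj)
  have h2 : (T.filter fun w => ∀ j, j < Fin.last k →
      ok w ((Fin.snoc c z : Fin (k + 1) → X) j)) = seqFeas T ok c := by
    refine Finset.filter_congr fun w _ => ?_
    constructor
    · intro h j
      simpa using h j.castSucc (Fin.castSucc_lt_last j)
    · intro h j hj
      induction j using Fin.lastCases with
      | last => exact absurd hj (lt_irrefl _)
      | cast j => simpa using h j
  rw [seqProb, Fin.prod_univ_castSucc]
  simp only [h1, h2, Fin.snoc_castSucc, Fin.snoc_last]
  rfl

lemma seqExp_succ (k : ℕ) (f : (Fin (k + 1) → X) → ℝ) :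
    seqExp T ok (k + 1) f = seqExp T ok k fun c =>
      ((seqFeas T ok c).card : ℝ)⁻¹ * ∑ z ∈ seqFeas T ok c, f (Fin.snoc c z) := by
  rw [seqExp, ← Equiv.sum_comp (Fin.snocEquiv fun _ : Fin (k + 1) => X),
    Fintype.sum_prod_type_right, seqExp]
  refine Finset.sum_congr rfl fun c _ => ?_
  have : ∀ z, (Fin.snocEquiv fun _ : Fin (k + 1) => X) (z, c) = Fin.snoc c z := fun z => rfl
  simp only [this, seqProb_snoc]
  rw [Finset.mul_sum, Finset.mul_sum, ← Finset.sum_filter_add_sum_filter_not univ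
    (fun z => z ∈ seqFeas T ok c)]
  rw [Finset.sum_eq_zero (s := univ.filter fun z => ¬ z ∈ seqFeas T ok c), add_zero]
  · rw [Finset.filter_mem_eq_inter, Finset.univ_inter]
    refine Finset.sum_congr rfl fun z hz => ?_
    rw [if_pos hz]
    ring
  · intro z hz
    simp only [mem_filter, mem_univ, true_and] at hz
    simp [hz]

lemma seqProb_nonneg {k : ℕ} (c : Fin k → X) : 0 ≤ seqProb T ok c :=
  Finset.prod_nonneg fun i _ => by split_ifs <;> positivity

variable {T ok}

lemma seqProb_support {k : ℕ} {c : Fin k → X} (h : seqProb T ok c ≠ 0) (i : Fin k) :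
    c i ∈ T ∧ ∀ j, j < i → ok (c i) (c j) := by
  have := (Finset.prod_ne_zero_iff.1 h) i (mem_univ i)
  by_contra hc
  rw [if_neg (by simpa using hc)] at this
  exact this rfl

lemma seqExp_mono {k : ℕ} {f g : (Fin k → X) → ℝ}
    (h : ∀ c, seqProb T ok c ≠ 0 → f c ≤ g c) : seqExp T ok k f ≤ seqExp T ok k g := by
  refine Finset.sum_le_sum fun c _ => ?_
  by_cases hc : seqProb T ok c = 0
  · simp [hc]
  · exact mul_le_mul_of_nonneg_left (h c hc) (seqProb_nonneg T ok c)

lemma seqExp_congr {k : ℕ} {f g : (Fin k → X) → ℝ}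
    (h : ∀ c, seqProb T ok c ≠ 0 → f c = g c) : seqExp T ok k f = seqExp T ok k g :=
  le_antisymm (seqExp_mono fun c hc => (h c hc).le) (seqExp_mono fun c hc => (h c hc).ge)

lemma seqExp_add {k : ℕ} (f g : (Fin k → X) → ℝ) :
    seqExp T ok k (fun c => f c + g c) = seqExp T ok k f + seqExp T ok k g := by
  simp only [seqExp, mul_add, Finset.sum_add_distrib]

lemma seqExp_sub {k : ℕ} (f g : (Fin k → X) → ℝ) :
    seqExp T ok k (fun c => f c - g c) = seqExp T ok k f - seqExp T ok k g := by
  simp only [seqExp, mul_sub, Finset.sum_sub_distrib]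

lemma seqExp_mul_left {k : ℕ} (r : ℝ) (f : (Fin k → X) → ℝ) :
    seqExp T ok k (fun c => r * f c) = r * seqExp T ok k f := by
  simp only [seqExp, Finset.mul_sum]
  exact Finset.sum_congr rfl fun c _ => by ring

lemma seqExp_sum {k : ℕ} {ι : Type*} (s : Finset ι) (f : ι → (Fin k → X) → ℝ) :
    seqExp T ok k (fun c => ∑ i ∈ s, f i c) = ∑ i ∈ s, seqExp T ok k (f i) := by
  simp only [seqExp, Finset.mul_sum]
  rw [Finset.sum_comm]

/-- Standing assumptions: each element of `T` forbids at most `b` elements of `T`, and `F`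
elements survive `M` exclusions. -/
structure Sparse (T : Finset X) (ok : X → X → Prop) (M : ℕ) (b F : ℝ) : Prop where
  symm : ∀ x y, ok x y → ok y x
  forbid : ∀ x ∈ T, ((T.filter fun z => ¬ ok z x).card : ℝ) ≤ b
  b_pos : 0 < b
  F_pos : 0 < F
  le : F + M * b ≤ T.card

variable {M : ℕ} {b F : ℝ}

lemma Sparse.card_feas_ge (hS : Sparse T ok M b F) {k : ℕ} (hk : k ≤ M) {c : Fin k → X} (hc : ∀ i, c i ∈ T) :
    F ≤ (seqFeas T ok c).card := by
  have h1 : T ⊆ seqFeas T ok c ∪ univ.biUnion fun j => T.filter fun z => ¬ ok z (c j) := by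
    intro z hz
    by_cases h : ∀ j, ok z (c j)
    · exact Finset.mem_union_left _ (by simp [seqFeas, hz, h])
    · push Not at h
      obtain ⟨j, hj⟩ := h
      exact Finset.mem_union_right _ (by simp only [mem_biUnion, mem_univ, true_and]; exact ⟨j, by simp [hz, hj]⟩)
  have h2 := (Finset.card_le_card h1).trans (Finset.card_union_le _ _)
  have h3 : ((univ.biUnion fun j => T.filter fun z => ¬ ok z (c j)).card : ℝ) ≤ k * b := by
    have : ((univ.biUnion fun j => T.filter fun z => ¬ ok z (c j)).card : ℝ) ≤
        ∑ j : Fin k, ((T.filter fun z => ¬ ok z (c j)).card : ℝ) := by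
      exact_mod_cast Finset.card_biUnion_le
    refine this.trans ((Finset.sum_le_sum fun j _ => hS.forbid _ (hc j)).trans ?_)
    simp
  have h4 : (T.card : ℝ) ≤ (seqFeas T ok c).card +
      (univ.biUnion fun j => T.filter fun z => ¬ ok z (c j)).card := by exact_mod_cast h2
  have h5 : (k : ℝ) * b ≤ M * b := mul_le_mul_of_nonneg_right (by exact_mod_cast hk) hS.b_pos.le
  linarith [hS.le]

lemma Sparse.card_feas_pos (hS : Sparse T ok M b F) {k : ℕ} (hk : k ≤ M) {c : Fin k → X} (hc : ∀ i, c i ∈ T) :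
    (0 : ℝ) < (seqFeas T ok c).card := hS.F_pos.trans_le (hS.card_feas_ge hk hc)

lemma Sparse.card_pos (hS : Sparse T ok M b F) : (0 : ℝ) < T.card := by
  have := hS.le
  have := hS.F_pos
  have := hS.b_pos
  have : (0 : ℝ) ≤ M * b := by positivity
  linarith

lemma Sparse.seqExp_one (hS : Sparse T ok M b F) {k : ℕ} (hk : k ≤ M) : seqExp T ok k (fun _ => 1) = 1 := by
  induction k with
  | zero => simp [seqExp, seqProb]
  | succ k ih =>
    rw [seqExp_succ]
    refine (seqExp_congr (g := fun _ => 1) fun c hc => ?_).trans (ih (by omega))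
    have := hS.card_feas_pos (k := k) (by omega) fun i => (seqProb_support hc i).1
    simp [this.ne']

/-- The law of a prefix. -/
lemma Sparse.seqExp_prefix (hS : Sparse T ok M b F) {k m : ℕ} (hkm : k ≤ m) (hm : m ≤ M) (f : (Fin k → X) → ℝ) :
    seqExp T ok m (fun c => f fun i => c (Fin.castLE hkm i)) = seqExp T ok k f := by
  induction m, hkm using Nat.le_induction with
  | base => rfl
  | succ m hkm ih =>
    rw [seqExp_succ, ← ih (by omega)]
    refine seqExp_congr fun c hc => ?_
    have hpos := hS.card_feas_pos (k := m) (by omega) fun i => (seqProb_support hc i).1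
    have : ∀ z, (fun i : Fin k => (Fin.snoc c z : Fin (m + 1) → X) (Fin.castLE (by omega) i)) =
        fun i => c (Fin.castLE hkm i) := by
      intro z
      funext i
      have : (Fin.castLE (by omega : k ≤ m + 1) i) = (Fin.castLE hkm i).castSucc := rfl
      rw [this, Fin.snoc_castSucc]
    simp only [this, Finset.sum_const, nsmul_eq_mul]
    rw [← mul_assoc, inv_mul_cancel₀ hpos.ne', one_mul]

/-- Supermartingale bound. -/
lemma Sparse.seqExp_le_prod (hS : Sparse T ok M b F) (G : ∀ k, (Fin k → X) → ℝ) (C : ℕ → ℝ) (hC : ∀ k, 0 ≤ C k)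
    (h0 : ∀ c, G 0 c ≤ 1)
    (hstep : ∀ k < M, ∀ c : Fin k → X, (∀ i, c i ∈ T) →
      ∑ z ∈ seqFeas T ok c, G (k + 1) (Fin.snoc c z) ≤ C k * (seqFeas T ok c).card * G k c) :
    seqExp T ok M (G M) ≤ ∏ k ∈ range M, C k := by
  have : ∀ k ≤ M, seqExp T ok k (G k) ≤ ∏ j ∈ range k, C j := by
    intro k
    induction k with
    | zero =>
      intro _
      have := seqExp_mono (T := T) (ok := ok) (f := G 0) (g := fun _ => 1) fun c _ => h0 c
      simpa [hS.seqExp_one (Nat.zero_le M)] using this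
    | succ k ih =>
      intro hk
      rw [Finset.prod_range_succ, seqExp_succ]
      refine le_trans (seqExp_mono (g := fun c => C k * G k c) fun c hc => ?_) ?_
      · have hT := fun i => (seqProb_support hc i).1
        have hpos := hS.card_feas_pos (k := k) (by omega) hT
        rw [inv_mul_le_iff₀ hpos]
        have := hstep k (by omega) c hT
        linarith
      · rw [seqExp_mul_left, mul_comm]
        exact mul_le_mul_of_nonneg_right (ih (by omega)) (hC k)
  exact this M le_rfl

lemma seqExp_eq_zero {k : ℕ} {f : (Fin k → X) → ℝ}
    (h : ∀ c, seqProb T ok c ≠ 0 → f c = 0) : seqExp T ok k f = 0 := by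
  rw [seqExp_congr (g := fun _ => 0) h]
  simp [seqExp]

lemma Sparse.seqExp_points_le (hS : Sparse T ok M b F) {κ : Type} [Fintype κ] {ι : κ → Fin M}
    (hι : Function.Injective ι) (v : κ → X) :
    seqExp T ok M (fun c => if ∀ j, c (ι j) = v j then 1 else 0) ≤ F⁻¹ ^ Fintype.card κ := by
  let C : ℕ → ℝ := fun i => if ∃ j, (ι j : ℕ) = i then F⁻¹ else 1
  let w : ℕ → X → ℝ := fun i z => if ∃ j, (ι j : ℕ) = i ∧ v j ≠ z then 0 else 1
  have hF := hS.F_pos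
  have hw : ∀ i z, w i z ≤ 1 := fun i z => by simp only [w]; split_ifs <;> norm_num
  have hw0 : ∀ i z, 0 ≤ w i z := fun i z => by simp only [w]; split_ifs <;> norm_num
  have h := hS.seqExp_le_prod (G := fun k c => ∏ i : Fin k, w i (c i)) (C := C)
    (fun k => by simp only [C]; split_ifs <;> positivity) (by simp) (by
      intro k hk c hc
      simp only [Fin.prod_univ_castSucc, Fin.snoc_castSucc, Fin.snoc_last, Fin.val_castSucc,
        Fin.val_last]
      rw [← Finset.mul_sum, mul_comm]
      refine mul_le_mul_of_nonneg_right ?_ (Finset.prod_nonneg fun i _ => hw0 _ _)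
      have hge := hS.card_feas_ge hk.le hc
      by_cases hk' : ∃ j, (ι j : ℕ) = k
      · obtain ⟨j, hj⟩ := hk'
        simp only [C, if_pos (⟨j, hj⟩ : ∃ j, (ι j : ℕ) = k)]
        have h1 : ∑ z ∈ seqFeas T ok c, w k z ≤ ∑ z ∈ seqFeas T ok c, if z = v j then 1 else 0 := by
          refine Finset.sum_le_sum fun z _ => ?_
          split_ifs with hz
          · exact hw _ _
          · simp only [w]
            rw [if_pos ⟨j, hj, fun h => hz h.symm⟩]
        have h2 : (∑ z ∈ seqFeas T ok c, if z = v j then (1 : ℝ) else 0) ≤ 1 := by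
          rw [Finset.sum_ite_eq']
          split_ifs <;> norm_num
        have h3 : 1 ≤ F⁻¹ * (seqFeas T ok c).card := by
          rw [inv_mul_eq_div, le_div_iff₀ hF]
          linarith
        linarith
      · simp only [C, if_neg hk', one_mul]
        refine (Finset.sum_le_card_nsmul _ _ 1 fun z _ => hw _ _).trans (by simp))
  have hprod : ∏ k ∈ range M, C k = F⁻¹ ^ Fintype.card κ := by
    simp only [C]
    rw [Finset.prod_ite, Finset.prod_const, Finset.prod_const_one, mul_one]
    congr 1
    have : (range M).filter (fun x => ∃ j, (ι j : ℕ) = x) = univ.image fun j => (ι j : ℕ) := by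
      ext x
      simp only [mem_filter, mem_range, mem_image, mem_univ, true_and, and_iff_right_iff_imp]
      rintro ⟨j, rfl⟩
      exact (ι j).2
    rw [this]
    exact (Finset.card_image_of_injective univ (f := fun j => (ι j : ℕ))
      (Fin.val_injective.comp hι)).trans card_univ
  rw [hprod] at h
  refine le_trans (seqExp_mono fun c _ => ?_) h
  split_ifs with hc
  · rw [Finset.prod_eq_one]
    intro i _
    simp only [w]
    rw [if_neg]
    rintro ⟨j, hj, hv⟩
    have : ι j = i := Fin.ext hj
    exact hv (by rw [← hc j, this])
  · exact Finset.prod_nonneg fun i _ => hw0 _ _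

/-- Joint densities of finitely many entries. -/
lemma Sparse.seqExp_fun_le (hS : Sparse T ok M b F) {κ : Type} [Fintype κ] [DecidableEq κ] {ι : κ → Fin M}
    (hι : Function.Injective ι) (h : (κ → X) → ℝ) (hh : ∀ v, 0 ≤ h v) :
    seqExp T ok M (fun c => h fun j => c (ι j)) ≤
      F⁻¹ ^ Fintype.card κ * ∑ v ∈ Fintype.piFinset fun _ : κ => T, h v := by
  have h1 : seqExp T ok M (fun c => h fun j => c (ι j)) =
      seqExp T ok M (fun c => ∑ v ∈ Fintype.piFinset fun _ : κ => T,
        h v * if ∀ j, c (ι j) = v j then 1 else 0) := by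
    refine seqExp_congr fun c hc => ?_
    rw [Finset.sum_eq_single fun j => c (ι j)]
    · simp
    · intro v _ hv
      rw [if_neg, mul_zero]
      intro hj
      exact hv (funext fun j => (hj j).symm)
    · intro hn
      exact absurd (Fintype.mem_piFinset.2 fun j => (seqProb_support hc (ι j)).1) hn
  rw [h1, seqExp_sum, Finset.mul_sum]
  refine Finset.sum_le_sum fun v _ => ?_
  rw [seqExp_mul_left, mul_comm]
  exact mul_le_mul_of_nonneg_right (hS.seqExp_points_le hι v) (hh v)

lemma sum_piFinset_succ {k : ℕ} (h : (Fin (k + 1) → X) → ℝ) :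
    ∑ v ∈ Fintype.piFinset (fun _ : Fin (k + 1) => T), h v =
      ∑ x ∈ T, ∑ v ∈ Fintype.piFinset (fun _ : Fin k => T), h (Fin.cons x v) := by
  rw [← Finset.sum_product']
  symm
  refine Finset.sum_bij' (fun p _ => Fin.cons p.1 p.2) (fun v _ => (v 0, Fin.tail v)) ?_ ?_ ?_ ?_ ?_
  · rintro ⟨x, v⟩ hp
    simp only [mem_product, Fintype.mem_piFinset] at hp ⊢
    exact Fin.cases (by simpa using hp.1) (by simpa using hp.2)
  · intro v hv
    simp only [mem_product, Fintype.mem_piFinset] at hv ⊢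
    exact ⟨hv 0, fun i => hv i.succ⟩
  · rintro ⟨x, v⟩ _
    simp
  · intro v _
    simp
  · intro p _
    rfl

lemma sum_piFinset_zero (h : (Fin 0 → X) → ℝ) :
    ∑ v ∈ Fintype.piFinset (fun _ : Fin 0 => T), h v = h ![] := by
  simp [Subsingleton.elim (default : Fin 0 → X) ![]]

lemma Sparse.seqExp_one_le (hS : Sparse T ok M b F) (i : Fin M) (h : X → ℝ) (hh : ∀ x, 0 ≤ h x) :
    seqExp T ok M (fun c => h (c i)) ≤ F⁻¹ * ∑ x ∈ T, h x := by
  have := hS.seqExp_fun_le (ι := ![i]) (fun _ _ _ => Subsingleton.elim _ _)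
    (fun v => h (v 0)) (fun v => hh _)
  refine this.trans (le_of_eq ?_)
  rw [Fintype.card_fin]
  rw [pow_one]
  congr 1
  exact (sum_piFinset_succ (k := 0) _).trans (Finset.sum_congr rfl fun _ _ => (sum_piFinset_zero _))

lemma Sparse.seqExp_two_le (hS : Sparse T ok M b F) {i j : Fin M} (hij : i ≠ j) (h : X → X → ℝ) (hh : ∀ x y, 0 ≤ h x y) :
    seqExp T ok M (fun c => h (c i) (c j)) ≤ F⁻¹ ^ 2 * ∑ x ∈ T, ∑ y ∈ T, h x y := by
  have hinj : Function.Injective ![i, j] := by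
    intro a b
    fin_cases a <;> fin_cases b <;> simp [hij, hij.symm]
  have := hS.seqExp_fun_le hinj (fun v => h (v 0) (v 1)) (fun v => hh _ _)
  refine this.trans (le_of_eq ?_)
  rw [Fintype.card_fin]
  congr 1
  exact (sum_piFinset_succ (k := 1) _).trans (Finset.sum_congr rfl fun _ _ =>
    (sum_piFinset_succ (k := 0) _).trans (Finset.sum_congr rfl fun _ _ => (sum_piFinset_zero _)))

lemma Sparse.seqExp_three_le (hS : Sparse T ok M b F) {i j k : Fin M} (hij : i ≠ j) (hik : i ≠ k) (hjk : j ≠ k)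
    (h : X → X → X → ℝ) (hh : ∀ x y z, 0 ≤ h x y z) :
    seqExp T ok M (fun c => h (c i) (c j) (c k)) ≤
      F⁻¹ ^ 3 * ∑ x ∈ T, ∑ y ∈ T, ∑ z ∈ T, h x y z := by
  have hinj : Function.Injective ![i, j, k] := by
    intro a b
    fin_cases a <;> fin_cases b <;> simp [hij, hij.symm, hik, hik.symm, hjk, hjk.symm]
  have := hS.seqExp_fun_le hinj (fun v => h (v 0) (v 1) (v 2)) (fun v => hh _ _ _)
  refine this.trans (le_of_eq ?_)
  rw [Fintype.card_fin]
  congr 1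
  exact (sum_piFinset_succ (k := 2) _).trans (Finset.sum_congr rfl fun _ _ =>
    (sum_piFinset_succ (k := 1) _).trans (Finset.sum_congr rfl fun _ _ =>
    (sum_piFinset_succ (k := 0) _).trans (Finset.sum_congr rfl fun _ _ => (sum_piFinset_zero _))))

lemma Sparse.seqExp_four_le (hS : Sparse T ok M b F) {i j k l : Fin M} (hij : i ≠ j) (hik : i ≠ k) (hil : i ≠ l)
    (hjk : j ≠ k) (hjl : j ≠ l) (hkl : k ≠ l)
    (h : X → X → X → X → ℝ) (hh : ∀ x y z w, 0 ≤ h x y z w) :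
    seqExp T ok M (fun c => h (c i) (c j) (c k) (c l)) ≤
      F⁻¹ ^ 4 * ∑ x ∈ T, ∑ y ∈ T, ∑ z ∈ T, ∑ w ∈ T, h x y z w := by
  have hinj : Function.Injective ![i, j, k, l] := by
    intro a b
    fin_cases a <;> fin_cases b <;>
      simp [hij, hij.symm, hik, hik.symm, hjk, hjk.symm, hil, hil.symm, hjl, hjl.symm, hkl,
        hkl.symm]
  have := hS.seqExp_fun_le hinj (fun v => h (v 0) (v 1) (v 2) (v 3)) (fun v => hh _ _ _ _)
  refine this.trans (le_of_eq ?_)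
  rw [Fintype.card_fin]
  congr 1
  exact (sum_piFinset_succ (k := 3) _).trans (Finset.sum_congr rfl fun _ _ =>
    (sum_piFinset_succ (k := 2) _).trans (Finset.sum_congr rfl fun _ _ =>
    (sum_piFinset_succ (k := 1) _).trans (Finset.sum_congr rfl fun _ _ =>
    (sum_piFinset_succ (k := 0) _).trans (Finset.sum_congr rfl fun _ _ => (sum_piFinset_zero _)))))

end Sequential

section Sequential

variable {X : Type} [Fintype X] {T : Finset X} {ok : X → X → Prop} {M : ℕ} {b F : ℝ}

/-- Number of elements of `A` excluded by `x`. -/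
def excl (ok : X → X → Prop) (A : Finset X) (x : X) : ℝ := (A.filter fun z => ¬ ok z x).card

lemma excl_nonneg (A : Finset X) (x : X) : 0 ≤ excl ok A x := Nat.cast_nonneg _

lemma Sparse.excl_le (hS : Sparse T ok M b F) {A : Finset X} (hA : A ⊆ T) {x : X} (hx : x ∈ T) :
    excl ok A x ≤ b :=
  le_trans (by unfold excl; exact_mod_cast Finset.card_le_card (Finset.filter_subset_filter _ hA))
    (hS.forbid x hx)

lemma Sparse.sum_excl_le (hS : Sparse T ok M b F) {A : Finset X} (hA : A ⊆ T) :
    ∑ x ∈ T, excl ok A x ≤ b * A.card := by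
  have h1 : ∑ x ∈ T, excl ok A x = ∑ z ∈ A, ∑ x ∈ T, if ¬ ok z x then (1 : ℝ) else 0 := by
    rw [Finset.sum_comm]
    refine Finset.sum_congr rfl fun x _ => ?_
    rw [excl, Finset.sum_boole]
  rw [h1]
  refine (Finset.sum_le_card_nsmul A _ b fun z hz => ?_).trans (by rw [nsmul_eq_mul, mul_comm])
  refine le_trans (le_of_eq ?_) (hS.forbid z (hA hz))
  rw [Finset.sum_boole]
  congr 2
  exact Finset.filter_congr fun x _ => not_congr ⟨hS.symm _ _, hS.symm _ _⟩

lemma Sparse.seqExp_exp_excl_le (hS : Sparse T ok M b F) {A : Finset X} (hA : A ⊆ T) :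
    seqExp T ok M (fun c => Real.exp ((∑ i, excl ok A (c i)) / b)) ≤
      Real.exp (M * (2 * A.card / F)) := by
  have hF := hS.F_pos
  have hb := hS.b_pos
  have h := hS.seqExp_le_prod (G := fun k c => Real.exp ((∑ i, excl ok A (c i)) / b))
    (C := fun _ => Real.exp (2 * A.card / F)) (fun k => (Real.exp_pos _).le) (by simp) (by
      intro k hk c hc
      simp only [Fin.sum_univ_castSucc, Fin.snoc_castSucc, Fin.snoc_last, add_div, Real.exp_add]
      rw [← Finset.mul_sum, mul_comm]
      refine mul_le_mul_of_nonneg_right ?_ (Real.exp_pos _).le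
      have hfe := hS.card_feas_ge hk.le hc
      have hsub : seqFeas T ok c ⊆ T := Finset.filter_subset _ _
      have h1 : ∀ z ∈ seqFeas T ok c, Real.exp (excl ok A z / b) ≤ 1 + 2 * (excl ok A z / b) := by
        intro z hz
        have hu : excl ok A z / b ≤ 1 := (div_le_one hb).2 (hS.excl_le hA (hsub hz))
        have hu0 : 0 ≤ excl ok A z / b := div_nonneg (excl_nonneg _ _) hb.le
        have := Real.abs_exp_sub_one_sub_id_le (x := excl ok A z / b) (by rwa [abs_of_nonneg hu0])
        have := (abs_le.1 this).2
        nlinarith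
      have h2 : ∑ z ∈ seqFeas T ok c, excl ok A z ≤ b * A.card :=
        (Finset.sum_le_sum_of_subset_of_nonneg hsub fun _ _ _ => excl_nonneg _ _).trans
          (hS.sum_excl_le hA)
      have h3 : ∑ z ∈ seqFeas T ok c, Real.exp (excl ok A z / b) ≤
          (seqFeas T ok c).card + 2 * A.card := by
        refine (Finset.sum_le_sum h1).trans ?_
        rw [Finset.sum_add_distrib, ← Finset.mul_sum, ← Finset.sum_div]
        have : (∑ z ∈ seqFeas T ok c, excl ok A z) / b ≤ A.card := by
          rw [div_le_iff₀ hb]; linarith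
        simp only [sum_const, nsmul_eq_mul, mul_one]
        linarith
      refine h3.trans ?_
      have h4 := Real.add_one_le_exp (2 * (A.card : ℝ) / F)
      have h5 : 2 * (A.card : ℝ) ≤ 2 * A.card / F * (seqFeas T ok c).card := by
        rw [div_mul_eq_mul_div, le_div_iff₀ hF]
        gcongr
      nlinarith)
  refine h.trans (le_of_eq ?_)
  rw [Finset.prod_const, card_range, ← Real.exp_nat_mul]

lemma Sparse.seqExp_hits_le (hS : Sparse T ok M b F) {A : Finset X} (hA : A ⊆ T) :
    seqExp T ok M (fun c => if ∑ i, excl ok A (c i) ≤ A.card / 2 then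
      Real.exp (-∑ i, if c i ∈ A then (1 : ℝ) else 0) else 0) ≤
      Real.exp (-(M * (A.card / (4 * T.card)))) := by
  have hT := hS.card_pos
  have h := hS.seqExp_le_prod (G := fun k c => if ∑ i, excl ok A (c i) ≤ A.card / 2 then
      Real.exp (-∑ i, if c i ∈ A then (1 : ℝ) else 0) else 0)
    (C := fun _ => Real.exp (-(A.card / (4 * T.card)))) (fun k => (Real.exp_pos _).le)
    (fun c => by split_ifs <;> simp) (by
      intro k hk c hc
      simp only [Fin.sum_univ_castSucc, Fin.snoc_castSucc, Fin.snoc_last]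
      by_cases hU : ∑ i, excl ok A (c i) ≤ A.card / 2
      swap
      · rw [if_neg hU, mul_zero]
        refine Finset.sum_nonpos fun z _ => ?_
        rw [if_neg]
        have := excl_nonneg (ok := ok) A z
        linarith
      rw [if_pos hU]
      have hcard : (A.card : ℝ) / 2 ≤ ((seqFeas T ok c).filter (· ∈ A)).card := by
        have hsub : A ⊆ (seqFeas T ok c).filter (· ∈ A) ∪
            univ.biUnion fun j => A.filter fun z => ¬ ok z (c j) := by
          intro z hz
          by_cases h : ∀ j, ok z (c j)
          · exact Finset.mem_union_left _ (by simp [seqFeas, hA hz, h, hz])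
          · push Not at h
            obtain ⟨j, hj⟩ := h
            refine Finset.mem_union_right _ ?_
            simp only [mem_biUnion, mem_univ, true_and]
            exact ⟨j, by simp [hz, hj]⟩
        have h2 := (Finset.card_le_card hsub).trans (Finset.card_union_le _ _)
        have h3 : ((univ.biUnion fun j => A.filter fun z => ¬ ok z (c j)).card : ℝ) ≤
            ∑ j, excl ok A (c j) := by
          unfold excl
          exact_mod_cast Finset.card_biUnion_le
        have h4 : (A.card : ℝ) ≤ ((seqFeas T ok c).filter (· ∈ A)).card +
          (univ.biUnion fun j => A.filter fun z => ¬ ok z (c j)).card := by exact_mod_cast h2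
        linarith
      have h1 : ∑ z ∈ seqFeas T ok c, Real.exp (-if z ∈ A then (1 : ℝ) else 0) ≤
          (seqFeas T ok c).card - A.card / 4 := by
        have he : Real.exp (-1) ≤ 1 / 2 := by
          have := Real.add_one_le_exp (1 : ℝ)
          rw [Real.exp_neg, inv_le_comm₀ (Real.exp_pos _) (by norm_num)]
          linarith
        have : ∀ z ∈ seqFeas T ok c, Real.exp (-if z ∈ A then (1 : ℝ) else 0) ≤
            1 - (if z ∈ A then 1 / 2 else 0) := by
          intro z _
          split_ifs
          · linarith
          · simp
        refine (Finset.sum_le_sum this).trans ?_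
        rw [Finset.sum_sub_distrib, ← Finset.sum_filter]
        simp only [sum_const, nsmul_eq_mul, mul_one]
        linarith
      have hle : ((seqFeas T ok c).card : ℝ) ≤ T.card := by
        exact_mod_cast Finset.card_le_card (Finset.filter_subset _ _)
      calc _ ≤ ∑ z ∈ seqFeas T ok c, Real.exp (-∑ i, if c i ∈ A then (1 : ℝ) else 0) *
            Real.exp (-if z ∈ A then (1 : ℝ) else 0) := by
            refine Finset.sum_le_sum fun z _ => ?_
            split_ifs with h h'
            · rw [← Real.exp_add, neg_add]
            · rw [← Real.exp_add, neg_add]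
            · positivity
            · positivity
        _ ≤ Real.exp (-∑ i, if c i ∈ A then (1 : ℝ) else 0) *
            ((seqFeas T ok c).card - A.card / 4) := by
            rw [← Finset.mul_sum]
            exact mul_le_mul_of_nonneg_left h1 (Real.exp_pos _).le
        _ ≤ Real.exp (-∑ i, if c i ∈ A then (1 : ℝ) else 0) *
            (Real.exp (-(A.card / (4 * T.card))) * (seqFeas T ok c).card) := by
            refine mul_le_mul_of_nonneg_left ?_ (Real.exp_pos _).le
            have h4 := Real.add_one_le_exp (-((A.card : ℝ) / (4 * T.card)))
            have h5 : (A.card : ℝ) / (4 * T.card) * (seqFeas T ok c).card ≤ A.card / 4 := by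
              rw [div_mul_eq_mul_div, div_le_div_iff₀ (by positivity) (by norm_num)]
              nlinarith [Nat.cast_nonneg (α := ℝ) A.card]
            nlinarith [Nat.cast_nonneg (α := ℝ) (seqFeas T ok c).card]
        _ = _ := by ring)
  refine h.trans (le_of_eq ?_)
  rw [Finset.prod_const, card_range, ← Real.exp_nat_mul, mul_neg]

/-- The number of entries falling in `A` is rarely much below its typical value. -/
lemma Sparse.hits (hS : Sparse T ok M b F) (hM : 8 * (M * b) ≤ F) {A : Finset X} (hA : A ⊆ T) :
    seqExp T ok M (fun c => if (∑ i, if c i ∈ A then (1 : ℝ) else 0) <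
      M * (A.card / (8 * T.card)) then 1 else 0) ≤
      Real.exp (-(M * (A.card / (8 * T.card)))) + Real.exp (-(A.card / (4 * b))) := by
  have hF := hS.F_pos
  have hb := hS.b_pos
  have hT := hS.card_pos
  have h1 := hS.seqExp_hits_le hA
  have h2 := hS.seqExp_exp_excl_le hA
  have h3 : Real.exp (-(A.card / (2 * b))) * Real.exp (M * (2 * A.card / F)) ≤
      Real.exp (-(A.card / (4 * b))) := by
    rw [← Real.exp_add]
    refine Real.exp_le_exp.2 ?_
    have : (M : ℝ) * (2 * A.card / F) ≤ A.card / (4 * b) := by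
      rw [mul_div_assoc', div_le_div_iff₀ hF (by positivity)]
      nlinarith [Nat.cast_nonneg (α := ℝ) A.card]
    have h' : (A.card : ℝ) / (2 * b) = A.card / (4 * b) + A.card / (4 * b) := by
      field_simp; ring
    linarith
  have h4 : Real.exp (M * (A.card / (8 * T.card))) * Real.exp (-(M * (A.card / (4 * T.card)))) =
      Real.exp (-(M * (A.card / (8 * T.card)))) := by
    rw [← Real.exp_add]
    congr 1
    field_simp
    ring
  have h5 := mul_le_mul_of_nonneg_left h1 (Real.exp_pos (M * (A.card / (8 * T.card)))).le
  have h6 := mul_le_mul_of_nonneg_left h2 (Real.exp_pos (-((A.card : ℝ) / (2 * b)))).le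
  rw [h4, ← seqExp_mul_left] at h5
  rw [← seqExp_mul_left] at h6
  refine le_trans ?_ (add_le_add h5 (h6.trans h3))
  rw [← seqExp_add]
  refine seqExp_mono fun c _ => ?_
  split_ifs with hc hU hU
  · have : 1 ≤ Real.exp (M * (A.card / (8 * T.card))) *
        Real.exp (-∑ i, if c i ∈ A then (1 : ℝ) else 0) := by
      rw [← Real.exp_add]
      exact Real.one_le_exp (by linarith)
    have := Real.exp_pos (-((A.card : ℝ) / (2 * b)))
    have := Real.exp_pos ((∑ i, excl ok A (c i)) / b)
    nlinarith
  · rw [mul_zero, zero_add, ← Real.exp_add]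
    refine Real.one_le_exp ?_
    push Not at hU
    have : (A.card : ℝ) / (2 * b) ≤ (∑ i, excl ok A (c i)) / b := by
      rw [div_le_div_iff₀ (by positivity) hb]
      nlinarith
    linarith
  · positivity
  · positivity

end Sequential

section Sequential

variable {X : Type} [Fintype X] {T : Finset X} {ok : X → X → Prop} {M : ℕ} {b F : ℝ}

lemma Sparse.seqExp_at_ge (hS : Sparse T ok M b F) (m : Fin M) {x : X} (hx : x ∈ T)
    (u : (Fin m → X) → ℝ) (hu : ∀ c, 0 ≤ u c) :
    (T.card : ℝ)⁻¹ * (seqExp T ok M (fun c => u fun j => c (Fin.castLE m.2.le j)) -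
      ∑ j : Fin m, seqExp T ok M (fun c => u (fun j => c (Fin.castLE m.2.le j)) *
        if ¬ ok x (c (Fin.castLE m.2.le j)) then 1 else 0)) ≤
    seqExp T ok M (fun c => u (fun j => c (Fin.castLE m.2.le j)) *
      if c m = x then 1 else 0) := by
  have h1 := hS.seqExp_prefix (k := m + 1) (m := M) m.2 le_rfl
    (fun c => u (fun j => c j.castSucc) * if c (Fin.last m) = x then 1 else 0)
  have h2 := hS.seqExp_prefix (k := m) (m := M) m.2.le le_rfl u
  have h3 := fun j : Fin m => hS.seqExp_prefix (k := m) (m := M) m.2.le le_rfl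
    (fun c => u c * if ¬ ok x (c j) then 1 else 0)
  have h1' : seqExp T ok M (fun c => u (fun j => c (Fin.castLE m.2.le j)) *
      if c m = x then 1 else 0) = _ := h1
  rw [h1', h2, seqExp_succ]
  simp only [h3]
  rw [← seqExp_sum, ← seqExp_sub, ← seqExp_mul_left]
  refine seqExp_mono fun c hc => ?_
  have hT := fun i => (seqProb_support hc i).1
  have hpos := hS.card_feas_pos m.2.le hT
  have hle : ((seqFeas T ok c).card : ℝ) ≤ T.card := by
    exact_mod_cast Finset.card_le_card (Finset.filter_subset _ _)
  simp only [Fin.snoc_castSucc, Fin.snoc_last]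
  rw [← Finset.mul_sum, ← Finset.mul_sum, Finset.sum_ite_eq']
  have hinv : (T.card : ℝ)⁻¹ ≤ ((seqFeas T ok c).card : ℝ)⁻¹ := inv_anti₀ hpos hle
  have hTp : 0 < (T.card : ℝ)⁻¹ := inv_pos.2 hS.card_pos
  by_cases hall : ∀ j, ok x (c j)
  · rw [if_pos (by simp [seqFeas, hx, hall])]
    have : (∑ i, if ¬ ok x (c i) then (1 : ℝ) else 0) = 0 :=
      Finset.sum_eq_zero fun i _ => by simp [hall i]
    rw [this, mul_zero, sub_zero, mul_one]
    exact mul_le_mul_of_nonneg_right hinv (hu c)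
  · rw [if_neg (by simpa [seqFeas, hx] using hall)]
    push Not at hall
    obtain ⟨j, hj⟩ := hall
    have : (1 : ℝ) ≤ ∑ i, if ¬ ok x (c i) then (1 : ℝ) else 0 := by
      refine le_trans (by simp [hj]) (Finset.single_le_sum
        (f := fun i => if ¬ ok x (c i) then (1 : ℝ) else 0)
        (fun i _ => by split_ifs <;> norm_num) (mem_univ j))
    have := hu c
    rw [mul_zero, mul_zero]
    refine mul_nonpos_of_nonneg_of_nonpos hTp.le ?_
    nlinarith

lemma Sparse.forbid' (hS : Sparse T ok M b F) {x : X} (hx : x ∈ T) :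
    (∑ z ∈ T, if ¬ ok x z then (1 : ℝ) else 0) ≤ b := by
  rw [Finset.sum_boole]
  refine le_trans (le_of_eq ?_) (hS.forbid x hx)
  congr 2
  exact Finset.filter_congr fun z _ => not_congr ⟨hS.symm _ _, hS.symm _ _⟩

lemma Sparse.seqExp_point_ge (hS : Sparse T ok M b F) (m : Fin M) {x : X} (hx : x ∈ T) :
    (T.card : ℝ)⁻¹ * (1 - M * b / F) ≤ seqExp T ok M (fun c => if c m = x then 1 else 0) := by
  have h := hS.seqExp_at_ge m hx (fun _ => 1) (fun _ => zero_le_one)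
  simp only [one_mul, hS.seqExp_one le_rfl] at h
  refine le_trans (mul_le_mul_of_nonneg_left ?_ (inv_pos.2 hS.card_pos).le) h
  have hF := hS.F_pos
  have hb := hS.b_pos
  have : ∀ j : Fin m, seqExp T ok M (fun c => if ¬ ok x (c (Fin.castLE m.2.le j)) then 1 else 0) ≤
      b / F := by
    intro j
    refine (hS.seqExp_one_le (Fin.castLE m.2.le j) (fun z => if ¬ ok x z then 1 else 0)
      (fun z => by split_ifs <;> norm_num)).trans ?_
    rw [inv_mul_eq_div]
    gcongr
    exact hS.forbid' hx
  have h2 := Finset.sum_le_card_nsmul (univ : Finset (Fin m)) _ _ fun j _ => this j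
  simp only [card_univ, Fintype.card_fin, nsmul_eq_mul] at h2
  have h3 : (m : ℝ) * (b / F) ≤ M * b / F := by
    rw [mul_div_assoc]
    gcongr
    exact m.2.le
  linarith

lemma Sparse.seqExp_pair_ge (hS : Sparse T ok M b F) {m m' : Fin M} (hm : m < m') {x x' : X}
    (hx : x ∈ T) (hx' : x' ∈ T) (hok : ok x' x) :
    (T.card : ℝ)⁻¹ * ((T.card : ℝ)⁻¹ * (1 - M * b / F) - M * b / F ^ 2) ≤
      seqExp T ok M (fun c => (if c m = x then 1 else 0) * if c m' = x' then 1 else 0) := by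
  have hm' : (m : ℕ) < m' := hm
  have h := hS.seqExp_at_ge m' hx' (fun c => if c ⟨m, hm'⟩ = x then 1 else 0)
    (fun _ => by split_ifs <;> norm_num)
  have e : Fin.castLE m'.2.le ⟨(m : ℕ), hm'⟩ = m := rfl
  simp only [e] at h
  refine le_trans (mul_le_mul_of_nonneg_left ?_ (inv_pos.2 hS.card_pos).le) h
  have hF := hS.F_pos
  have hb := hS.b_pos
  have h1 := hS.seqExp_point_ge m hx
  have : ∀ j : Fin m', seqExp T ok M (fun c => (if c m = x then 1 else 0) *
      if ¬ ok x' (c (Fin.castLE m'.2.le j)) then 1 else 0) ≤ b / F ^ 2 := by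
    intro j
    by_cases hj : m = Fin.castLE m'.2.le j
    · rw [seqExp_eq_zero]
      · positivity
      · intro c _
        rw [← hj]
        by_cases h1 : c m = x
        · simp [h1, hok]
        · simp [h1]
    · refine (hS.seqExp_two_le hj (fun y z => (if y = x then 1 else 0) * if ¬ ok x' z then 1 else 0)
        (fun y z => by split_ifs <;> norm_num)).trans ?_
      simp only [← Finset.mul_sum]
      rw [← Finset.sum_mul, Finset.sum_ite_eq', if_pos hx, one_mul, inv_pow, inv_mul_eq_div]
      gcongr
      exact hS.forbid' hx'
  have h2 := Finset.sum_le_card_nsmul (univ : Finset (Fin m')) _ _ fun j _ => this j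
  simp only [card_univ, Fintype.card_fin, nsmul_eq_mul] at h2
  have h3 : (m' : ℝ) * (b / F ^ 2) ≤ M * b / F ^ 2 := by
    rw [mul_div_assoc]
    gcongr
    exact m'.2.le
  linarith

/-- A `0`-`1` relation between compatible elements of `T` with constant row and column sums. -/
structure Regular (T : Finset X) (ok : X → X → Prop) (a : X → X → ℝ) (s : ℝ) : Prop where
  zero_or_one : ∀ x y, a x y = 0 ∨ a x y = 1
  ok : ∀ x y, a x y ≠ 0 → ok y x
  row : ∀ x ∈ T, ∑ y ∈ T, a x y = s
  col : ∀ y ∈ T, ∑ x ∈ T, a x y = s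

lemma Regular.nonneg {a : X → X → ℝ} {s : ℝ} (ha : Regular T ok a s) (x y : X) : 0 ≤ a x y := by
  rcases ha.zero_or_one x y with h | h <;> simp [h]

lemma Regular.le_one {a : X → X → ℝ} {s : ℝ} (ha : Regular T ok a s) (x y : X) : a x y ≤ 1 := by
  rcases ha.zero_or_one x y with h | h <;> simp [h]

lemma Sparse.seqExp_rel_ge (hS : Sparse T ok M b F) {ρ : ℝ} (hρ : ρ ≤ 1)
    (h1 : M * b ≤ ρ * F) (h2 : T.card ≤ (1 + ρ) * F) {a : X → X → ℝ} {s : ℝ}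
    (ha : Regular T ok a s) {i j : Fin M} (hij : i < j) :
    s / T.card * (1 - 3 * ρ) ≤ seqExp T ok M (fun c => a (c i) (c j)) := by
  have hF := hS.F_pos
  have hb := hS.b_pos
  have hT := hS.card_pos
  have hρ0 : 0 ≤ ρ := by
    have : 0 ≤ ρ * F := le_trans (by positivity) h1
    exact nonneg_of_mul_nonneg_left this hF
  have e : seqExp T ok M (fun c => a (c i) (c j)) = ∑ x ∈ T, ∑ y ∈ T, a x y *
      seqExp T ok M (fun c => (if c i = x then 1 else 0) * if c j = y then 1 else 0) := by
    simp only [← seqExp_mul_left, ← seqExp_sum]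
    refine seqExp_congr fun c hc => ?_
    rw [Finset.sum_eq_single (c i), Finset.sum_eq_single (c j)]
    · simp
    · intro y _ hy
      simp [hy.symm]
    · intro h
      exact absurd (seqProb_support hc j).1 h
    · intro x _ hx
      simp [hx.symm]
    · intro h
      exact absurd (seqProb_support hc i).1 h
  have hLB : (T.card : ℝ)⁻¹ * (T.card : ℝ)⁻¹ * (1 - 3 * ρ) ≤
      (T.card : ℝ)⁻¹ * ((T.card : ℝ)⁻¹ * (1 - M * b / F) - M * b / F ^ 2) := by
    rw [mul_assoc]
    refine mul_le_mul_of_nonneg_left ?_ (inv_pos.2 hT).le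
    have h3 : M * b / F ≤ ρ := (div_le_iff₀ hF).2 h1
    have h4 : M * b / F ^ 2 ≤ (T.card : ℝ)⁻¹ * (2 * ρ) := by
      rw [inv_mul_eq_div, div_le_div_iff₀ (by positivity) hT]
      have : (T.card : ℝ) ≤ 2 * F := by nlinarith
      calc M * b * T.card ≤ ρ * F * (2 * F) := by gcongr
        _ = _ := by ring
    have := mul_le_mul_of_nonneg_left h3 (inv_pos.2 hT).le
    nlinarith
  rw [e]
  calc s / T.card * (1 - 3 * ρ)
      = ∑ x ∈ T, ∑ y ∈ T, a x y * ((T.card : ℝ)⁻¹ * (T.card : ℝ)⁻¹ * (1 - 3 * ρ)) := by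
        simp only [← Finset.sum_mul]
        rw [Finset.sum_congr rfl ha.row, Finset.sum_const, nsmul_eq_mul]
        field_simp
    _ ≤ _ := by
        refine Finset.sum_le_sum fun x hx => Finset.sum_le_sum fun y hy => ?_
        by_cases h0 : a x y = 0
        · simp [h0]
        · exact mul_le_mul_of_nonneg_left
            (hLB.trans (hS.seqExp_pair_ge hij hx hy (ha.ok x y h0))) (ha.nonneg _ _)

lemma Sparse.seqExp_rel_mul_le (hS : Sparse T ok M b F) {ρ : ℝ} (hρ0 : 0 ≤ ρ)
    (h2 : T.card ≤ (1 + ρ) * F) {a : X → X → ℝ} {s : ℝ} (hs : 0 ≤ s)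
    (ha : Regular T ok a s) {i j k l : Fin M} (hij : i < j) (hil : i < l) (hkj : k < j)
    (hkl : k < l) :
    seqExp T ok M (fun c => a (c i) (c j) * a (c k) (c l)) ≤
      (1 + ρ) ^ 4 * ((s / T.card) ^ 2 + if i = k ∧ j = l then s / T.card else 0) := by
  have hF := hS.F_pos
  have hT := hS.card_pos
  have hinv : F⁻¹ ≤ (1 + ρ) * (T.card : ℝ)⁻¹ := by
    rw [← div_eq_mul_inv, le_div_iff₀ hT, inv_mul_le_iff₀ hF, mul_comm]
    exact h2
  have hFi : 0 ≤ F⁻¹ := (inv_pos.2 hF).le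
  have h1 : 1 ≤ 1 + ρ := by linarith
  have hite : (0 : ℝ) ≤ if i = k ∧ j = l then s / T.card else 0 := by
    split_ifs <;> positivity
  by_cases hik : i = k
  · subst hik
    by_cases hjl : j = l
    · subst hjl
      simp only [and_self, if_true]
      refine (hS.seqExp_two_le hij.ne (fun x y => a x y * a x y)
        fun x y => mul_nonneg (ha.nonneg _ _) (ha.nonneg _ _)).trans ?_
      have : ∑ x ∈ T, ∑ y ∈ T, a x y * a x y ≤ T.card * s := by
        refine (Finset.sum_le_card_nsmul T _ s fun x hx => ?_).trans (by simp)
        rw [← ha.row x hx]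
        exact Finset.sum_le_sum fun y _ => mul_le_of_le_one_left (ha.nonneg _ _) (ha.le_one _ _)
      calc _ ≤ ((1 + ρ) * (T.card : ℝ)⁻¹) ^ 2 * (T.card * s) := by
            gcongr
            exact Finset.sum_nonneg fun x _ => Finset.sum_nonneg fun y _ => mul_self_nonneg _
        _ = (1 + ρ) ^ 2 * (s / T.card) := by field_simp
        _ ≤ (1 + ρ) ^ 4 * (s / T.card) := by
            gcongr
            norm_num
        _ ≤ _ := by
            gcongr
            have := sq_nonneg (s / (T.card : ℝ))
            linarith
    · refine (hS.seqExp_three_le hij.ne hil.ne hjl (fun x y z => a x y * a x z)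
        fun x y z => mul_nonneg (ha.nonneg _ _) (ha.nonneg _ _)).trans ?_
      have : ∑ x ∈ T, ∑ y ∈ T, ∑ z ∈ T, a x y * a x z = T.card * (s * s) := by
        simp only [← Finset.mul_sum, ← Finset.sum_mul]
        rw [Finset.sum_congr rfl fun x hx => by rw [ha.row x hx]]
        simp
      rw [this]
      calc _ ≤ ((1 + ρ) * (T.card : ℝ)⁻¹) ^ 3 * (T.card * (s * s)) := by gcongr
        _ = (1 + ρ) ^ 3 * (s / T.card) ^ 2 := by field_simp
        _ ≤ (1 + ρ) ^ 4 * (s / T.card) ^ 2 := by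
            gcongr
            norm_num
        _ ≤ _ := by
            gcongr
            linarith
  · by_cases hjl : j = l
    · subst hjl
      refine (hS.seqExp_three_le hik hij.ne hkj.ne (fun x y z => a x z * a y z)
        fun x y z => mul_nonneg (ha.nonneg _ _) (ha.nonneg _ _)).trans ?_
      have : ∑ x ∈ T, ∑ y ∈ T, ∑ z ∈ T, a x z * a y z = T.card * (s * s) := by
        rw [Finset.sum_congr rfl fun x _ => Finset.sum_comm, Finset.sum_comm]
        simp only [← Finset.mul_sum, ← Finset.sum_mul]
        rw [Finset.sum_congr rfl fun x hx => by rw [ha.col x hx]]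
        simp
      rw [this]
      calc _ ≤ ((1 + ρ) * (T.card : ℝ)⁻¹) ^ 3 * (T.card * (s * s)) := by gcongr
        _ = (1 + ρ) ^ 3 * (s / T.card) ^ 2 := by field_simp
        _ ≤ (1 + ρ) ^ 4 * (s / T.card) ^ 2 := by
            gcongr
            norm_num
        _ ≤ _ := by
            gcongr
            linarith
    · refine (hS.seqExp_four_le hij.ne hik hil.ne hkj.ne' hjl hkl.ne
        (fun x y z w => a x y * a z w)
        fun x y z w => mul_nonneg (ha.nonneg _ _) (ha.nonneg _ _)).trans ?_
      have : ∑ x ∈ T, ∑ y ∈ T, ∑ z ∈ T, ∑ w ∈ T, a x y * a z w =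
          (T.card * s) * (T.card * s) := by
        simp only [← Finset.mul_sum, ← Finset.sum_mul]
        rw [Finset.sum_congr rfl ha.row]
        simp
      rw [this]
      calc _ ≤ ((1 + ρ) * (T.card : ℝ)⁻¹) ^ 4 * (T.card * s * (T.card * s)) := by gcongr
        _ = (1 + ρ) ^ 4 * (s / T.card) ^ 2 := by field_simp
        _ ≤ _ := by
            gcongr
            linarith

/-- Chebyshev bound for the number of related pairs. -/
lemma Sparse.chebyshev (hS : Sparse T ok M b F) {ρ : ℝ} (hρ0 : 0 ≤ ρ) (hρ : ρ ≤ 1)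
    (h1 : M * b ≤ ρ * F) (h2 : T.card ≤ (1 + ρ) * F) {a : X → X → ℝ} {s : ℝ} (hs : 0 < s)
    (ha : Regular T ok a s) {I J : Finset (Fin M)} (hI : I.Nonempty) (hJ : J.Nonempty)
    (hIJ : ∀ i ∈ I, ∀ j ∈ J, i < j) {μ : ℝ} (hμ : μ = I.card * J.card * (s / T.card)) :
    seqExp T ok M (fun c => if ∑ i ∈ I, ∑ j ∈ J, a (c i) (c j) < μ / 2 then 1 else 0) ≤
      84 * ρ + 64 / μ := by
  have hT := hS.card_pos
  have hI' : (0 : ℝ) < I.card := by exact_mod_cast hI.card_pos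
  have hJ' : (0 : ℝ) < J.card := by exact_mod_cast hJ.card_pos
  have hp : 0 < s / T.card := by positivity
  have hμ0 : 0 < μ := by rw [hμ]; positivity
  set N : (Fin M → X) → ℝ := fun c => ∑ i ∈ I, ∑ j ∈ J, a (c i) (c j) with hN
  have hE1 : μ * (1 - 3 * ρ) ≤ seqExp T ok M N := by
    rw [hN, seqExp_sum]
    simp only [seqExp_sum]
    calc μ * (1 - 3 * ρ) = ∑ i ∈ I, ∑ j ∈ J, s / T.card * (1 - 3 * ρ) := by
          simp [hμ]; ring
      _ ≤ _ := Finset.sum_le_sum fun i hi => Finset.sum_le_sum fun j hj =>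
          hS.seqExp_rel_ge hρ h1 h2 ha (hIJ i hi j hj)
  have hE2 : seqExp T ok M (fun c => N c * N c) ≤ (1 + ρ) ^ 4 * (μ ^ 2 + μ) := by
    have : ∀ c, N c * N c = ∑ i ∈ I, ∑ j ∈ J, ∑ k ∈ I, ∑ l ∈ J,
        a (c i) (c j) * a (c k) (c l) := by
      intro c
      simp only [hN, ← Finset.mul_sum, ← Finset.sum_mul]
    simp only [this, seqExp_sum]
    calc _ ≤ ∑ i ∈ I, ∑ j ∈ J, ∑ k ∈ I, ∑ l ∈ J,
          (1 + ρ) ^ 4 * ((s / T.card) ^ 2 + if i = k ∧ j = l then s / T.card else 0) :=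
          Finset.sum_le_sum fun i hi => Finset.sum_le_sum fun j hj =>
            Finset.sum_le_sum fun k hk => Finset.sum_le_sum fun l hl =>
              hS.seqExp_rel_mul_le hρ0 h2 hs.le ha (hIJ i hi j hj) (hIJ i hi l hl)
                (hIJ k hk j hj) (hIJ k hk l hl)
      _ = ∑ i ∈ I, ∑ j ∈ J, (1 + ρ) ^ 4 * (I.card * J.card * (s / T.card) ^ 2 + s / T.card) := by
          refine Finset.sum_congr rfl fun i hi => Finset.sum_congr rfl fun j hj => ?_
          simp only [← Finset.mul_sum, Finset.sum_add_distrib]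
          congr 1
          have : ∀ k, (∑ l ∈ J, if i = k ∧ j = l then s / T.card else 0) =
              if i = k then s / (T.card : ℝ) else 0 := by
            intro k
            by_cases h : i = k <;> simp [h, hj]
          simp only [this, Finset.sum_ite_eq, hi, if_true]
          simp
          ring
      _ = _ := by
          simp [hμ]
          ring
  have hK : (1 + ρ) ^ 4 ≤ 1 + 15 * ρ := by
    nlinarith [mul_nonneg hρ0 hρ0, mul_nonneg hρ0 (mul_nonneg hρ0 hρ0), mul_nonneg hρ0 (sub_nonneg.2 hρ),
      mul_nonneg (mul_nonneg hρ0 hρ0) (sub_nonneg.2 hρ),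
      mul_nonneg (mul_nonneg hρ0 (mul_nonneg hρ0 hρ0)) (sub_nonneg.2 hρ)]
  have hV : seqExp T ok M (fun c => (N c - μ) ^ 2) ≤ 21 * ρ * μ ^ 2 + 16 * μ := by
    have e : ∀ c, (N c - μ) ^ 2 = N c * N c - 2 * μ * N c + μ ^ 2 * 1 := fun c => by ring
    simp only [e]
    rw [seqExp_add, seqExp_sub, seqExp_mul_left, seqExp_mul_left, hS.seqExp_one le_rfl]
    have : (1 + ρ) ^ 4 * (μ ^ 2 + μ) ≤ (1 + 15 * ρ) * μ ^ 2 + 16 * μ := by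
      have h16 : (1 + ρ) ^ 4 ≤ 16 := by linarith
      nlinarith [mul_le_mul_of_nonneg_right hK (sq_nonneg μ), mul_le_mul_of_nonneg_right h16 hμ0.le]
    nlinarith [mul_le_mul_of_nonneg_left hE1 (by positivity : 0 ≤ 2 * μ)]
  have hM : seqExp T ok M (fun c => if N c < μ / 2 then 1 else 0) ≤
      4 / μ ^ 2 * seqExp T ok M (fun c => (N c - μ) ^ 2) := by
    rw [← seqExp_mul_left]
    refine seqExp_mono fun c _ => ?_
    split_ifs with h
    · rw [div_mul_eq_mul_div, le_div_iff₀ (by positivity)]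
      nlinarith
    · positivity
  refine hM.trans ((mul_le_mul_of_nonneg_left hV (by positivity)).trans (le_of_eq ?_))
  field_simp
  ring

end Sequential

section Basics

variable {γ κ : Type} [Fintype γ] [Fintype κ]

lemma push_nonneg (f : γ → κ) {p : γ → ℝ} (hp : ∀ a, 0 ≤ p a) (c : κ) : 0 ≤ push f p c :=
  Finset.sum_nonneg fun a _ => by split_ifs; exacts [hp a, le_rfl]

lemma sum_push (f : γ → κ) (p : γ → ℝ) : ∑ c, push f p c = ∑ a, p a := by
  simp only [push]
  rw [Finset.sum_comm]
  simp

lemma IsDist.push (f : γ → κ) {p : γ → ℝ} (hp : IsDist p) : IsDist (push f p) :=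
  ⟨push_nonneg f hp.1, (sum_push f p).trans hp.2⟩

lemma continuous_push (f : γ → κ) : Continuous (push f : (γ → ℝ) → κ → ℝ) := by
  refine continuous_pi fun c => continuous_finsetSum _ fun a _ => ?_
  split_ifs
  · exact continuous_apply a
  · exact continuous_const

lemma continuous_Ent : Continuous (Ent : (γ → ℝ) → ℝ) :=
  continuous_finsetSum _ fun a _ => Real.continuous_negMulLog.comp (continuous_apply a)

lemma isCompact_isDist : IsCompact {p : γ → ℝ | IsDist p} := isCompact_stdSimplex ℝ γ

lemma IsDist.le_one {p : γ → ℝ} (hp : IsDist p) (a : γ) : p a ≤ 1 := by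
  rw [← hp.2]
  exact Finset.single_le_sum (fun a _ => hp.1 a) (mem_univ a)

/-- Convex combination of two weight functions. -/
def mix (t : ℝ) (p q : γ → ℝ) : γ → ℝ := fun a => (1 - t) * p a + t * q a

lemma IsDist.mix {t : ℝ} (h0 : 0 ≤ t) (h1 : t ≤ 1) {p q : γ → ℝ} (hp : IsDist p)
    (hq : IsDist q) : IsDist (mix t p q) := by
  refine ⟨fun a => ?_, ?_⟩
  · have := hp.1 a
    have := hq.1 a
    have : 0 ≤ 1 - t := by linarith
    unfold RGV.mix
    positivity
  · simp only [RGV.mix, Finset.sum_add_distrib, ← Finset.mul_sum, hp.2, hq.2]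
    ring

lemma push_mix (f : γ → κ) (t : ℝ) (p q : γ → ℝ) :
    push f (mix t p q) = mix t (push f p) (push f q) := by
  funext c
  simp only [push, mix, Finset.mul_sum, ← Finset.sum_add_distrib]
  exact Finset.sum_congr rfl fun a _ => by split_ifs <;> simp

lemma mix_self (t : ℝ) (p : γ → ℝ) : mix t p p = p := by
  funext a
  simp only [mix]
  ring

lemma abs_mix_sub_le {t : ℝ} (h0 : 0 ≤ t) {p q : γ → ℝ} (hp : IsDist p)
    (hq : IsDist q) (a : γ) : |mix t p q a - p a| ≤ t := by
  have : mix t p q a - p a = t * (q a - p a) := by simp only [mix]; ring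
  rw [this, abs_mul, abs_of_nonneg h0]
  refine mul_le_of_le_one_right h0 (abs_le.2 ⟨?_, ?_⟩)
  · linarith [hq.1 a, hp.le_one a]
  · linarith [hp.1 a, hq.le_one a]

lemma Ent_mix_ge {t : ℝ} (h0 : 0 ≤ t) (h1 : t ≤ 1) {p q : γ → ℝ} (hp : ∀ a, 0 ≤ p a)
    (hq : ∀ a, 0 ≤ q a) : (1 - t) * Ent p + t * Ent q ≤ Ent (mix t p q) := by
  simp only [Ent, Finset.mul_sum, ← Finset.sum_add_distrib]
  refine Finset.sum_le_sum fun a _ => ?_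
  have := Real.concaveOn_negMulLog.2 (hp a) (hq a) (by linarith : 0 ≤ 1 - t) h0 (by ring)
  simpa [mix, smul_eq_mul] using this

lemma exists_unif_cont {S : Set (γ → ℝ)} (hS : IsCompact S) {φ : (γ → ℝ) → ℝ}
    (hφ : ContinuousOn φ S) {ε : ℝ} (hε : 0 < ε) :
    ∃ η > 0, ∀ p ∈ S, ∀ q ∈ S, (∀ a, |p a - q a| ≤ η) → |φ p - φ q| ≤ ε := by
  obtain ⟨η, hη, h⟩ := Metric.uniformContinuousOn_iff_le.1
    (hS.uniformContinuousOn_of_continuous hφ) ε hε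
  refine ⟨η, hη, fun p hp q hq hpq => ?_⟩
  have := h p hp q hq ((dist_pi_le_iff hη.le).2 fun a => by rw [Real.dist_eq]; exact hpq a)
  rwa [Real.dist_eq] at this

end Basics

section Coupling

variable {α β : Type} [Fintype α] [Fintype β]

lemma mutInf_eq {P : α × β → ℝ} (hP : ∀ p, 0 ≤ P p) :
    mutInf P = Ent (push Prod.fst P) + Ent (push Prod.snd P) - Ent P := by
  have h1 : Ent (push Prod.fst P) =
      -∑ p : α × β, P p * Real.log (push Prod.fst P p.1) := by
    simp only [Ent, Real.negMulLog, Fintype.sum_prod_type, ← Finset.sum_neg_distrib]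
    refine Finset.sum_congr rfl fun a _ => ?_
    rw [push_fst_apply, Finset.sum_neg_distrib, ← Finset.sum_mul, neg_mul]
  have h2 : Ent (push Prod.snd P) =
      -∑ p : α × β, P p * Real.log (push Prod.snd P p.2) := by
    simp only [Ent, Real.negMulLog, Fintype.sum_prod_type_right, ← Finset.sum_neg_distrib]
    refine Finset.sum_congr rfl fun a _ => ?_
    rw [push_snd_apply, Finset.sum_neg_distrib, ← Finset.sum_mul, neg_mul]
  rw [h1, h2, mutInf, Ent]
  simp only [Real.negMulLog, neg_mul, Finset.sum_neg_distrib]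
  rw [sub_neg_eq_add, ← Finset.sum_neg_distrib, ← Finset.sum_neg_distrib,
    ← Finset.sum_add_distrib, ← Finset.sum_add_distrib]
  refine Finset.sum_congr rfl fun p _ => ?_
  rw [← push_fst_apply, ← push_snd_apply]
  rcases (hP p).eq_or_lt with h | h
  · simp [← h]
  have hA : 0 < push Prod.fst P p.1 := by
    rw [push_fst_apply]
    exact h.trans_le (Finset.single_le_sum (f := fun b => P (p.1, b)) (fun b _ => hP _)
      (mem_univ p.2))
  have hB : 0 < push Prod.snd P p.2 := by
    rw [push_snd_apply]
    exact h.trans_le (Finset.single_le_sum (f := fun a => P (a, p.2)) (fun b _ => hP _)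
      (mem_univ p.1))
  rw [Real.log_div h.ne' (mul_pos hA hB).ne', Real.log_mul hA.ne' hB.ne']
  ring

lemma continuousOn_mutInf : ContinuousOn (mutInf : (α × β → ℝ) → ℝ) {p | IsDist p} := by
  refine ContinuousOn.congr (Continuous.continuousOn ?_) fun P hP => mutInf_eq hP.1
  exact ((continuous_Ent.comp (continuous_push _)).add
    (continuous_Ent.comp (continuous_push _))).sub continuous_Ent

/-- `P` is a coupling of `Q` and `PY`. -/
structure Coup (Q : α → ℝ) (PY : β → ℝ) (P : α × β → ℝ) : Prop where
  nonneg : ∀ p, 0 ≤ P p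
  fst : push Prod.fst P = Q
  snd : push Prod.snd P = PY

lemma Coup.isDist {Q : α → ℝ} (hQ : IsDist Q) {PY : β → ℝ} {P : α × β → ℝ} (h : Coup Q PY P) :
    IsDist P := ⟨h.nonneg, by rw [← hQ.2, ← h.fst, sum_push]⟩

/-- The product distribution. -/
def prodD (Q : α → ℝ) (PY : β → ℝ) : α × β → ℝ := fun p => Q p.1 * PY p.2

lemma coup_prodD {Q : α → ℝ} (hQ : IsDist Q) {PY : β → ℝ} (hY : IsDist PY) :
    Coup Q PY (prodD Q PY) := by
  refine ⟨fun p => mul_nonneg (hQ.1 _) (hY.1 _), ?_, ?_⟩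
  · funext a
    simp only [push_fst_apply, prodD, ← Finset.mul_sum, hY.2, mul_one]
  · funext a
    simp only [push_snd_apply, prodD, ← Finset.sum_mul, hQ.2, one_mul]

lemma Ent_prodD {Q : α → ℝ} (hQ : IsDist Q) {PY : β → ℝ} (hY : IsDist PY) :
    Ent (prodD Q PY) = Ent Q + Ent PY := by
  simp only [Ent, prodD, Real.negMulLog_mul, Fintype.sum_prod_type, Finset.sum_add_distrib,
    ← Finset.mul_sum, ← Finset.sum_mul, hQ.2, hY.2, one_mul]

lemma mutInf_prodD {Q : α → ℝ} (hQ : IsDist Q) {PY : β → ℝ} (hY : IsDist PY) :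
    mutInf (prodD Q PY) = 0 := by
  have h := coup_prodD hQ hY
  rw [mutInf_eq h.nonneg, h.fst, h.snd, Ent_prodD hQ hY, sub_self]

lemma Coup.mix {t : ℝ} (h0 : 0 ≤ t) (h1 : t ≤ 1) {Q : α → ℝ} {PY : β → ℝ} {P P' : α × β → ℝ}
    (hP : Coup Q PY P) (hP' : Coup Q PY P') : Coup Q PY (mix t P P') := by
  refine ⟨fun p => ?_, ?_, ?_⟩
  · have := hP.nonneg p
    have := hP'.nonneg p
    have : 0 ≤ 1 - t := by linarith
    unfold RGV.mix
    positivity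
  · rw [push_mix, hP.fst, hP'.fst, mix_self]
  · rw [push_mix, hP.snd, hP'.snd, mix_self]

lemma Coup.mutInf_mix_le {t : ℝ} (h0 : 0 ≤ t) (h1 : t ≤ 1) {Q : α → ℝ} (hQ : IsDist Q)
    {PY : β → ℝ} (hY : IsDist PY) {P : α × β → ℝ} (hP : Coup Q PY P) :
    mutInf (RGV.mix t P (prodD Q PY)) ≤ (1 - t) * mutInf P := by
  have h := coup_prodD hQ hY
  have hm := hP.mix h0 h1 h
  rw [mutInf_eq hm.nonneg, hm.fst, hm.snd, mutInf_eq hP.nonneg, hP.fst, hP.snd]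
  have := Ent_mix_ge h0 h1 hP.nonneg h.nonneg
  rw [Ent_prodD hQ hY] at this
  linarith

/-- Small changes of the second marginal can be followed by small changes of the coupling. -/
lemma Coup.exists_near {Q : α → ℝ} (hQ : IsDist Q) {PY PY' : β → ℝ} (hY : IsDist PY)
    (hY' : IsDist PY') {P : α × β → ℝ} (hP : Coup Q PY P) {η : ℝ}
    (hη : ∀ y, |PY y - PY' y| ≤ η) : ∃ P', Coup Q PY' P' ∧ ∀ p, |P' p - P p| ≤ η := by
  let m : β → ℝ := fun y => min (PY y) (PY' y)
  let w : β → ℝ := fun y => m y / PY y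
  have hm0 : ∀ y, 0 ≤ m y := fun y => le_min (hY.1 y) (hY'.1 y)
  have hw0 : ∀ y, 0 ≤ w y := fun y => div_nonneg (hm0 y) (hY.1 y)
  have hw1 : ∀ y, w y ≤ 1 := fun y => div_le_one_of_le₀ (min_le_left _ _) (hY.1 y)
  have hwm : ∀ y, PY y * w y = m y := by
    intro y
    simp only [w]
    by_cases h : PY y = 0
    · have : m y = 0 := le_antisymm ((min_le_left _ _).trans h.le) (hm0 y)
      rw [h, this]; simp
    · field_simp
  have hsnd : ∀ y, ∑ a, P (a, y) = PY y := fun y => by rw [← push_snd_apply, hP.snd]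
  have hfst : ∀ a, ∑ y, P (a, y) = Q a := fun a => by rw [← push_fst_apply, hP.fst]
  let rQ : α → ℝ := fun a => Q a - ∑ y, P (a, y) * w y
  let rY : β → ℝ := fun y => PY' y - m y
  have hrQ0 : ∀ a, 0 ≤ rQ a := by
    intro a
    simp only [rQ, ← hfst, ← Finset.sum_sub_distrib]
    exact Finset.sum_nonneg fun y _ => by nlinarith [hP.nonneg (a, y), hw1 y]
  have hrY0 : ∀ y, 0 ≤ rY y := fun y => sub_nonneg.2 (min_le_right _ _)
  have hsum : ∑ a, rQ a = ∑ y, rY y := by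
    simp only [rQ, rY, Finset.sum_sub_distrib, hQ.2, hY'.2]
    rw [Finset.sum_comm]
    simp only [← Finset.sum_mul, hsnd, hwm]
  set r := ∑ y, rY y with hr
  have hr0 : 0 ≤ r := Finset.sum_nonneg fun y _ => hrY0 y
  have hrQr : ∀ a, rQ a ≤ r := fun a => by
    rw [← hsum]
    exact Finset.single_le_sum (f := rQ) (fun a _ => hrQ0 a) (mem_univ a)
  have hrYr : ∀ a, rY a ≤ r := fun a => by
    exact Finset.single_le_sum (f := rY) (fun a _ => hrY0 a) (mem_univ a)
  have hz : r = 0 → ∀ a, rQ a = 0 := fun h a => le_antisymm (h ▸ hrQr a) (hrQ0 a)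
  have hz' : r = 0 → ∀ a, rY a = 0 := fun h a => le_antisymm (h ▸ hrYr a) (hrY0 a)
  refine ⟨fun p => P p * w p.2 + rQ p.1 * rY p.2 / r, ⟨fun p => ?_, ?_, ?_⟩, fun p => ?_⟩
  · exact add_nonneg (mul_nonneg (hP.nonneg p) (hw0 _))
      (div_nonneg (mul_nonneg (hrQ0 _) (hrY0 _)) hr0)
  · funext a
    rw [push_fst_apply]
    simp only [Finset.sum_add_distrib, ← Finset.sum_div, ← Finset.mul_sum]
    rw [← hr]
    by_cases h : r = 0
    · have := hz h a
      simp only [rQ] at this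
      rw [h]
      simp
      linarith
    · rw [mul_div_assoc, div_self h, mul_one]
      simp [rQ]
  · funext y
    rw [push_snd_apply]
    simp only [Finset.sum_add_distrib, ← Finset.sum_div, ← Finset.sum_mul]
    rw [hsum, hsnd, hwm]
    by_cases h : r = 0
    · have := hz' h y
      simp only [rY] at this
      rw [h]
      simp
      linarith
    · rw [mul_comm, mul_div_assoc, div_self h, mul_one]
      simp [rY]
  · have hA0 : 0 ≤ P p * (1 - w p.2) := mul_nonneg (hP.nonneg p) (by linarith [hw1 p.2])
    have hA : P p * (1 - w p.2) ≤ PY p.2 - m p.2 := by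
      rw [← hwm, ← mul_one_sub]
      refine mul_le_mul_of_nonneg_right ?_ (by linarith [hw1 p.2])
      rw [← hsnd]
      exact Finset.single_le_sum (f := fun a => P (a, p.2)) (fun b _ => hP.nonneg _) (mem_univ p.1)
    have hB0 : 0 ≤ rQ p.1 * rY p.2 / r := div_nonneg (mul_nonneg (hrQ0 _) (hrY0 _)) hr0
    have hB : rQ p.1 * rY p.2 / r ≤ rY p.2 := by
      refine div_le_of_le_mul₀ hr0 (hrY0 _) ?_
      rw [mul_comm]
      exact mul_le_mul_of_nonneg_left (hrQr _) (hrY0 _)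
    have h1 : PY p.2 - m p.2 ≤ η := by
      have := abs_le.1 (hη p.2)
      have h0 := (abs_nonneg _).trans (hη p.2)
      simp only [m]
      rcases min_choice (PY p.2) (PY' p.2) with h | h <;> rw [h] <;> linarith
    have h2 : rY p.2 ≤ η := by
      have := abs_le.1 (hη p.2)
      have h0 := (abs_nonneg _).trans (hη p.2)
      simp only [rY, m]
      rcases min_choice (PY p.2) (PY' p.2) with h | h <;> rw [h] <;> linarith
    rw [abs_le]
    constructor <;> nlinarith

end Coupling

section Alpha

variable {α β : Type} [Fintype α] [Fintype β] {Q : α → ℝ} {g : (α × β → ℝ) → ℝ} {R : ℝ}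

/-- The objective maximized in `alphaF`. -/
def hfun (g : (α × β → ℝ) → ℝ) (R : ℝ) (P : α × β → ℝ) : ℝ := g P - mutInf P + R

lemma continuousOn_hfun (hg : Continuous g) : ContinuousOn (hfun g R) {p | IsDist p} :=
  (hg.continuousOn.sub continuousOn_mutInf).add continuousOn_const

lemma exists_jointOf {PY : β → ℝ} (hQ : IsDist Q) {P : α × β → ℝ} (hP : Coup Q PY P) :
    ∃ V' : β → α → ℝ, (∀ y, IsDist (V' y)) ∧ (∀ a, ∑ y, PY y * V' y a = Q a) ∧
      jointOf PY V' = P := by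
  have hsnd : ∀ y, ∑ a, P (a, y) = PY y := fun y => by rw [← push_snd_apply, hP.snd]
  have hfst : ∀ a, ∑ y, P (a, y) = Q a := fun a => by rw [← push_fst_apply, hP.fst]
  have key : ∀ y a, PY y * (if PY y = 0 then Q a else P (a, y) / PY y) = P (a, y) := by
    intro y a
    split_ifs with h
    · have h0 := hsnd y
      rw [h, Finset.sum_eq_zero_iff_of_nonneg fun a _ => hP.nonneg _] at h0
      rw [h, zero_mul, h0 a (mem_univ a)]
    · field_simp
  refine ⟨fun y a => if PY y = 0 then Q a else P (a, y) / PY y, fun y => ?_, fun a => ?_, ?_⟩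
  · by_cases h : PY y = 0
    · simpa [h] using hQ
    · simp only [h, if_false]
      have hpos : 0 ≤ PY y := by
        rw [← hsnd]; exact Finset.sum_nonneg fun a _ => hP.nonneg _
      exact ⟨fun a => div_nonneg (hP.nonneg _) hpos, by rw [← Finset.sum_div, hsnd, div_self h]⟩
  · simp only [key, hfst]
  · funext p
    exact key p.2 p.1

lemma coup_jointOf {PY : β → ℝ} (hY : IsDist PY) {V' : β → α → ℝ} (hV : ∀ y, IsDist (V' y))
    (h : ∀ a, ∑ y, PY y * V' y a = Q a) : Coup Q PY (jointOf PY V') := by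
  refine ⟨fun p => mul_nonneg (hY.1 _) ((hV _).1 _), ?_, ?_⟩
  · funext a
    rw [push_fst_apply]
    exact h a
  · funext y
    simp only [push_snd_apply, jointOf, ← Finset.mul_sum, (hV y).2, mul_one]

lemma alphaF_eq (hQ : IsDist Q) {PY : β → ℝ} (hY : IsDist PY) :
    alphaF Q g R PY = sSup {v | ∃ P, Coup Q PY P ∧ mutInf P ≤ R ∧ v = g P - mutInf P} + R := by
  unfold alphaF
  congr 2
  ext v
  constructor
  · rintro ⟨V', hV, h, hI, rfl⟩
    exact ⟨_, coup_jointOf hY hV h, hI, rfl⟩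
  · rintro ⟨P, hP, hI, rfl⟩
    obtain ⟨V', hV, h, rfl⟩ := exists_jointOf hQ hP
    exact ⟨V', hV, h, hI, rfl⟩

lemma bddAbove_alpha (hQ : IsDist Q) (hg : Continuous g) (PY : β → ℝ) :
    BddAbove {v | ∃ P, Coup Q PY P ∧ mutInf P ≤ R ∧ v = g P - mutInf P} := by
  obtain ⟨C, hC⟩ := (isCompact_isDist (γ := α × β)).bddAbove_image
    (hg.continuousOn.sub continuousOn_mutInf)
  refine ⟨C, ?_⟩
  rintro v ⟨P, hP, -, rfl⟩
  exact hC ⟨P, hP.isDist hQ, rfl⟩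

lemma hfun_le_alphaF (hQ : IsDist Q) (hg : Continuous g) {PY : β → ℝ} (hY : IsDist PY)
    {P : α × β → ℝ} (hP : Coup Q PY P) (hI : mutInf P ≤ R) : hfun g R P ≤ alphaF Q g R PY := by
  rw [alphaF_eq hQ hY, hfun]
  gcongr
  exact le_csSup (bddAbove_alpha hQ hg PY) ⟨P, hP, hI, rfl⟩

lemma exists_alphaF_le (hQ : IsDist Q) (hR : 0 ≤ R) {PY : β → ℝ} (hY : IsDist PY)
    {ε : ℝ} (hε : 0 < ε) :
    ∃ P, Coup Q PY P ∧ mutInf P ≤ R ∧ alphaF Q g R PY ≤ hfun g R P + ε := by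
  have hne : {v | ∃ P, Coup Q PY P ∧ mutInf P ≤ R ∧ v = g P - mutInf P}.Nonempty :=
    ⟨_, prodD Q PY, coup_prodD hQ hY, by rwa [mutInf_prodD hQ hY], rfl⟩
  obtain ⟨v, ⟨P, hP, hI, rfl⟩, hv⟩ := exists_lt_of_lt_csSup hne (sub_lt_self _ hε)
  refine ⟨P, hP, hI, ?_⟩
  rw [alphaF_eq hQ hY, hfun]
  linarith

/-- Robust upper bound on the objective of `alphaF`. -/
lemma exists_hfun_le_alphaF (hQ : IsDist Q) (hg : Continuous g) (hR : 0 < R) {ε : ℝ}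
    (hε : 0 < ε) :
    ∃ η > 0, ∀ PY PY' : β → ℝ, IsDist PY → IsDist PY' → (∀ y, |PY y - PY' y| ≤ η) →
      ∀ P, Coup Q PY P → mutInf P ≤ R + η → hfun g R P ≤ alphaF Q g R PY' + ε := by
  obtain ⟨t₀, ht₀, h1⟩ := exists_unif_cont isCompact_isDist
    (continuousOn_hfun (α := α) (β := β) (R := R) hg) (half_pos hε)
  set t := min t₀ 1 with ht
  have ht0 : 0 < t := lt_min ht₀ one_pos
  have ht1 : t ≤ 1 := min_le_right _ _
  obtain ⟨κ, hκ, h2⟩ := exists_unif_cont isCompact_isDist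
    (continuousOn_mutInf (α := α) (β := β)) (by positivity : 0 < t * R / 2)
  refine ⟨min t₀ (min κ (t * R / 2)), by positivity, fun PY PY' hY hY' hYY P hP hI => ?_⟩
  obtain ⟨P', hP', hd⟩ := hP.exists_near hQ hY hY' hYY
  have hdP := hP.isDist hQ
  have hdP' := hP'.isDist hQ
  have hd' : ∀ p, |P' p - P p| ≤ κ := fun p =>
    (hd p).trans ((min_le_right _ _).trans (min_le_left _ _))
  have hI' := abs_le.1 (h2 _ hdP' _ hdP hd')
  have hh := abs_le.1 (h1 _ hdP' _ hdP fun p => (hd p).trans (min_le_left _ _))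
  have hη : min t₀ (min κ (t * R / 2)) ≤ t * R / 2 := (min_le_right _ _).trans (min_le_right _ _)
  have hmix := hP'.mix ht0.le ht1 (coup_prodD hQ hY')
  have hImix := hP'.mutInf_mix_le ht0.le ht1 hQ hY'
  have hle := hfun_le_alphaF hQ hg hY' hmix (R := R) (by
    refine hImix.trans ?_
    have : mutInf P' ≤ R + t * R := by linarith
    calc (1 - t) * mutInf P' ≤ (1 - t) * (R + t * R) := by
          exact mul_le_mul_of_nonneg_left this (by linarith)
      _ ≤ R := by nlinarith [mul_pos (mul_pos ht0 ht0) hR])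
  have hh2 := abs_le.1 (h1 _ (hmix.isDist hQ) _ hdP' fun p =>
    (abs_mix_sub_le ht0.le hdP' ((coup_prodD hQ hY').isDist hQ) p).trans (min_le_left _ _))
  linarith

lemma exists_alphaF_unif (hQ : IsDist Q) (hg : Continuous g) (hR : 0 < R) {ε : ℝ}
    (hε : 0 < ε) :
    ∃ η > 0, ∀ PY PY' : β → ℝ, IsDist PY → IsDist PY' → (∀ y, |PY y - PY' y| ≤ η) →
      alphaF Q g R PY ≤ alphaF Q g R PY' + ε := by
  obtain ⟨η, hη, h⟩ := exists_hfun_le_alphaF (β := β) hQ hg hR (half_pos hε)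
  refine ⟨η, hη, fun PY PY' hY hY' hYY => ?_⟩
  obtain ⟨P, hP, hI, hle⟩ := exists_alphaF_le (g := g) hQ hR.le hY (half_pos hε)
  have := h PY PY' hY hY' hYY P hP (by linarith)
  linarith

lemma continuousOn_alphaF (hQ : IsDist Q) (hg : Continuous g) (hR : 0 < R) :
    ContinuousOn (alphaF Q g R) {p | IsDist p} := by
  rw [Metric.continuousOn_iff]
  intro p hp ε hε
  obtain ⟨η, hη, h⟩ := exists_alphaF_unif (β := β) hQ hg hR (half_pos hε)
  refine ⟨η, hη, fun q hq hpq => ?_⟩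
  have hd : ∀ y, |q y - p y| ≤ η := fun y => by
    rw [← Real.dist_eq]; exact (dist_le_pi_dist q p y).trans hpq.le
  have h1 := h q p hq hp hd
  have h2 := h p q hp hq fun y => by rw [abs_sub_comm]; exact hd y
  rw [Real.dist_eq, abs_lt]
  constructor <;> linarith

end Alpha

section Rounding

variable {A B K : Type} [Fintype A] [Fintype B] [Fintype K] {n : ℕ}

/-- Rounding a distribution to an `n`-type while keeping two marginals. -/
lemma exists_rounding (hn : 0 < n) {τ : A × B × K → ℝ} (hτ : IsDist τ)
    (hA : IsTypeDist n (push (fun p => p.1) τ)) (hB : IsTypeDist n (push (fun p => p.2.1) τ))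
    (k₀ : A → K) :
    ∃ τ' : A × B × K → ℝ, IsDist τ' ∧ IsTypeDist n τ' ∧
      push (fun p => p.1) τ' = push (fun p => p.1) τ ∧
      push (fun p => p.2.1) τ' = push (fun p => p.2.1) τ ∧
      (∀ p, |τ' p - τ p| ≤ (Fintype.card (A × B × K) + 1) / n) ∧
      ∀ p, τ' p ≠ 0 → τ p ≠ 0 ∨ p.2.2 = k₀ p.1 := by
  have hn' : (0 : ℝ) < n := by exact_mod_cast hn
  choose qA hqA using hA
  choose qB hqB using hB
  let f : A × B × K → ℕ := fun p => ⌊τ p * n⌋₊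
  have hf : ∀ p, (f p : ℝ) ≤ τ p * n := fun p =>
    Nat.floor_le (mul_nonneg (hτ.1 p) hn'.le)
  have hf' : ∀ p, τ p * n ≤ f p + 1 := fun p => (Nat.lt_floor_add_one _).le
  have hmA : ∀ a, ∑ b, ∑ k, τ (a, b, k) = qA a / n := by
    intro a
    rw [eq_div_iff hn'.ne', ← hqA, push]
    congr 1
    rw [Fintype.sum_prod_type, Finset.sum_eq_single a]
    · simp [Fintype.sum_prod_type]
    · intro a' _ h
      simp [h]
    · simp
  have hmB : ∀ b, ∑ a, ∑ k, τ (a, b, k) = qB b / n := by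
    intro b
    rw [eq_div_iff hn'.ne', ← hqB, push]
    congr 1
    rw [Fintype.sum_prod_type]
    refine Finset.sum_congr rfl fun a _ => ?_
    rw [Fintype.sum_prod_type, Finset.sum_eq_single b]
    · simp
    · intro a' _ h
      simp [h]
    · simp
  have hleA : ∀ a, ∑ b, ∑ k, f (a, b, k) ≤ qA a := by
    intro a
    have : ((∑ b, ∑ k, f (a, b, k) : ℕ) : ℝ) ≤ qA a := by
      push_cast
      calc _ ≤ ∑ b, ∑ k, τ (a, b, k) * n :=
            Finset.sum_le_sum fun b _ => Finset.sum_le_sum fun k _ => hf _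
        _ = qA a := by
            simp only [← Finset.sum_mul, hmA]
            field_simp
    exact_mod_cast this
  have hleB : ∀ b, ∑ a, ∑ k, f (a, b, k) ≤ qB b := by
    intro b
    have : ((∑ a, ∑ k, f (a, b, k) : ℕ) : ℝ) ≤ qB b := by
      push_cast
      calc _ ≤ ∑ a, ∑ k, τ (a, b, k) * n :=
            Finset.sum_le_sum fun b _ => Finset.sum_le_sum fun k _ => hf _
        _ = qB b := by
            simp only [← Finset.sum_mul, hmB]
            field_simp
    exact_mod_cast this
  have hsA : ∑ a, qA a = n := by
    have : ((∑ a, qA a : ℕ) : ℝ) = n := by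
      push_cast
      simp only [← hqA]
      rw [← Finset.sum_mul, sum_push, hτ.2, one_mul]
    exact_mod_cast this
  have hsB : ∑ a, qB a = n := by
    have : ((∑ a, qB a : ℕ) : ℝ) = n := by
      push_cast
      simp only [← hqB]
      rw [← Finset.sum_mul, sum_push, hτ.2, one_mul]
    exact_mod_cast this
  let N := n - ∑ p, f p
  obtain ⟨u, hu⟩ := exists_seq_of_counts (fun a => qA a - ∑ b, ∑ k, f (a, b, k)) (N := N) (by
    rw [Finset.sum_tsub_distrib _ fun a _ => hleA a, hsA]
    simp only [N, Fintype.sum_prod_type])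
  obtain ⟨v, hv⟩ := exists_seq_of_counts (fun b => qB b - ∑ a, ∑ k, f (a, b, k)) (N := N) (by
    rw [Finset.sum_tsub_distrib _ fun a _ => hleB a, hsB]
    simp only [N, Fintype.sum_prod_type]
    rw [Finset.sum_comm])
  let e : A → B → ℕ := fun a b => (univ.filter fun i => u i = a ∧ v i = b).card
  have heA : ∀ a, ∑ b, e a b = qA a - ∑ b, ∑ k, f (a, b, k) := by
    intro a
    rw [← hu, Finset.card_eq_sum_card_fiberwise (f := v) (t := univ) (by simp)]
    simp only [e, Finset.filter_filter]
  have heB : ∀ b, ∑ a, e a b = qB b - ∑ a, ∑ k, f (a, b, k) := by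
    intro a
    rw [← hv, Finset.card_eq_sum_card_fiberwise (f := u) (t := univ) (by simp)]
    simp only [e, Finset.filter_filter, and_comm]
  let h : A × B × K → ℕ := fun p => f p + if p.2.2 = k₀ p.1 then e p.1 p.2.1 else 0
  have hhA : ∀ a, ∑ b, ∑ k, h (a, b, k) = qA a := by
    intro a
    simp only [h, Finset.sum_add_distrib, Finset.sum_ite_eq', mem_univ, if_true, heA]
    have := hleA a
    omega
  have hhB : ∀ b, ∑ a, ∑ k, h (a, b, k) = qB b := by
    intro b
    simp only [h, Finset.sum_add_distrib, Finset.sum_ite_eq', mem_univ, if_true, heB]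
    have := hleB b
    omega
  have hN : (N : ℝ) ≤ Fintype.card (A × B × K) := by
    have h1 : n ≤ ∑ p, (f p + 1) := by
      have : (n : ℝ) ≤ ((∑ p, (f p + 1) : ℕ) : ℝ) := by
        push_cast
        calc (n : ℝ) = ∑ p, τ p * n := by rw [← Finset.sum_mul, hτ.2, one_mul]
          _ ≤ _ := Finset.sum_le_sum fun p _ => hf' p
      exact_mod_cast this
    rw [Finset.sum_add_distrib] at h1
    simp only [sum_const, card_univ, smul_eq_mul, mul_one] at h1
    have : N ≤ Fintype.card (A × B × K) := by
      simp only [N]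
      omega
    exact_mod_cast this
  have he : ∀ a b, (e a b : ℝ) ≤ Fintype.card (A × B × K) := by
    intro a b
    refine le_trans ?_ hN
    have : e a b ≤ N := (Finset.card_le_univ _).trans (by simp)
    exact_mod_cast this
  refine ⟨fun p => h p / n, ⟨fun p => by positivity, ?_⟩, fun p => ⟨h p, by field_simp⟩, ?_, ?_,
    fun p => ?_, fun p hp => ?_⟩
  · rw [← Finset.sum_div, div_eq_one_iff_eq hn'.ne', ← Nat.cast_sum, ← hsA]
    simp only [Fintype.sum_prod_type, hhA]
  · funext a
    have h1 : push (fun p : A × B × K => p.1) τ a = qA a / n := by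
      rw [eq_div_iff hn'.ne', hqA]
    rw [h1, push, Fintype.sum_prod_type, Finset.sum_eq_single a]
    · simp only [if_true, ← Finset.sum_div, Fintype.sum_prod_type]
      rw [← hhA a]
      push_cast
      rfl
    · intro a' _ h
      simp [h]
    · simp
  · funext b
    have h1 : push (fun p : A × B × K => p.2.1) τ b = qB b / n := by
      rw [eq_div_iff hn'.ne', hqB]
    rw [h1, push, Fintype.sum_prod_type, ← hhB b]
    push_cast
    rw [Finset.sum_div]
    refine Finset.sum_congr rfl fun a _ => ?_
    rw [Fintype.sum_prod_type, Finset.sum_eq_single b]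
    · simp only [if_true, ← Finset.sum_div]
    · intro a' _ h
      simp [h]
    · simp
  · have e1 : (h p : ℝ) / n - τ p = (h p - τ p * n) / n := by field_simp
    rw [e1, abs_div, abs_of_pos hn']
    gcongr
    have h2 : (h p : ℝ) = f p + if p.2.2 = k₀ p.1 then (e p.1 p.2.1 : ℝ) else 0 := by
      simp only [h]
      push_cast
      rfl
    have h3 : (if p.2.2 = k₀ p.1 then (e p.1 p.2.1 : ℝ) else 0) ≤ Fintype.card (A × B × K) := by
      split_ifs
      · exact he _ _
      · positivity
    have h4 : (0 : ℝ) ≤ if p.2.2 = k₀ p.1 then (e p.1 p.2.1 : ℝ) else 0 := by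
      split_ifs <;> positivity
    rw [h2, abs_le]
    constructor
    · linarith [hf' p]
    · linarith [hf p]
  · by_contra hc
    push Not at hc
    apply hp
    simp [h, f, hc.1, hc.2]

end Rounding

section Rounding

variable {α β : Type} [Fintype α] [Fintype β] {Q : α → ℝ} {g : (α × β → ℝ) → ℝ} {R : ℝ}

lemma isTypeDist_emp {n : ℕ} (hn : 0 < n) (y : Fin n → β) : IsTypeDist n (emp n y) :=
  fun a => ⟨(univ.filter fun i => y i = a).card, by
    have : (n : ℝ) ≠ 0 := by positivity
    simp only [emp]
    field_simp⟩

lemma IsTypeDist.of_dvd {D n : ℕ} (h : IsTypeDist D Q) (hn : D ∣ n) : IsTypeDist n Q := by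
  obtain ⟨k, rfl⟩ := hn
  intro a
  obtain ⟨j, hj⟩ := h a
  exact ⟨j * k, by push_cast; rw [← hj]; ring⟩

lemma Coup.exists_rounding {n : ℕ} (hn : 0 < n) (hQ : IsDist Q) {PY : β → ℝ} {P : α × β → ℝ}
    (hP : Coup Q PY P) (htQ : IsTypeDist n Q) (htY : IsTypeDist n PY) :
    ∃ P', Coup Q PY P' ∧ IsTypeDist n P' ∧
      ∀ p, |P' p - P p| ≤ (Fintype.card (α × β × Unit) + 1) / n := by
  let ι : α × β × Unit → α × β := fun p => (p.1, p.2.1)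
  have e : ∀ (κ : Type) (F : α × β → κ) (τ : α × β × Unit → ℝ),
      push (fun p => F (ι p)) τ = push F fun p : α × β => τ (p.1, p.2, ()) := by
    intro κ F τ
    funext c
    simp [push, ι, Fintype.sum_prod_type]
  have hfst : push (fun p => p.1) (P ∘ ι) = Q := (e _ Prod.fst _).trans hP.fst
  have hsnd : push (fun p => p.2.1) (P ∘ ι) = PY := (e _ Prod.snd _).trans hP.snd
  obtain ⟨τ, h1, h2, h3, h4, h5, -⟩ := RGV.exists_rounding (τ := P ∘ ι) hn
    ⟨fun p => hP.nonneg _, by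
      rw [← sum_push (fun p : α × β × Unit => p.1), hfst, hQ.2]⟩
    (by rwa [hfst]) (by rwa [hsnd]) (fun _ => ())
  refine ⟨fun p => τ (p.1, p.2, ()), ⟨fun p => h1.1 _, ?_, ?_⟩, fun p => h2 _, fun p => h5 _⟩
  · exact (e _ Prod.fst _).symm.trans (h3.trans hfst)
  · exact (e _ Prod.snd _).symm.trans (h4.trans hsnd)

lemma coup_emp2 {n : ℕ} (z : Fin n → α) (y : Fin n → β) (hz : emp n z = Q) :
    Coup Q (emp n y) (emp2 n z y) := by
  refine ⟨fun p => by simp only [emp2]; positivity, ?_, push_snd_emp2 z y⟩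
  rw [push_fst_emp2, hz]

lemma Coup.exists_seq {n : ℕ} (hn : 0 < n) (hQ : IsDist Q) {y : Fin n → β} {P : α × β → ℝ}
    (hP : Coup Q (emp n y) P) (ht : IsTypeDist n P) : ∃ z, emp n z = Q ∧ emp2 n z y = P := by
  obtain ⟨w, hw⟩ := exists_emp_eq hn (hP.isDist hQ).2 ht
  obtain ⟨z, hz⟩ := exists_emp2_eq (y := y) (w := w) (by rw [hw, hP.snd])
  refine ⟨z, ?_, hz.trans hw⟩
  rw [← push_fst_emp2 z y, hz, hw, hP.fst]

/-- For every output sequence there is a sequence of composition `Q` nearly attaining `alphaF`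
with mutual information bounded away from the rate. -/
lemma eventually_exists_seq (hQ : IsDist Q) (hg : Continuous g) (hR : 0 < R) {D : ℕ}
    (hQD : IsTypeDist D Q) {ε : ℝ} (hε : 0 < ε) :
    ∃ ε' > 0, ∀ᶠ n : ℕ in atTop, D ∣ n → ∀ y : Fin n → β, ∃ z : Fin n → α, emp n z = Q ∧
      mutInf (emp2 n z y) ≤ R - ε' ∧ alphaF Q g R (emp n y) - ε ≤ hfun g R (emp2 n z y) := by
  obtain ⟨t₀, ht₀, h1⟩ := exists_unif_cont isCompact_isDist
    (continuousOn_hfun (α := α) (β := β) (R := R) hg) (by positivity : 0 < ε / 3)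
  set t := min t₀ 1 with ht
  have ht0 : 0 < t := lt_min ht₀ one_pos
  have ht1 : t ≤ 1 := min_le_right _ _
  obtain ⟨κ, hκ, h2⟩ := exists_unif_cont isCompact_isDist
    (continuousOn_mutInf (α := α) (β := β)) (by positivity : 0 < t * R / 2)
  refine ⟨t * R / 2, by positivity, ?_⟩
  have hlim : Tendsto (fun n : ℕ => ((Fintype.card (α × β × Unit) : ℝ) + 1) / n) atTop (nhds 0) :=
    tendsto_const_nhds.div_atTop tendsto_natCast_atTop_atTop
  filter_upwards [hlim.eventually_le_const (show 0 < min t₀ κ by positivity),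
    eventually_gt_atTop 0] with n hsmall hn hDn y
  have hY := emp_isDist hn y
  obtain ⟨P, hP, hI, hα⟩ := exists_alphaF_le (g := g) hQ hR.le hY (by positivity : 0 < ε / 3)
  have hmix := hP.mix ht0.le ht1 (coup_prodD hQ hY)
  have hImix := hP.mutInf_mix_le ht0.le ht1 hQ hY
  obtain ⟨P', hP', ht', hd⟩ := hmix.exists_rounding hn hQ (hQD.of_dvd hDn) (isTypeDist_emp hn y)
  obtain ⟨z, hz, rfl⟩ := hP'.exists_seq hn hQ ht'
  refine ⟨z, hz, ?_, ?_⟩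
  · have := abs_le.1 (h2 _ (hP'.isDist hQ) _ (hmix.isDist hQ) fun p =>
      (hd p).trans (hsmall.trans (min_le_right _ _)))
    nlinarith [mul_le_mul_of_nonneg_left hI (by linarith : 0 ≤ 1 - t)]
  · have h3 := abs_le.1 (h1 _ (hP'.isDist hQ) _ (hmix.isDist hQ) fun p =>
      (hd p).trans (hsmall.trans (min_le_left _ _)))
    have h4 := abs_le.1 (h1 _ (hmix.isDist hQ) _ (hP.isDist hQ) fun p =>
      (abs_mix_sub_le ht0.le (hP.isDist hQ) ((coup_prodD hQ hY).isDist hQ) p).trans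
        (min_le_left _ _))
    linarith

end Rounding

section Objective

variable {α β : Type} [Fintype α] [Fintype β] {Q : α → ℝ} {W : α → β → ℝ}
  {g : (α × β → ℝ) → ℝ} {R : ℝ}

/-- Marginals of a distribution of `(X, X', Y)`. -/
def margXX (τ : α × α × β → ℝ) : α × α → ℝ := push (fun p => (p.1, p.2.1)) τ

def margXY (τ : α × α × β → ℝ) : α × β → ℝ := push (fun p => (p.1, p.2.2)) τ

def margXpY (τ : α × α × β → ℝ) : α × β → ℝ := push (fun p => p.2) τ

def margY (τ : α × α × β → ℝ) : β → ℝ := push (fun p => p.2.2) τ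

/-- Joint laws of `(X, X', Y)` with both input marginals `Q` and absolutely continuous with
respect to the channel. -/
structure Adm (Q : α → ℝ) (W : α → β → ℝ) (τ : α × α × β → ℝ) : Prop where
  dist : IsDist τ
  fst : push (fun p => p.1) τ = Q
  snd : push (fun p => p.2.1) τ = Q
  abs : ∀ p, W p.1 p.2.2 = 0 → τ p = 0

/-- The gap term of the exponent. -/
def gap (Q : α → ℝ) (g : (α × β → ℝ) → ℝ) (R : ℝ) (τ : α × α × β → ℝ) : ℝ :=
  pos (max (g (margXY τ)) (alphaF Q g R (margY τ)) - g (margXpY τ))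

/-- Expected log-likelihood. -/
def logLik (W : α → β → ℝ) (τ : α × α × β → ℝ) : ℝ := ∑ p, τ p * Real.log (W p.1 p.2.2)

/-- The exponent as a function of the joint law of `(X, X', Y)`. -/
def expo (Q : α → ℝ) (W : α → β → ℝ) (g : (α × β → ℝ) → ℝ) (R : ℝ) (τ : α × α × β → ℝ) : ℝ :=
  2 * Ent Q - Ent τ - logLik W τ + gap Q g R τ - R

lemma margXX_apply (τ : α × α × β → ℝ) (p : α × α) : margXX τ p = ∑ y, τ (p.1, p.2, y) := by
  obtain ⟨a, b⟩ := p
  simp only [margXX, push, Fintype.sum_prod_type, Prod.mk.injEq]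
  rw [Finset.sum_eq_single a, Finset.sum_eq_single b]
  · simp
  · intro b' _ h; simp [h]
  · simp
  · intro a' _ h; simp [h]
  · simp

lemma margXY_apply (τ : α × α × β → ℝ) (p : α × β) : margXY τ p = ∑ b, τ (p.1, b, p.2) := by
  obtain ⟨a, y⟩ := p
  simp only [margXY, push, Fintype.sum_prod_type, Prod.mk.injEq]
  rw [Finset.sum_eq_single a]
  · simp
  · intro a' _ h; simp [h]
  · simp

lemma margXpY_apply (τ : α × α × β → ℝ) (p : α × β) : margXpY τ p = ∑ a, τ (a, p) := by
  rw [margXpY, push, Fintype.sum_prod_type]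
  refine Finset.sum_congr rfl fun a _ => ?_
  exact (Finset.sum_eq_single p (fun q _ h => if_neg h) (by simp)).trans (if_pos rfl)

lemma margY_apply (τ : α × α × β → ℝ) (y : β) : margY τ y = ∑ a, ∑ b, τ (a, b, y) := by
  simp [margY, push, Fintype.sum_prod_type]

lemma continuousOn_expo (hQ : IsDist Q) (hg : Continuous g) (hR : 0 < R) :
    ContinuousOn (expo Q W g R) {τ | IsDist τ} := by
  have hα : ContinuousOn (fun τ : α × α × β → ℝ => alphaF Q g R (margY τ)) {τ | IsDist τ} :=
    (continuousOn_alphaF hQ hg hR).comp (continuous_push _).continuousOn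
      fun τ hτ => IsDist.push _ hτ
  have h1 : Continuous fun τ : α × α × β → ℝ => g (margXY τ) := hg.comp (continuous_push _)
  have h2 : Continuous fun τ : α × α × β → ℝ => g (margXpY τ) := hg.comp (continuous_push _)
  have h3 : Continuous (logLik W : (α × α × β → ℝ) → ℝ) := by unfold logLik; fun_prop
  have hgap : ContinuousOn (gap Q g R : (α × α × β → ℝ) → ℝ) {τ | IsDist τ} :=
    ((h1.continuousOn.sup hα).sub h2.continuousOn).sup continuousOn_const
  exact ((((continuous_const.sub continuous_Ent).sub h3).continuousOn).add hgap).sub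
    continuousOn_const

lemma Adm.coup {τ : α × α × β → ℝ} (h : Adm Q W τ) : Coup Q Q (margXX τ) := by
  refine ⟨push_nonneg _ h.dist.1, ?_, ?_⟩
  · rw [margXX, push_push]; exact h.fst
  · rw [margXX, push_push]; exact h.snd

lemma Adm.mix {t : ℝ} (h0 : 0 ≤ t) (h1 : t ≤ 1) {τ τ' : α × α × β → ℝ} (h : Adm Q W τ)
    (h' : Adm Q W τ') : Adm Q W (mix t τ τ') := by
  refine ⟨h.dist.mix h0 h1 h'.dist, ?_, ?_, fun p hp => ?_⟩
  · rw [push_mix, h.fst, h'.fst, mix_self]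
  · rw [push_mix, h.snd, h'.snd, mix_self]
  · simp [RGV.mix, h.abs p hp, h'.abs p hp]

/-- The law with independent inputs. -/
def indepLaw (Q : α → ℝ) (W : α → β → ℝ) : α × α × β → ℝ :=
  fun p => Q p.1 * Q p.2.1 * W p.1 p.2.2

lemma margXX_indepLaw (hW : IsChannel W) : margXX (indepLaw Q W) = prodD Q Q := by
  funext p
  simp [margXX_apply, indepLaw, prodD, ← Finset.mul_sum, (hW _).2]

lemma adm_indepLaw (hQ : IsDist Q) (hW : IsChannel W) : Adm Q W (indepLaw Q W) := by
  have hc := coup_prodD hQ hQ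
  have e1 : push (fun p => p.1) (indepLaw Q W) = Q := by
    conv_rhs => rw [← hc.fst, ← margXX_indepLaw hW, margXX, push_push]
    rfl
  have e2 : push (fun p => p.2.1) (indepLaw Q W) = Q := by
    conv_rhs => rw [← hc.snd, ← margXX_indepLaw hW, margXX, push_push]
    rfl
  refine ⟨⟨fun p => ?_, ?_⟩, e1, e2, fun p hp => by simp [indepLaw, hp]⟩
  · exact mul_nonneg (mul_nonneg (hQ.1 _) (hQ.1 _)) ((hW _).1 _)
  · rw [← sum_push (fun p : α × α × β => p.1), e1, hQ.2]

lemma neg_one_le_mul_log_div {t u : ℝ} (ht : 0 ≤ t) (hu : 0 ≤ u) (hu1 : u ≤ 1) :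
    -1 ≤ t * Real.log (t / u) := by
  rcases ht.eq_or_lt with rfl | ht
  · simp
  rcases hu.eq_or_lt with rfl | hu
  · simp
  have h1 := Real.one_sub_inv_le_log_of_pos (show 0 < t / u by positivity)
  have h2 : t * (1 - (t / u)⁻¹) ≤ t * Real.log (t / u) := by gcongr
  have h3 : t * (1 - (t / u)⁻¹) = t - u := by field_simp
  linarith

lemma neg_card_le_condDiv {P : α × α → ℝ} {V : α × α → β → ℝ} (hQ : IsDist Q) (hW : IsChannel W)
    (hP : ∀ p, 0 ≤ P p) (hV : ∀ p, IsDist (V p)) :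
    -(Fintype.card α * Fintype.card β : ℝ) ≤ condDiv Q W P V := by
  have : ∑ a : α, ∑ y : β, (-1 : ℝ) ≤ condDiv Q W P V := by
    refine Finset.sum_le_sum fun a _ => Finset.sum_le_sum fun y _ => ?_
    refine neg_one_le_mul_log_div (Finset.sum_nonneg fun b _ => mul_nonneg (hP _) ((hV _).1 _))
      (mul_nonneg (hQ.1 _) ((hW _).1 _)) (mul_le_one₀ (hQ.le_one _) ((hW _).1 _) ((hW _).le_one _))
  simpa using this

lemma neg_card_le_cmi {P : α × α → ℝ} {V : α × α → β → ℝ} (hP : IsDist P)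
    (hV : ∀ p, IsDist (V p)) :
    -(Fintype.card α * (Fintype.card α * Fintype.card β) : ℝ) ≤ cmi P V := by
  have : ∑ a : α, ∑ b : α, ∑ y : β, (-1 : ℝ) ≤ cmi P V := by
    refine Finset.sum_le_sum fun a _ => Finset.sum_le_sum fun b _ => Finset.sum_le_sum fun y _ => ?_
    rw [← div_div_eq_mul_div]
    have h0 : 0 ≤ PXY P V (a, y) := Finset.sum_nonneg fun b _ => mul_nonneg (hP.1 _) ((hV _).1 _)
    have h1 : PXY P V (a, y) ≤ ∑ b', P (a, b') :=
      Finset.sum_le_sum fun b _ => mul_le_of_le_one_right (hP.1 _) ((hV _).le_one _)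
    have h2 : 0 ≤ ∑ b', P (a, b') := h0.trans h1
    refine neg_one_le_mul_log_div (mul_nonneg (hP.1 _) ((hV _).1 _))
      (div_nonneg (mul_nonneg (hP.1 _) h0) h2) ?_
    exact div_le_one_of_le₀ ((mul_le_of_le_one_left h0 (hP.le_one _)).trans h1) h2
  simpa using this

lemma neg_card_le_mutInf {P : α × β → ℝ} (hP : IsDist P) :
    -(Fintype.card α * Fintype.card β : ℝ) ≤ mutInf P := by
  have : ∑ p : α × β, (-1 : ℝ) ≤ mutInf P := by
    refine Finset.sum_le_sum fun p _ => ?_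
    have h1 := (hP.push Prod.fst).le_one p.1
    have h2 := (hP.push Prod.snd).le_one p.2
    rw [push_fst_apply] at h1
    rw [push_snd_apply] at h2
    have h3 : 0 ≤ ∑ a, P (a, p.2) := Finset.sum_nonneg fun _ _ => hP.1 _
    exact neg_one_le_mul_log_div (hP.1 _)
      (mul_nonneg (Finset.sum_nonneg fun _ _ => hP.1 _) h3) (mul_le_one₀ h1 h3 h2)
  simpa using this

lemma Gamma_le {P : α × α → ℝ} {V : α × α → β → ℝ} (hQ : IsDist Q) (hW : IsChannel W)
    (hP : IsDist P) (hV : ∀ p, IsDist (V p)) :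
    Gamma Q W g P R ≤ condDiv Q W P V + cmi P V +
      pos (max (g (PXY P V)) (alphaF Q g R (PYof P V)) - g (PXpY P V)) := by
  refine csInf_le ⟨-(Fintype.card α * Fintype.card β : ℝ) +
    -(Fintype.card α * (Fintype.card α * Fintype.card β) : ℝ) + 0, ?_⟩ ⟨V, hV, rfl⟩
  rintro _ ⟨V, hV, rfl⟩
  exact add_le_add (add_le_add (neg_card_le_condDiv hQ hW hP.1 hV) (neg_card_le_cmi hP hV))
    (le_max_right _ _)

lemma bddBelow_Eex (hQ : IsDist Q) (hW : IsChannel W) :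
    BddBelow { v | ∃ P : α × α → ℝ, Joint Q P ∧ mutInf P ≤ R ∧
      v = Gamma Q W g P R + mutInf P - R } := by
  refine ⟨-(Fintype.card α * Fintype.card β : ℝ) +
    -(Fintype.card α * (Fintype.card α * Fintype.card β) : ℝ) + 0 +
      -(Fintype.card α * Fintype.card α : ℝ) - R, ?_⟩
  rintro _ ⟨P, hP, -, rfl⟩
  refine sub_le_sub_right (add_le_add ?_ (neg_card_le_mutInf hP.1)) _
  refine le_csInf ⟨_, fun p => W p.1, fun p => hW _, rfl⟩ ?_
  rintro _ ⟨V, hV, rfl⟩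
  exact add_le_add (add_le_add (neg_card_le_condDiv hQ hW hP.1.1 hV) (neg_card_le_cmi hP.1 hV))
    (le_max_right _ _)

lemma Adm.exists_cond {τ : α × α × β → ℝ} (hW : IsChannel W) (h : Adm Q W τ) :
    ∃ V : α × α → β → ℝ, (∀ p, IsDist (V p)) ∧
      ∀ a b y, margXX τ (a, b) * V (a, b) y = τ (a, b, y) := by
  refine ⟨fun p y => if margXX τ p = 0 then W p.1 y else τ (p.1, p.2, y) / margXX τ p,
    fun p => ?_, fun a b y => ?_⟩
  · have h0 : 0 ≤ margXX τ p := h.coup.nonneg p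
    by_cases hp : margXX τ p = 0
    · simpa [hp] using hW p.1
    · simp only [hp, if_false]
      exact ⟨fun y => div_nonneg (h.dist.1 _) h0, by
        rw [← Finset.sum_div, ← margXX_apply, div_self hp]⟩
  · by_cases hp : margXX τ (a, b) = 0
    · rw [hp, zero_mul]
      rw [margXX_apply, Finset.sum_eq_zero_iff_of_nonneg fun _ _ => h.dist.1 _] at hp
      exact (hp y (mem_univ _)).symm
    · simp only [hp, if_false]
      field_simp

lemma Eex_le_expo {τ : α × α × β → ℝ} (hQ : IsDist Q) (hW : IsChannel W) (h : Adm Q W τ)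
    (hI : mutInf (margXX τ) ≤ R) : Eex Q W g R ≤ expo Q W g R τ := by
  obtain ⟨V, hV, hτ⟩ := h.exists_cond hW
  set P := margXX τ with hPdef
  have hPd : IsDist P := h.dist.push _
  have hrow : ∀ a, ∑ b, P (a, b) = Q a := fun a => by rw [← push_fst_apply, h.coup.fst]
  have hcol : ∀ b, ∑ a, P (a, b) = Q b := fun b => by rw [← push_snd_apply, h.coup.snd]
  have eXY : PXY P V = margXY τ := by
    funext p; simp only [PXY, hτ, margXY_apply]
  have eXpY : PXpY P V = margXpY τ := by
    funext p; simp only [PXpY, hτ, margXpY_apply]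
  have eY : PYof P V = margY τ := by
    funext y; simp only [PYof, Fintype.sum_prod_type, hτ, margY_apply]
  have hG := Gamma_le (g := g) (R := R) hQ hW hPd hV
  have hE : Eex Q W g R ≤ Gamma Q W g P R + mutInf P - R :=
    csInf_le (bddBelow_Eex hQ hW) ⟨P, ⟨hPd, hrow, hcol⟩, hI, rfl⟩
  have hM : mutInf P = 2 * Ent Q - Ent P := by
    rw [mutInf_eq hPd.1, h.coup.fst, h.coup.snd]; ring
  have hdiv : condDiv Q W P V + cmi P V = Ent P - Ent τ - logLik W τ := by
    have e1 : condDiv Q W P V = ∑ a, ∑ b, ∑ y,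
        τ (a, b, y) * Real.log (margXY τ (a, y) / (Q a * W a y)) := by
      simp only [condDiv, eXY]
      refine Finset.sum_congr rfl fun a _ => ?_
      rw [Finset.sum_comm]
      refine Finset.sum_congr rfl fun y _ => ?_
      rw [← Finset.sum_mul, ← margXY_apply τ (a, y)]
    have e2 : Ent P = ∑ a, ∑ b, ∑ y, τ (a, b, y) * -Real.log (P (a, b)) := by
      simp only [Ent, Fintype.sum_prod_type, Real.negMulLog]
      refine Finset.sum_congr rfl fun a _ => Finset.sum_congr rfl fun b _ => ?_
      rw [← Finset.sum_mul, ← margXX_apply τ (a, b)]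
      ring
    rw [e1, e2, cmi, Ent, logLik]
    simp only [Fintype.sum_prod_type, ← Finset.sum_add_distrib, ← Finset.sum_sub_distrib]
    refine Finset.sum_congr rfl fun a _ => Finset.sum_congr rfl fun b _ =>
      Finset.sum_congr rfl fun y _ => ?_
    rw [hτ, hrow, eXY, Real.negMulLog]
    by_cases h0 : τ (a, b, y) = 0
    · simp [h0]
    have hpos : 0 < τ (a, b, y) := lt_of_le_of_ne (h.dist.1 _) (Ne.symm h0)
    have hWp : W a y ≠ 0 := fun hw => h0 (h.abs (a, b, y) hw)
    have hPp : 0 < P (a, b) := by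
      rw [hPdef, margXX_apply]
      exact hpos.trans_le (Finset.single_le_sum (f := fun y => τ (a, b, y))
        (fun _ _ => h.dist.1 _) (mem_univ y))
    have hXYp : 0 < margXY τ (a, y) := by
      rw [margXY_apply]
      exact hpos.trans_le (Finset.single_le_sum (f := fun b => τ (a, b, y))
        (fun _ _ => h.dist.1 _) (mem_univ b))
    have hQp : 0 < Q a := by
      rw [← hrow]
      exact hPp.trans_le (Finset.single_le_sum (f := fun b => P (a, b))
        (fun _ _ => hPd.1 _) (mem_univ b))
    rw [Real.log_div hXYp.ne' (mul_ne_zero hQp.ne' hWp), Real.log_mul hQp.ne' hWp,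
      Real.log_div (by positivity) (by positivity), Real.log_mul hpos.ne' hQp.ne',
      Real.log_mul hPp.ne' hXYp.ne']
    ring
  rw [eXY, eXpY, eY] at hG
  simp only [expo, gap]
  linarith

/-- The laws over which the exponent of the ensemble is minimised. -/
def lawSet (Q : α → ℝ) (W : α → β → ℝ) (r : ℝ) : Set (α × α × β → ℝ) :=
  {τ | Adm Q W τ ∧ mutInf (margXX τ) < r}

/-- The exponent of the ensemble. -/
def trcExp (Q : α → ℝ) (W : α → β → ℝ) (g : (α × β → ℝ) → ℝ) (R r : ℝ) : ℝ :=
  sInf (expo Q W g R '' lawSet Q W r)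

lemma indepLaw_mem (hQ : IsDist Q) (hW : IsChannel W) {r : ℝ} (hr : 0 < r) :
    indepLaw Q W ∈ lawSet Q W r :=
  ⟨adm_indepLaw hQ hW, by rwa [margXX_indepLaw hW, mutInf_prodD hQ hQ]⟩

lemma trcExp_le (hQ : IsDist Q) (hg : Continuous g) (hR : 0 < R) {r : ℝ} {τ : α × α × β → ℝ}
    (h : τ ∈ lawSet Q W r) : trcExp Q W g R r ≤ expo Q W g R τ := by
  refine csInf_le ?_ ⟨τ, h, rfl⟩
  exact (isCompact_isDist.bddBelow_image (continuousOn_expo hQ hg hR)).mono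
    (Set.image_mono fun τ h => h.1.dist)

lemma exists_expo_lt (hQ : IsDist Q) (hW : IsChannel W) {r ε : ℝ} (hr : 0 < r) (hε : 0 < ε) :
    ∃ τ ∈ lawSet Q W r, expo Q W g R τ < trcExp Q W g R r + ε := by
  obtain ⟨_, ⟨τ, hτ, rfl⟩, h⟩ := exists_lt_of_csInf_lt
    (Set.Nonempty.image (expo Q W g R) ⟨_, indepLaw_mem hQ hW hr⟩)
    (lt_add_of_pos_right (trcExp Q W g R r) hε)
  exact ⟨τ, hτ, h⟩

lemma exists_Eex_le_trcExp (hQ : IsDist Q) (hW : IsChannel W) (hg : Continuous g) (hR : 0 < R)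
    {ε : ℝ} (hε : 0 < ε) :
    ∃ δ₀ > 0, ∀ δ < δ₀, 0 < δ → Eex Q W g R - ε ≤ trcExp Q W g R (R + 2 * δ) := by
  obtain ⟨η, hη, h⟩ := exists_unif_cont isCompact_isDist (continuousOn_expo (W := W) hQ hg hR) hε
  set t := min η 1 with ht
  have ht0 : 0 < t := lt_min hη one_pos
  have ht1 : t ≤ 1 := min_le_right _ _
  refine ⟨t * R / 4, by positivity, fun δ hδ hδ0 => ?_⟩
  refine le_csInf (Set.Nonempty.image _ ⟨_, indepLaw_mem hQ hW (by positivity)⟩) ?_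
  rintro _ ⟨τ, ⟨hτ, hI⟩, rfl⟩
  have hi := adm_indepLaw hQ hW
  have hm := hτ.mix ht0.le ht1 hi
  have hI' : mutInf (margXX (mix t τ (indepLaw Q W))) ≤ R := by
    rw [margXX, push_mix, ← margXX, ← margXX, margXX_indepLaw hW]
    refine (hτ.coup.mutInf_mix_le ht0.le ht1 hQ hQ).trans ?_
    have : (1 - t) * mutInf (margXX τ) ≤ (1 - t) * (R + 2 * δ) :=
      mul_le_mul_of_nonneg_left hI.le (by linarith)
    nlinarith [mul_pos ht0 hδ0]
  have h1 := Eex_le_expo (g := g) hQ hW hm hI'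
  have h2 := abs_le.1 (h _ hm.dist _ hτ.dist fun p =>
    (abs_mix_sub_le ht0.le hτ.dist hi.dist p).trans (min_le_left _ _))
  linarith

end Objective

section Ensemble

variable {α β : Type} [Fintype α] [Fintype β] {Q : α → ℝ} {R : ℝ} {n : ℕ}

/-- Compatibility of two sequences in the construction with `d = -mutInf` and `Δ = -r`. -/
def okRel (n : ℕ) (r : ℝ) (z x : Fin n → α) : Prop := -r < -mutInf (emp2 n z x)

lemma okRel_iff {r : ℝ} {z x : Fin n → α} : okRel n r z x ↔ mutInf (emp2 n z x) < r :=
  neg_lt_neg_iff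

lemma expect_eq_seqExp (n M : ℕ) (Q : α → ℝ) (r : ℝ) (f : (Fin M → Fin n → α) → ℝ) :
    expect n Q (fun P : α × α → ℝ => -mutInf P) (-r) M f =
      seqExp (typeClass n Q) (okRel n r) M f := by
  refine Finset.sum_congr rfl fun c _ => congrArg (· * f c) (Finset.prod_congr rfl fun i _ => ?_)
  have h : feasible n Q (fun P : α × α → ℝ => -mutInf P) (-r) c i =
      (typeClass n Q).filter fun z => ∀ j, j < i → okRel n r z (c j) := by
    ext z
    rw [feasible, mem_filter, mem_filter]
    rfl
  rw [h]
  by_cases hc : c i ∈ (typeClass n Q).filter fun z => ∀ j, j < i → okRel n r z (c j)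
  · rw [if_pos hc, if_pos hc]
  · rw [if_neg hc, if_neg hc]

lemma mutInf_swap (P : α × β → ℝ) : mutInf (fun p : β × α => P p.swap) = mutInf P := by
  refine Fintype.sum_equiv (Equiv.prodComm β α) _ _ fun p => ?_
  simp [mul_comm]

lemma mutInf_emp2_comm (x : Fin n → α) (y : Fin n → β) :
    mutInf (emp2 n y x) = mutInf (emp2 n x y) := by
  rw [← mutInf_swap (emp2 n x y)]
  congr 1
  funext p
  simp [emp2, and_comm]

lemma mem_typeClass {x : Fin n → α} : x ∈ typeClass n Q ↔ emp n x = Q := by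
  simp [typeClass]

lemma mutInf_emp2 (z : Fin n → α) (y : Fin n → β) :
    mutInf (emp2 n z y) = Ent (emp n z) + Ent (emp n y) - Ent (emp2 n z y) := by
  rw [mutInf_eq (fun p => by simp only [emp2]; positivity), push_fst_emp2, push_snd_emp2]

/-- Size estimates for the construction at blocklength `n`. -/
structure Good (n : ℕ) (Q : α → ℝ) (R δ η F : ℝ) : Prop where
  sparse : Sparse (typeClass n Q) (okRel n (R + 2 * δ)) (Mof R n)
    (Real.exp (n * (Ent Q - (R + 2 * δ) + η))) F
  small : Mof R n * Real.exp (n * (Ent Q - (R + 2 * δ) + η)) ≤ 4 * Real.exp (-(n * δ)) * F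
  card_le : ((typeClass n Q).card : ℝ) ≤ (1 + 4 * Real.exp (-(n * δ))) * F
  le_card : Real.exp (n * (Ent Q - η)) ≤ (typeClass n Q).card
  card_le_exp : ((typeClass n Q).card : ℝ) ≤ Real.exp (n * (Ent Q + η))
  le_M : Real.exp (n * R) ≤ Mof R n
  M_le : (Mof R n : ℝ) ≤ 2 * Real.exp (n * R)
  rho_le : 4 * Real.exp (-(n * δ)) ≤ 1 / 8

lemma eventually_mul_exp_le (A : ℝ) {c B : ℝ} (hc : 0 < c) (hB : 0 < B) :
    ∀ᶠ n : ℕ in atTop, A * Real.exp (-(n * c)) ≤ B := by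
  have h : Tendsto (fun n : ℕ => A * Real.exp (-(n * c))) atTop (nhds (A * 0)) :=
    (Real.tendsto_exp_neg_atTop_nhds_zero.comp
      (tendsto_natCast_atTop_atTop.atTop_mul_const hc)).const_mul A
  rw [mul_zero] at h
  exact h.eventually_le_const hB

lemma Mof_le (hR : 0 < R) (n : ℕ) : (Mof R n : ℝ) ≤ 2 * Real.exp (n * R) := by
  have h1 : 1 ≤ Real.exp (n * R) := Real.one_le_exp (by positivity)
  have h2 := (Nat.ceil_lt_add_one (Real.exp_pos (n * R)).le).le
  rw [Mof]
  linarith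

lemma eventually_good (hQ : IsDist Q) {D : ℕ} (hQD : IsTypeDist D Q) (hR : 0 < R) {δ η : ℝ}
    (hδ : 0 < δ) (hη : 0 < η) (hηδ : 2 * η ≤ δ) :
    ∀ᶠ n : ℕ in atTop, D ∣ n → ∃ F, Good n Q R δ η F := by
  filter_upwards [eventually_card_cls α η hη, eventually_sum_fix_le α α η hη,
    eventually_mul_exp_le 4 hδ (by norm_num : (0 : ℝ) < 1 / 8), eventually_gt_atTop 0]
    with n hcls hfix hρ hn hDn
  obtain ⟨z₀, hz₀⟩ := exists_emp_eq hn hQ.2 (hQD.of_dvd hDn)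
  have hT : cls z₀ = typeClass n Q := by
    ext z; simp [cls, typeClass, hz₀]
  have hc := hcls z₀
  rw [hT, hz₀] at hc
  set T := typeClass n Q
  set b := Real.exp (n * (Ent Q - (R + 2 * δ) + η)) with hb
  have hM := Mof_le hR n
  have hMb : Mof R n * b ≤ 2 * Real.exp (-(n * δ)) * T.card := by
    calc (Mof R n : ℝ) * b ≤ 2 * Real.exp (n * R) * b := by gcongr
      _ = 2 * Real.exp (n * (Ent Q - 2 * δ + η)) := by
          rw [hb, mul_assoc, ← Real.exp_add]; ring_nf
      _ ≤ 2 * Real.exp (-(n * δ) + n * (Ent Q - η)) := by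
          have : (n : ℝ) * (2 * η) ≤ n * δ := by gcongr
          gcongr
          linarith
      _ ≤ 2 * Real.exp (-(n * δ)) * T.card := by
          rw [Real.exp_add, ← mul_assoc]
          gcongr
          exact hc.1
  have hTpos : (0 : ℝ) < T.card := (Real.exp_pos _).trans_le hc.1
  have hF : (T.card : ℝ) / 2 ≤ T.card - Mof R n * b := by nlinarith
  have hsmall : Mof R n * b ≤ 4 * Real.exp (-(n * δ)) * (T.card - Mof R n * b) := by
    have : Real.exp (-(n * δ)) * (T.card / 2) ≤ Real.exp (-(n * δ)) * (T.card - Mof R n * b) := by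
      gcongr
    linarith
  refine ⟨T.card - Mof R n * b, ⟨⟨?_, ?_, Real.exp_pos _, by linarith, by linarith⟩, hsmall,
    by linarith, hc.1, hc.2, Nat.le_ceil _, hM, hρ⟩⟩
  · intro x y h
    rw [okRel_iff] at h ⊢
    rwa [mutInf_emp2_comm]
  · intro x hx
    have hx' := mem_typeClass.1 hx
    have := hfix x (fun P => if push Prod.fst P = Q ∧ R + 2 * δ ≤ mutInf P then 1 else 0)
      (Real.exp (n * (Ent Q - (R + 2 * δ)))) (Real.exp_pos _).le (fun p => by positivity) ?_
    · simp only [push_fst_emp2] at this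
      rw [Finset.sum_boole, ← Real.exp_add] at this
      refine le_trans (le_of_eq ?_) (this.trans (le_of_eq (by ring_nf)))
      congr 2
      ext z
      simp [mem_typeClass, okRel_iff]
    · intro z
      split_ifs with h
      · rw [mul_one]
        rw [push_fst_emp2] at h
        have := mutInf_emp2 z x
        rw [h.1] at this
        exact Real.exp_le_exp.2 (mul_le_mul_of_nonneg_left (by linarith) (Nat.cast_nonneg _))
      · rw [mul_zero]; positivity

lemma Good.card_le_two {δ η F : ℝ} (h : Good n Q R δ η F) :
    ((typeClass n Q).card : ℝ) ≤ 2 * F := by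
  have := h.sparse.F_pos
  have := h.card_le
  have := h.rho_le
  nlinarith

end Ensemble

section ErrorProbability

variable {α β : Type} [Fintype α] [Fintype β] {Q : α → ℝ} {W : α → β → ℝ}
  {g : (α × β → ℝ) → ℝ} {R : ℝ} {n M : ℕ}

/-- The sequence of triples built from three sequences. -/
def tri (x x' : Fin n → α) (y : Fin n → β) : Fin n → α × α × β := fun i => (x i, x' i, y i)

lemma margXX_tri (x x' : Fin n → α) (y : Fin n → β) :
    margXX (emp n (tri x x' y)) = emp2 n x x' := by
  rw [margXX, ← emp_comp, emp2_eq]; rfl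

lemma margXY_tri (x x' : Fin n → α) (y : Fin n → β) :
    margXY (emp n (tri x x' y)) = emp2 n x y := by
  rw [margXY, ← emp_comp, emp2_eq]; rfl

lemma margXpY_tri (x x' : Fin n → α) (y : Fin n → β) :
    margXpY (emp n (tri x x' y)) = emp2 n x' y := by
  rw [margXpY, ← emp_comp, emp2_eq]; rfl

lemma margY_tri (x x' : Fin n → α) (y : Fin n → β) :
    margY (emp n (tri x x' y)) = emp n y := by
  rw [margY, ← emp_comp]; rfl

lemma push_fst_tri (x x' : Fin n → α) (y : Fin n → β) :
    push (fun p => p.1) (emp n (tri x x' y)) = emp n x := by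
  rw [← emp_comp]; rfl

lemma push_snd_tri (x x' : Fin n → α) (y : Fin n → β) :
    push (fun p => p.2.1) (emp n (tri x x' y)) = emp n x' := by
  rw [← emp_comp]; rfl

lemma sum_comp_eq_mul_sum_emp {γ : Type} [Fintype γ] (hn : 0 < n) (w : Fin n → γ) (f : γ → ℝ) :
    ∑ i, f (w i) = n * ∑ p, emp n w p * f p := by
  have hn' : (n : ℝ) ≠ 0 := by positivity
  rw [Finset.mul_sum, ← Finset.sum_fiberwise_of_maps_to (g := w) (t := univ) (by simp)]
  refine Finset.sum_congr rfl fun p _ => ?_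
  rw [Finset.sum_congr rfl (g := fun _ => f p) (fun i hi => by rw [(mem_filter.1 hi).2])]
  simp only [emp, sum_const, nsmul_eq_mul]
  field_simp

lemma emp_pos (hn : 0 < n) {γ : Type} [Fintype γ] (w : Fin n → γ) (i : Fin n) :
    0 < emp n w (w i) := by
  have : 0 < (univ.filter fun j => w j = w i).card := card_pos.2 ⟨i, by simp⟩
  simp only [emp]
  positivity

lemma emp_eq_zero {γ : Type} [Fintype γ] {w : Fin n → γ} {p : γ} (h : ∀ i, w i ≠ p) :
    emp n w p = 0 := by
  simp [emp, h]

lemma Adm.Wn_eq (hn : 0 < n) (hW : IsChannel W) {x x' : Fin n → α} {y : Fin n → β}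
    (h : Adm Q W (emp n (tri x x' y))) :
    Wn n W x y = Real.exp (n * logLik W (emp n (tri x x' y))) := by
  rw [logLik, ← sum_comp_eq_mul_sum_emp hn (tri x x' y) fun p => Real.log (W p.1 p.2.2),
    Real.exp_sum, Wn]
  refine Finset.prod_congr rfl fun i _ => ?_
  rw [Real.exp_log]
  · rfl
  · refine lt_of_le_of_ne ((hW _).1 _) fun h0 => ?_
    exact (emp_pos hn (tri x x' y) i).ne' (h.abs _ h0.symm)

lemma adm_of_Wn_ne_zero (hn : 0 < n) {x x' : Fin n → α} {y : Fin n → β} (hx : emp n x = Q)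
    (hx' : emp n x' = Q) (h : Wn n W x y ≠ 0) : Adm Q W (emp n (tri x x' y)) := by
  refine ⟨emp_isDist hn _, by rw [push_fst_tri, hx], by rw [push_snd_tri, hx'], fun p hp => ?_⟩
  refine emp_eq_zero fun i hi => ?_
  subst hi
  exact prod_ne_zero_iff.1 h i (mem_univ _) hp

lemma Wn_nonneg (hW : IsChannel W) (x : Fin n → α) (y : Fin n → β) : 0 ≤ Wn n W x y :=
  Finset.prod_nonneg fun _ _ => (hW _).1 _

lemma sum_Wn (hW : IsChannel W) (x : Fin n → α) : ∑ y : Fin n → β, Wn n W x y = 1 := by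
  simp only [Wn]
  rw [← Fintype.piFinset_univ, ← Finset.prod_univ_sum (fun _ : Fin n => (univ : Finset β))
    fun i b => W (x i) b]
  simp [(hW _).2]

lemma Pe_le_one (hM : 0 < M) (hW : IsChannel W) (c : Fin M → Fin n → α) : Pe n W g c ≤ 1 := by
  have : Nonempty (Fin M) := ⟨⟨0, hM⟩⟩
  have hpos : ∀ y : Fin n → β, 0 < ∑ m : Fin M, Real.exp ((n : ℝ) * g (emp2 n (c m) y)) :=
    fun y => Finset.sum_pos (fun _ _ => Real.exp_pos _) univ_nonempty
  have h : ∀ m : Fin M, ∑ m' ∈ Finset.univ.erase m, ∑ y : Fin n → β,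
      Wn n W (c m) y * Real.exp ((n : ℝ) * g (emp2 n (c m') y)) /
        ∑ m'' : Fin M, Real.exp ((n : ℝ) * g (emp2 n (c m'') y)) ≤ 1 := by
    intro m
    rw [Finset.sum_comm, ← sum_Wn hW (c m)]
    refine Finset.sum_le_sum fun y _ => ?_
    rw [← Finset.sum_div, ← Finset.mul_sum, div_le_iff₀ (hpos y)]
    exact mul_le_mul_of_nonneg_left (Finset.sum_le_sum_of_subset_of_nonneg (erase_subset _ _)
      fun _ _ _ => (Real.exp_pos _).le) (Wn_nonneg hW _ _)
  rw [Pe, inv_mul_le_iff₀ (by positivity), mul_one]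
  simpa using Finset.sum_le_sum fun m (_ : m ∈ univ) => h m

lemma le_Pe {G : ℝ} (hn : 0 < n) (hM : 2 ≤ M) (hW : IsChannel W)
    (hG : ∀ P : α × β → ℝ, IsDist P → |g P| ≤ G) (c : Fin M → Fin n → α) :
    Real.exp (-(2 * (n * G))) / 2 ≤ Pe n W g c := by
  have hM' : (2 : ℝ) ≤ M := by exact_mod_cast hM
  have hd : ∀ (x : Fin n → α) (y : Fin n → β), |g (emp2 n x y)| ≤ G := fun x y =>
    hG _ (by rw [emp2_eq]; exact emp_isDist hn _)
  have h : ∀ m : Fin M, Real.exp (-(2 * (n * G))) / 2 ≤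
      ∑ m' ∈ Finset.univ.erase m, ∑ y : Fin n → β,
      Wn n W (c m) y * Real.exp ((n : ℝ) * g (emp2 n (c m') y)) /
        ∑ m'' : Fin M, Real.exp ((n : ℝ) * g (emp2 n (c m'') y)) := by
    intro m
    rw [Finset.sum_comm, ← mul_one (Real.exp _ / 2), ← sum_Wn hW (c m), Finset.mul_sum]
    refine Finset.sum_le_sum fun y _ => ?_
    rw [← Finset.sum_div, ← Finset.mul_sum, mul_comm, mul_div_assoc]
    refine mul_le_mul_of_nonneg_left ?_ (Wn_nonneg hW _ _)
    have hden : ∑ m'' : Fin M, Real.exp ((n : ℝ) * g (emp2 n (c m'') y)) ≤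
        M * Real.exp (n * G) := by
      have : ∑ m'' : Fin M, Real.exp ((n : ℝ) * g (emp2 n (c m'') y)) ≤
          ∑ m'' : Fin M, Real.exp (n * G) := by
        gcongr with m''
        exact (le_abs_self _).trans (hd _ _)
      simpa using this
    have hnum : (M - 1) * Real.exp (-(n * G)) ≤
        ∑ m' ∈ Finset.univ.erase m, Real.exp ((n : ℝ) * g (emp2 n (c m') y)) := by
      have : ∑ m' ∈ Finset.univ.erase m, Real.exp (-(n * G)) ≤
          ∑ m' ∈ Finset.univ.erase m, Real.exp ((n : ℝ) * g (emp2 n (c m') y)) := by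
        refine Finset.sum_le_sum fun m' _ => ?_
        rw [← mul_neg]
        gcongr
        exact (abs_le.1 (hd _ _)).1
      rw [sum_const, card_erase_of_mem (mem_univ _), card_univ, Fintype.card_fin, nsmul_eq_mul,
        Nat.cast_sub (by omega), Nat.cast_one] at this
      exact this
    have hpos : 0 < ∑ m'' : Fin M, Real.exp ((n : ℝ) * g (emp2 n (c m'') y)) :=
      Finset.sum_pos (fun _ _ => Real.exp_pos _) ⟨m, mem_univ _⟩
    rw [le_div_iff₀ hpos]
    calc Real.exp (-(2 * (n * G))) / 2 * _ ≤ Real.exp (-(2 * (n * G))) / 2 *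
          (M * Real.exp (n * G)) := by gcongr
      _ = M / 2 * Real.exp (-(n * G)) := by
          rw [show -(2 * (n * G)) = -(n * G) + -(n * G) by ring, Real.exp_add, Real.exp_neg]
          field_simp
      _ ≤ (M - 1) * Real.exp (-(n * G)) := by gcongr; linarith
      _ ≤ _ := hnum
  rw [Pe, le_inv_mul_iff₀ (by positivity)]
  simpa using Finset.sum_le_sum fun m (_ : m ∈ univ) => h m

lemma exists_abs_le (hg : Continuous g) : ∃ G, ∀ P : α × β → ℝ, IsDist P → |g P| ≤ G := by
  obtain ⟨G, hG⟩ := isCompact_isDist.exists_bound_of_continuousOn hg.continuousOn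
  exact ⟨G, fun P hP => hG P hP⟩

end ErrorProbability

section Covering

variable {α β : Type} [Fintype α] [Fintype β] {Q : α → ℝ} {W : α → β → ℝ}
  {g : (α × β → ℝ) → ℝ} {R : ℝ} {n M : ℕ}

lemma eventually_mul_le_exp (K : ℝ) {κ : ℝ} (hκ : 0 < κ) :
    ∀ᶠ n : ℕ in atTop, K * n ≤ Real.exp (n * κ) := by
  filter_upwards [tendsto_natCast_atTop_atTop.eventually_ge_atTop (2 * K / κ ^ 2)] with n hn
  rw [div_le_iff₀ (by positivity)] at hn
  have h := Real.quadratic_le_exp_of_nonneg (show 0 ≤ n * κ by positivity)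
  have h1 : 0 ≤ (n : ℝ) := Nat.cast_nonneg _
  have h2 : 0 ≤ n * κ := by positivity
  nlinarith

lemma eventually_le_exp (K : ℝ) {κ : ℝ} (hκ : 0 < κ) :
    ∀ᶠ n : ℕ in atTop, K ≤ Real.exp (n * κ) :=
  (Real.tendsto_exp_atTop.comp
    (tendsto_natCast_atTop_atTop.atTop_mul_const hκ)).eventually_ge_atTop K

/-- The codewords whose joint type with `y` equals that of `z` number at least their share. -/
lemma Good.prob_sum_exp_lt {δ η F : ℝ} (hG : Good n Q R δ η F) {y : Fin n → β} {z : Fin n → α}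
    (hz : emp n z = Q)
    (hcard : Real.exp (n * (Ent (emp2 n z y) - Ent (emp n y) - η)) ≤
      (univ.filter fun z' : Fin n → α => emp2 n z' y = emp2 n z y).card)
    {κ θ : ℝ} (hκ : κ ≤ R - mutInf (emp2 n z y) - 2 * η) (hδ : 0 ≤ δ)
    (hθ : 8 * θ ≤ Real.exp (n * (hfun g R (emp2 n z y) - 2 * η))) :
    seqExp (typeClass n Q) (okRel n (R + 2 * δ)) (Mof R n)
      (fun c => if ∑ m, Real.exp (n * g (emp2 n (c m) y)) < θ then 1 else 0) ≤
      2 * Real.exp (-(Real.exp (n * κ) / 8)) := by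
  set A := univ.filter fun z' : Fin n → α => emp2 n z' y = emp2 n z y with hA
  set T := typeClass n Q with hT
  have hn0 : (0 : ℝ) ≤ n := Nat.cast_nonneg _
  have hAT : A ⊆ T := by
    intro z' hz'
    rw [hA, mem_filter] at hz'
    rw [hT, mem_typeClass, ← hz, ← push_fst_emp2 z' y, hz'.2, push_fst_emp2]
  have hI := mutInf_emp2 z y
  rw [hz] at hI
  have hTpos := hG.sparse.card_pos
  have hu : Real.exp (n * (R - mutInf (emp2 n z y) - 2 * η)) / 8 ≤
      Mof R n * (A.card / (8 * T.card)) := by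
    have h1 : Real.exp (n * (R - mutInf (emp2 n z y) - 2 * η)) * Real.exp (n * (Ent Q + η)) =
        Real.exp (n * R) * Real.exp (n * (Ent (emp2 n z y) - Ent (emp n y) - η)) := by
      rw [← Real.exp_add, ← Real.exp_add, hI]; ring_nf
    have h2 : Real.exp (n * (R - mutInf (emp2 n z y) - 2 * η)) * T.card ≤ Mof R n * A.card :=
      calc _ ≤ Real.exp (n * (R - mutInf (emp2 n z y) - 2 * η)) * Real.exp (n * (Ent Q + η)) := by
            gcongr; exact hG.card_le_exp
        _ ≤ _ := by
            rw [h1]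
            exact mul_le_mul hG.le_M hcard (Real.exp_pos _).le (Nat.cast_nonneg _)
    rw [← mul_div_assoc, div_le_div_iff₀ (by norm_num) (by positivity)]
    nlinarith
  have hb : Real.exp (n * κ) / 8 ≤
      A.card / (4 * Real.exp (n * (Ent Q - (R + 2 * δ) + η))) := by
    rw [div_le_div_iff₀ (by norm_num) (by positivity)]
    have : Real.exp (n * κ) * Real.exp (n * (Ent Q - (R + 2 * δ) + η)) ≤ A.card := by
      refine le_trans ?_ hcard
      rw [← Real.exp_add, ← mul_add]
      exact Real.exp_le_exp.2 (mul_le_mul_of_nonneg_left (by linarith) hn0)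
    have h0 : (0 : ℝ) ≤ A.card := Nat.cast_nonneg _
    nlinarith
  have hh := hG.sparse.hits (by nlinarith [hG.small, hG.rho_le, hG.sparse.F_pos]) hAT
  have e1 : Real.exp (-(Mof R n * (A.card / (8 * T.card)))) ≤
      Real.exp (-(Real.exp (n * κ) / 8)) := by
    refine Real.exp_le_exp.2 (neg_le_neg (le_trans ?_ hu))
    gcongr
  have e2 := Real.exp_le_exp.2 (neg_le_neg hb)
  refine le_trans (seqExp_mono fun c _ => ?_) (hh.trans (by linarith))
  by_cases h : ∑ m, Real.exp (n * g (emp2 n (c m) y)) < θ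
  · rw [if_pos h, if_pos]
    by_contra! hge
    have h1 := mul_le_mul_of_nonneg_right (hu.trans hge) (Real.exp_pos (n * g (emp2 n z y))).le
    rw [Finset.sum_mul] at h1
    have h2 := h1.trans (Finset.sum_le_sum
      (g := fun m => Real.exp (n * g (emp2 n (c m) y))) fun i _ => by
        split_ifs with hi
        · rw [(mem_filter.1 hi).2, one_mul]
        · rw [zero_mul]; exact (Real.exp_pos _).le)
    have h3 : Real.exp (n * (R - mutInf (emp2 n z y) - 2 * η)) * Real.exp (n * g (emp2 n z y)) =
        Real.exp (n * (hfun g R (emp2 n z y) - 2 * η)) := by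
      rw [← Real.exp_add, hfun]; ring_nf
    linarith
  · rw [if_neg h]; positivity

/-- With overwhelming probability every output sequence sees its share of the codebook. -/
lemma eventually_prob_sum_exp_lt (hQ : IsDist Q) (hg : Continuous g) (hR : 0 < R) {D : ℕ}
    (hQD : IsTypeDist D Q) {δ ε : ℝ} (hδ : 0 < δ) (hε : 0 < ε) (C : ℝ) :
    ∀ᶠ n : ℕ in atTop, D ∣ n →
      seqExp (typeClass n Q) (okRel n (R + 2 * δ)) (Mof R n)
        (fun c => if ∃ y : Fin n → β, ∑ m, Real.exp (n * g (emp2 n (c m) y)) <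
          Real.exp (n * (alphaF Q g R (emp n y) - ε)) then 1 else 0) ≤ Real.exp (-(n * C)) := by
  obtain ⟨ε', hε', hseq⟩ := eventually_exists_seq (β := β) hQ hg hR hQD (half_pos hε)
  set η := min (δ / 2) (min (ε' / 4) (ε / 8)) with hη
  have hη0 : 0 < η := by positivity
  have hη1 : η ≤ δ / 2 := min_le_left _ _
  have hη2 : η ≤ ε' / 4 := (min_le_right _ _).trans (min_le_left _ _)
  have hη3 : η ≤ ε / 8 := (min_le_right _ _).trans (min_le_right _ _)
  filter_upwards [hseq, eventually_good hQ hQD hR hδ hη0 (by linarith),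
    eventually_card_fix_ge α β η hη0, eventually_le_exp 8 (by positivity : 0 < ε / 4),
    eventually_mul_le_exp (8 * (Fintype.card β + 1 + C)) (half_pos hε'), eventually_gt_atTop 0]
    with n hseq hgood hcard h8 hbig hn hDn
  obtain ⟨F, hG⟩ := hgood hDn
  have hn0 : (1 : ℝ) ≤ n := by exact_mod_cast hn
  have hy : ∀ y : Fin n → β, seqExp (typeClass n Q) (okRel n (R + 2 * δ)) (Mof R n)
      (fun c => if ∑ m, Real.exp (n * g (emp2 n (c m) y)) <
        Real.exp (n * (alphaF Q g R (emp n y) - ε)) then 1 else 0) ≤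
      2 * Real.exp (-(Real.exp (n * (ε' / 2)) / 8)) := by
    intro y
    obtain ⟨z, hz, hI, hα⟩ := hseq hDn y
    refine hG.prob_sum_exp_lt hz (hcard y z) (by linarith) hδ.le ?_
    calc 8 * Real.exp (n * (alphaF Q g R (emp n y) - ε)) ≤
          Real.exp (n * (ε / 4)) * Real.exp (n * (alphaF Q g R (emp n y) - ε)) := by gcongr
      _ ≤ _ := by
          rw [← Real.exp_add, ← mul_add]
          exact Real.exp_le_exp.2 (mul_le_mul_of_nonneg_left (by linarith) (by linarith))
  calc _ ≤ seqExp (typeClass n Q) (okRel n (R + 2 * δ)) (Mof R n) (fun c => ∑ y : Fin n → β,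
        if ∑ m, Real.exp (n * g (emp2 n (c m) y)) <
          Real.exp (n * (alphaF Q g R (emp n y) - ε)) then 1 else 0) := by
        refine seqExp_mono fun c _ => ?_
        have hnn : ∀ y ∈ (univ : Finset (Fin n → β)),
          (0 : ℝ) ≤ if ∑ m, Real.exp (n * g (emp2 n (c m) y)) <
            Real.exp (n * (alphaF Q g R (emp n y) - ε)) then 1 else 0 := fun y _ => by positivity
        split_ifs with h
        · obtain ⟨y, hy⟩ := h
          refine le_trans (le_of_eq ?_) (Finset.single_le_sum hnn (mem_univ y))
          rw [if_pos hy]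
        · exact Finset.sum_nonneg hnn
    _ ≤ ∑ y : Fin n → β, 2 * Real.exp (-(Real.exp (n * (ε' / 2)) / 8)) := by
        rw [seqExp_sum]
        exact Finset.sum_le_sum fun y _ => hy y
    _ = (Fintype.card β : ℝ) ^ n * (2 * Real.exp (-(Real.exp (n * (ε' / 2)) / 8))) := by
        simp
    _ ≤ Real.exp (Fintype.card β) ^ n *
          (Real.exp 1 * Real.exp (-(Real.exp (n * (ε' / 2)) / 8))) := by
        have h1 := Real.add_one_le_exp (Fintype.card β : ℝ)
        have h2 := Real.add_one_le_exp (1 : ℝ)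
        gcongr <;> linarith
    _ ≤ Real.exp (-(n * C)) := by
        rw [← Real.exp_nat_mul, ← Real.exp_add, ← Real.exp_add]
        refine Real.exp_le_exp.2 ?_
        nlinarith

end Covering

section Upper

variable {α β : Type} [Fintype α] [Fintype β] {Q : α → ℝ} {W : α → β → ℝ}
  {g : (α × β → ℝ) → ℝ} {R : ℝ} {n M : ℕ}

lemma mutInf_lt_of_seqProb_ne_zero {r : ℝ} {c : Fin M → Fin n → α}
    (hc : seqProb (typeClass n Q) (okRel n r) c ≠ 0) {i j : Fin M} (hij : i ≠ j) :
    mutInf (emp2 n (c i) (c j)) < r := by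
  rcases lt_or_gt_of_ne hij with h | h
  · rw [← mutInf_emp2_comm]
    exact okRel_iff.1 ((seqProb_support hc j).2 i h)
  · exact okRel_iff.1 ((seqProb_support hc i).2 j h)

lemma emp_eq_of_seqProb_ne_zero {r : ℝ} {c : Fin M → Fin n → α}
    (hc : seqProb (typeClass n Q) (okRel n r) c ≠ 0) (i : Fin M) : emp n (c i) = Q :=
  mem_typeClass.1 (seqProb_support hc i).1

/-- The contribution to the error probability of a triple of type `τ`. -/
def tripleBound (n : ℕ) (Q : α → ℝ) (W : α → β → ℝ) (g : (α × β → ℝ) → ℝ) (R r ε : ℝ)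
    (τ : α × α × β → ℝ) : ℝ :=
  if τ ∈ lawSet Q W r then Real.exp (n * (logLik W τ - gap Q g R τ + ε)) else 0

lemma tripleBound_nonneg (r ε : ℝ) (τ : α × α × β → ℝ) : 0 ≤ tripleBound n Q W g R r ε τ := by
  unfold tripleBound; positivity

lemma Pe_le_sum_tripleBound (hn : 0 < n) (hW : IsChannel W) {r ε : ℝ} (hε : 0 ≤ ε)
    {c : Fin M → Fin n → α} (hc : seqProb (typeClass n Q) (okRel n r) c ≠ 0)
    (hgood : ∀ y : Fin n → β, Real.exp (n * (alphaF Q g R (emp n y) - ε)) ≤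
      ∑ m, Real.exp (n * g (emp2 n (c m) y))) :
    Pe n W g c ≤ (M : ℝ)⁻¹ * ∑ m : Fin M, ∑ m' ∈ univ.erase m, ∑ y : Fin n → β,
      tripleBound n Q W g R r ε (emp n (tri (c m) (c m') y)) := by
  rw [Pe]
  gcongr with m _ m' hm' y _
  rcases eq_or_ne (Wn n W (c m) y) 0 with h0 | h0
  · rw [h0, zero_mul, zero_div]; exact tripleBound_nonneg _ _ _
  have hA := adm_of_Wn_ne_zero (W := W) (x' := c m') hn (emp_eq_of_seqProb_ne_zero hc m)
    (emp_eq_of_seqProb_ne_zero hc m') h0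
  have hlaw : emp n (tri (c m) (c m') y) ∈ lawSet Q W r :=
    ⟨hA, by rw [margXX_tri]; exact mutInf_lt_of_seqProb_ne_zero hc (ne_of_mem_erase hm').symm⟩
  rw [tripleBound, if_pos hlaw, hA.Wn_eq hn hW]
  set S := ∑ m'' : Fin M, Real.exp ((n : ℝ) * g (emp2 n (c m'') y)) with hS
  have hle : ∀ k : Fin M, Real.exp ((n : ℝ) * g (emp2 n (c k) y)) ≤ S := fun k =>
    Finset.single_le_sum (f := fun k => Real.exp ((n : ℝ) * g (emp2 n (c k) y)))
      (fun _ _ => (Real.exp_pos _).le) (mem_univ k)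
  have hSpos : 0 < S := (Real.exp_pos _).trans_le (hle m)
  have hn0 : (0 : ℝ) ≤ n := Nat.cast_nonneg _
  have hlogS : n * (g (emp2 n (c m') y) + gap Q g R (emp n (tri (c m) (c m') y)) - ε) ≤
      Real.log S := by
    have e1 := (Real.le_log_iff_exp_le hSpos).2 (hle m)
    have e2 := (Real.le_log_iff_exp_le hSpos).2 (hle m')
    have e3 := (Real.le_log_iff_exp_le hSpos).2 (hgood y)
    have hnε : 0 ≤ n * ε := by positivity
    rw [gap, margXY_tri, margXpY_tri, margY_tri, pos]
    rcases max_cases (max (g (emp2 n (c m) y)) (alphaF Q g R (emp n y)) - g (emp2 n (c m') y)) 0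
      with h | h <;> rcases max_cases (g (emp2 n (c m) y)) (alphaF Q g R (emp n y)) with h' | h' <;>
      rw [h.1] <;> try rw [h'.1]
    all_goals ring_nf at e1 e2 e3 ⊢; linarith
  rw [mul_div_assoc, show n * (logLik W (emp n (tri (c m) (c m') y)) -
    gap Q g R (emp n (tri (c m) (c m') y)) + ε) = n * logLik W (emp n (tri (c m) (c m') y)) +
    n * (ε - gap Q g R (emp n (tri (c m) (c m') y))) by ring, Real.exp_add]
  refine mul_le_mul_of_nonneg_left ?_ (Real.exp_pos _).le
  rw [div_le_iff₀ hSpos]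
  rw [← Real.exp_log hSpos, ← Real.exp_add]
  refine Real.exp_le_exp.2 ?_
  linarith

lemma sum_tri (F : (Fin n → α × α × β) → ℝ) :
    ∑ x : Fin n → α, ∑ x' : Fin n → α, ∑ y : Fin n → β, F (tri x x' y) = ∑ w, F w := by
  simp only [← Fintype.sum_prod_type']
  refine Fintype.sum_equiv
    ⟨fun p => tri p.1 p.2.1 p.2.2, fun w => (fun i => (w i).1, fun i => (w i).2.1,
      fun i => (w i).2.2), fun _ => rfl, fun _ => rfl⟩ _ _ fun p => rfl

lemma Good.seqExp_sum_tripleBound_le {δ η F C r ε : ℝ} (hG : Good n Q R δ η F)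
    (hC : ∑ w : Fin n → α × α × β, tripleBound n Q W g R r ε (emp n w) ≤ C) :
    seqExp (typeClass n Q) (okRel n (R + 2 * δ)) (Mof R n) (fun c =>
      ((Mof R n : ℕ) : ℝ)⁻¹ * ∑ m, ∑ m' ∈ univ.erase m, ∑ y : Fin n → β,
        tripleBound n Q W g R r ε (emp n (tri (c m) (c m') y))) ≤
      8 * Real.exp (n * (R - 2 * Ent Q + 2 * η)) * C := by
  set T := typeClass n Q
  set M := Mof R n
  have hM : (0 : ℝ) < M := (Real.exp_pos _).trans_le hG.le_M
  have hnn : ∀ x x' : Fin n → α, 0 ≤ ∑ y : Fin n → β,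
      tripleBound n Q W g R r ε (emp n (tri x x' y)) :=
    fun x x' => Finset.sum_nonneg fun y _ => tripleBound_nonneg _ _ _
  have hCnn : 0 ≤ C := (Finset.sum_nonneg fun w _ => tripleBound_nonneg _ _ _).trans hC
  have hsum : ∑ x ∈ T, ∑ x' ∈ T, ∑ y : Fin n → β,
      tripleBound n Q W g R r ε (emp n (tri x x' y)) ≤ C := by
    refine le_trans ?_ hC
    rw [← sum_tri fun w : Fin n → α × α × β => tripleBound n Q W g R r ε (emp n w)]
    refine (Finset.sum_le_sum fun x _ => Finset.sum_le_sum_of_subset_of_nonneg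
      (subset_univ T) fun x' _ _ => hnn x x').trans ?_
    exact Finset.sum_le_sum_of_subset_of_nonneg (subset_univ T) fun x _ _ =>
      Finset.sum_nonneg fun x' _ => hnn x x'
  have hpair : ∀ m m' : Fin M, m' ∈ univ.erase m → seqExp T (okRel n (R + 2 * δ)) M (fun c =>
      ∑ y : Fin n → β, tripleBound n Q W g R r ε (emp n (tri (c m) (c m') y))) ≤
      F⁻¹ ^ 2 * C := fun m m' h =>
    (hG.sparse.seqExp_two_le (ne_of_mem_erase h).symm (fun x x' => ∑ y : Fin n → β,
      tripleBound n Q W g R r ε (emp n (tri x x' y))) hnn).trans (by gcongr)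
  have hF := hG.sparse.F_pos
  have hF2 : F⁻¹ ^ 2 ≤ 4 * Real.exp (-(2 * (n * (Ent Q - η)))) := by
    have h1 : Real.exp (n * (Ent Q - η)) ≤ 2 * F := hG.le_card.trans hG.card_le_two
    have h2 : F⁻¹ ≤ 2 * Real.exp (-(n * (Ent Q - η))) := by
      rw [Real.exp_neg, inv_le_iff_one_le_mul₀ hF, mul_assoc, mul_left_comm,
        le_inv_mul_iff₀ (Real.exp_pos _)]
      linarith
    calc F⁻¹ ^ 2 ≤ (2 * Real.exp (-(n * (Ent Q - η)))) ^ 2 := by gcongr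
      _ = _ := by rw [mul_pow, ← Real.exp_nat_mul]; norm_num
  rw [seqExp_mul_left, seqExp_sum]
  simp only [seqExp_sum (univ.erase _)]
  calc _ ≤ (M : ℝ)⁻¹ * ∑ m : Fin M, ∑ m' : Fin M, F⁻¹ ^ 2 * C := by
        refine mul_le_mul_of_nonneg_left (Finset.sum_le_sum fun m _ => ?_) (by positivity)
        refine (Finset.sum_le_sum fun m' hm' => hpair m m' hm').trans ?_
        exact Finset.sum_le_sum_of_subset_of_nonneg (erase_subset _ _) fun _ _ _ => by positivity
    _ = M * (F⁻¹ ^ 2 * C) := by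
        simp only [sum_const, card_univ, Fintype.card_fin, nsmul_eq_mul]
        field_simp
    _ ≤ 2 * Real.exp (n * R) * (4 * Real.exp (-(2 * (n * (Ent Q - η)))) * C) := by
        gcongr
        exact hG.M_le
    _ = _ := by
        rw [show n * (R - 2 * Ent Q + 2 * η) = n * R + -(2 * (n * (Ent Q - η))) by ring,
          Real.exp_add]
        ring

/-- The expected error probability decays at least as fast as the typical exponent predicts. -/
lemma eventually_seqExp_Pe_le (hQ : IsDist Q) (hW : IsChannel W) (hg : Continuous g) (hR : 0 < R)
    {D : ℕ} (hQD : IsTypeDist D Q) {δ ε : ℝ} (hδ : 0 < δ) (hε : 0 < ε) :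
    ∀ᶠ n : ℕ in atTop, D ∣ n →
      seqExp (typeClass n Q) (okRel n (R + 2 * δ)) (Mof R n) (fun c => Pe n W g c) ≤
        Real.exp (-(n * (trcExp Q W g R (R + 2 * δ) - ε))) := by
  set L := trcExp Q W g R (R + 2 * δ)
  set η := min (δ / 2) (ε / 8)
  have hη0 : 0 < η := by positivity
  have hη1 : η ≤ δ / 2 := min_le_left _ _
  have hη2 : η ≤ ε / 8 := min_le_right _ _
  have hε4 : 0 < ε / 4 := by positivity
  filter_upwards [eventually_good hQ hQD hR hδ hη0 (by linarith),
    eventually_prob_sum_exp_lt (β := β) hQ hg hR hQD hδ hε4 L,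
    eventually_sum_types_le (α × α × β) η hη0, eventually_le_exp 9 hε4,
    eventually_gt_atTop 0] with n hgood hbad hsum h9 hn hDn
  obtain ⟨F, hG⟩ := hgood hDn
  have hn0 : (0 : ℝ) ≤ n := Nat.cast_nonneg _
  have hC : ∑ w : Fin n → α × α × β, tripleBound n Q W g R (R + 2 * δ) (ε / 4) (emp n w) ≤
      Real.exp (n * η) * Real.exp (n * (2 * Ent Q - R - L + ε / 4)) := by
    refine hsum _ _ (Real.exp_pos _).le (fun τ => tripleBound_nonneg _ _ _) fun w => ?_
    rw [tripleBound]
    split_ifs with h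
    · rw [← Real.exp_add, ← mul_add]
      have h1 := trcExp_le hQ hg hR h
      rw [expo] at h1
      exact Real.exp_le_exp.2 (mul_le_mul_of_nonneg_left (by linarith) hn0)
    · rw [mul_zero]; exact (Real.exp_pos _).le
  have hMpos : 0 < Mof R n := by
    exact_mod_cast (Real.exp_pos _).trans_le hG.le_M
  have hmain := hG.seqExp_sum_tripleBound_le hC
  have hstep : seqExp (typeClass n Q) (okRel n (R + 2 * δ)) (Mof R n) (fun c => Pe n W g c) ≤
      Real.exp (-(n * L)) + 8 * Real.exp (n * (R - 2 * Ent Q + 2 * η)) *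
        (Real.exp (n * η) * Real.exp (n * (2 * Ent Q - R - L + ε / 4))) := by
    refine le_trans ?_ (add_le_add (hbad hDn) hmain)
    rw [← seqExp_add]
    refine seqExp_mono fun c hc => ?_
    split_ifs with h
    · refine (Pe_le_one hMpos hW c).trans ((le_add_iff_nonneg_right _).2 ?_)
      exact mul_nonneg (by positivity) (Finset.sum_nonneg fun _ _ => Finset.sum_nonneg fun _ _ =>
        Finset.sum_nonneg fun _ _ => tripleBound_nonneg _ _ _)
    · rw [zero_add]
      push Not at h
      exact Pe_le_sum_tripleBound hn hW hε4.le hc h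
  refine hstep.trans ?_
  rw [mul_assoc 8, ← Real.exp_add, ← Real.exp_add]
  have e1 : Real.exp (-(n * L)) ≤ Real.exp (-(n * (L - 3 * ε / 4))) :=
    Real.exp_le_exp.2 (neg_le_neg (mul_le_mul_of_nonneg_left (by linarith) hn0))
  have e2 : Real.exp (n * (R - 2 * Ent Q + 2 * η) + (n * η + n * (2 * Ent Q - R - L + ε / 4))) ≤
      Real.exp (-(n * (L - 3 * ε / 4))) := by
    rw [← mul_add, ← mul_add, ← mul_neg]
    exact Real.exp_le_exp.2 (mul_le_mul_of_nonneg_left (by linarith) hn0)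
  calc _ ≤ 9 * Real.exp (-(n * (L - 3 * ε / 4))) := by linarith
    _ ≤ Real.exp (n * (ε / 4)) * Real.exp (-(n * (L - 3 * ε / 4))) := by gcongr
    _ = _ := by rw [← Real.exp_add]; ring_nf

end Upper

section Triples

variable {α β : Type} [Fintype α] [Fintype β] {Q : α → ℝ} {W : α → β → ℝ}
  {g : (α × β → ℝ) → ℝ} {R : ℝ} {n M : ℕ}

/-- Admissible laws are approximated by types of triples of sequences. -/
lemma eventually_exists_tri (hQ : IsDist Q) (hW : IsChannel W) (hg : Continuous g) (hR : 0 < R)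
    {D : ℕ} (hQD : IsTypeDist D Q) {r ε : ℝ} (hε : 0 < ε) {τ : α × α × β → ℝ}
    (hτ : τ ∈ lawSet Q W r) :
    ∀ᶠ n : ℕ in atTop, D ∣ n → ∃ (x x' : Fin n → α) (y : Fin n → β),
      emp n (tri x x' y) ∈ lawSet Q W r ∧
        expo Q W g R (emp n (tri x x' y)) ≤ expo Q W g R τ + ε := by
  obtain ⟨t₁, ht₁, h1⟩ := exists_unif_cont isCompact_isDist
    (continuousOn_expo (W := W) hQ hg hR) hε
  have hcont : ContinuousOn (fun τ : α × α × β → ℝ => mutInf (margXX τ)) {τ | IsDist τ} :=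
    continuousOn_mutInf.comp (continuous_push _).continuousOn fun τ hτ => IsDist.push _ hτ
  obtain ⟨t₂, ht₂, h2⟩ := exists_unif_cont isCompact_isDist hcont
    (half_pos (sub_pos.2 hτ.2))
  have hk : ∀ a, ∃ b, W a b ≠ 0 := by
    intro a
    by_contra! h
    have := (hW a).2
    simp [h] at this
  choose k₀ hk₀ using hk
  have hlim : Tendsto (fun n : ℕ => ((Fintype.card (α × α × β) : ℝ) + 1) / n) atTop (nhds 0) :=
    tendsto_const_nhds.div_atTop tendsto_natCast_atTop_atTop
  filter_upwards [hlim.eventually_le_const (show 0 < min t₁ t₂ by positivity),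
    eventually_gt_atTop 0] with n hsmall hn hDn
  have hQn := hQD.of_dvd hDn
  obtain ⟨τ', hd, ht, hf, hs, hclose, hsupp⟩ := exists_rounding hn hτ.1.dist
    (by rw [hτ.1.fst]; exact hQn) (by rw [hτ.1.snd]; exact hQn) k₀
  obtain ⟨w, hw⟩ := exists_emp_eq hn hd.2 ht
  have hAdm : Adm Q W τ' := by
    refine ⟨hd, hf.trans hτ.1.fst, hs.trans hτ.1.snd, fun p hp => ?_⟩
    by_contra h0
    rcases hsupp p h0 with h | h
    · exact h (hτ.1.abs p hp)
    · exact hk₀ p.1 (h ▸ hp)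
  refine ⟨fun i => (w i).1, fun i => (w i).2.1, fun i => (w i).2.2, ?_⟩
  have hw' : emp n (tri (fun i => (w i).1) (fun i => (w i).2.1) fun i => (w i).2.2) = τ' := hw
  rw [hw']
  have e1 := abs_le.1 (h1 τ' hd τ hτ.1.dist fun p =>
    (hclose p).trans (hsmall.trans (min_le_left _ _)))
  have e2 := abs_le.1 (h2 τ' hd τ hτ.1.dist fun p =>
    (hclose p).trans (hsmall.trans (min_le_right _ _)))
  have e3 := hτ.2
  exact ⟨⟨hAdm, by linarith⟩, by linarith⟩

/-- Indicator of a pair of sequences of joint type `P`. -/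
def pairInd (n : ℕ) (P : α × α → ℝ) (x x' : Fin n → α) : ℝ := if emp2 n x x' = P then 1 else 0

/-- Indicator of a triple of sequences of joint type `τ`. -/
def triInd (n : ℕ) (τ : α × α × β → ℝ) (x x' : Fin n → α) (y : Fin n → β) : ℝ :=
  if emp n (tri x x' y) = τ then 1 else 0

lemma triInd_nonneg (τ : α × α × β → ℝ) (x x' : Fin n → α) (y : Fin n → β) :
    0 ≤ triInd n τ x x' y := by
  unfold triInd; positivity

lemma emp2_swap (x : Fin n → α) (y : Fin n → β) :
    emp2 n y x = push Prod.swap (emp2 n x y) := by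
  rw [emp2_eq, emp2_eq, ← emp_comp]; rfl

lemma regular_pairInd {r : ℝ} {x₀ x₁ : Fin n → α} (h₀ : emp n x₀ = Q) (h₁ : emp n x₁ = Q)
    (hr : mutInf (emp2 n x₀ x₁) < r) :
    Regular (typeClass n Q) (okRel n r) (pairInd n (emp2 n x₀ x₁))
      ((univ.filter fun z : Fin n → α => emp2 n z x₁ = emp2 n x₀ x₁).card : ℝ) := by
  set T := typeClass n Q with hT
  set s := ((univ.filter fun z : Fin n → α => emp2 n z x₁ = emp2 n x₀ x₁).card : ℝ) with hs
  have hcol : ∀ y ∈ T, ∑ x ∈ T, pairInd n (emp2 n x₀ x₁) x y = s := by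
    intro y hy
    rw [Finset.sum_subset (f := fun x => pairInd n (emp2 n x₀ x₁) x y) (subset_univ T)
      fun x _ hx => if_neg fun h => hx ?_]
    · refine (sum_emp2_congr (fun P => if P = emp2 n x₀ x₁ then (1 : ℝ) else 0)
        ((mem_typeClass.1 hy).trans h₁.symm)).trans ?_
      rw [Finset.sum_boole]
    · rw [hT, mem_typeClass, ← push_fst_emp2 x y, h, push_fst_emp2, h₀]
  have hrow : ∀ x ∈ T, ∑ y ∈ T, pairInd n (emp2 n x₀ x₁) x y =
      ∑ y, pairInd n (emp2 n x₀ x₁) x₀ y := by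
    intro x hx
    rw [Finset.sum_subset (f := fun y => pairInd n (emp2 n x₀ x₁) x y) (subset_univ T)
      fun y _ hy => if_neg fun h => hy ?_]
    · have hsw : ∀ u y : Fin n → α, pairInd n (emp2 n x₀ x₁) u y =
          if push Prod.swap (emp2 n y u) = emp2 n x₀ x₁ then 1 else 0 := fun u y => by
        rw [pairInd, emp2_swap y u]
      simp only [hsw]
      exact sum_emp2_congr (fun P => if push Prod.swap P = emp2 n x₀ x₁ then (1 : ℝ) else 0)
        ((mem_typeClass.1 hx).trans h₀.symm)
    · rw [hT, mem_typeClass, ← push_snd_emp2 x y, h, push_snd_emp2, h₁]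
  have hTpos : (0 : ℝ) < T.card := by
    exact_mod_cast card_pos.2 ⟨x₀, mem_typeClass.2 h₀⟩
  have hrs : ∑ y, pairInd n (emp2 n x₀ x₁) x₀ y = s := by
    have e1 := Finset.sum_congr rfl hrow
    have e2 := Finset.sum_congr rfl hcol
    rw [Finset.sum_comm, e1, sum_const, sum_const, nsmul_eq_mul, nsmul_eq_mul] at e2
    exact mul_left_cancel₀ hTpos.ne' e2
  refine ⟨fun x y => ?_, fun x y h => ?_, fun x hx => (hrow x hx).trans hrs, hcol⟩
  · rw [pairInd]; split_ifs <;> simp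
  · rw [okRel_iff, mutInf_emp2_comm]
    rw [pairInd] at h
    rwa [(ite_ne_right_iff.1 h).1]

lemma sum_triInd (x₀ x₁ x x' : Fin n → α) (y₀ : Fin n → β) :
    ∑ y, triInd n (emp n (tri x₀ x₁ y₀)) x x' y =
      pairInd n (emp2 n x₀ x₁) x x' * ∑ y, triInd n (emp n (tri x₀ x₁ y₀)) x₀ x₁ y := by
  rw [pairInd]
  split_ifs with h
  · rw [one_mul]
    have hpush : ∀ (u u' : Fin n → α) (y : Fin n → β), emp n (tri u u' y) =
        push (fun p : β × α × α => (p.2.1, p.2.2, p.1)) (emp2 n y fun i => (u i, u' i)) := by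
      intro u u' y
      rw [emp2_eq, ← emp_comp]; rfl
    simp only [triInd, fun u u' y => hpush u u' y]
    refine sum_emp2_congr (fun P : β × α × α → ℝ =>
      if push (fun p : β × α × α => (p.2.1, p.2.2, p.1)) P = _ then (1 : ℝ) else 0) ?_
    rw [← emp2_eq, ← emp2_eq, h]
  · rw [zero_mul]
    refine Finset.sum_eq_zero fun y _ => if_neg fun h' => h ?_
    rw [← margXX_tri x x' y, h', margXX_tri]

lemma sum_sum_sum_triInd_mul {x₀ x₁ : Fin n → α} {y₀ : Fin n → β} (h₀ : emp n x₀ = Q)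
    (h₁ : emp n x₁ = Q) :
    ∑ x ∈ typeClass n Q, ∑ x' ∈ typeClass n Q, ∑ y, triInd n (emp n (tri x₀ x₁ y₀)) x x' y =
      (cls (tri x₀ x₁ y₀)).card := by
  have hzero : ∀ x x' : Fin n → α, x ∉ typeClass n Q ∨ x' ∉ typeClass n Q →
      ∑ y, triInd n (emp n (tri x₀ x₁ y₀)) x x' y = 0 := by
    refine fun x x' hx => Finset.sum_eq_zero fun y _ => if_neg fun h => ?_
    rcases hx with hx | hx <;> refine hx (mem_typeClass.2 ?_)
    · rw [← push_fst_tri x x' y, h, push_fst_tri, h₀]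
    · rw [← push_snd_tri x x' y, h, push_snd_tri, h₁]
  rw [Finset.sum_subset (subset_univ _) fun x _ hx =>
    Finset.sum_eq_zero fun x' _ => hzero x x' (Or.inl hx)]
  rw [Finset.sum_congr rfl fun x _ => Finset.sum_subset (subset_univ _) fun x' _ hx' =>
    hzero x x' (Or.inr hx')]
  refine (sum_tri fun w : Fin n → α × α × β =>
    if emp n w = emp n (tri x₀ x₁ y₀) then (1 : ℝ) else 0).trans ?_
  rw [Finset.sum_boole]
  rfl

end Triples

section Rivals

variable {α β : Type} [Fintype α] [Fintype β] {Q : α → ℝ} {W : α → β → ℝ}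
  {g : (α × β → ℝ) → ℝ} {R : ℝ} {n M : ℕ}

/-- The relative score of a competing codeword having joint type `P` with the output, truncated
at `1` for codewords that are unusually close to the output. -/
def rivalBound (n : ℕ) (Q : α → ℝ) (g : (α × β → ℝ) → ℝ) (R ε ε' : ℝ) (P : α × β → ℝ) : ℝ :=
  if push Prod.fst P = Q then
    if mutInf P ≤ R + ε' then Real.exp (n * (g P - alphaF Q g R (push Prod.snd P) - ε)) else 1
  else 0

lemma rivalBound_nonneg (ε ε' : ℝ) (P : α × β → ℝ) : 0 ≤ rivalBound n Q g R ε ε' P := by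
  unfold rivalBound; positivity

lemma eventually_sum_rivalBound_le (hQ : IsDist Q) (hg : Continuous g) (hR : 0 < R) {ε : ℝ}
    (hε : 0 < ε) :
    ∃ ε' > 0, ∃ κ > 0, ∀ η > 0, ∀ᶠ n : ℕ in atTop, ∀ y : Fin n → β,
      ∑ z : Fin n → α, rivalBound n Q g R ε ε' (emp2 n z y) ≤
        Real.exp (n * (Ent Q - R - κ + η)) := by
  obtain ⟨ε', hε', hα⟩ := exists_hfun_le_alphaF (β := β) hQ hg hR (half_pos hε)
  refine ⟨ε', hε', min (ε / 2) ε', by positivity, fun η hη => ?_⟩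
  filter_upwards [eventually_sum_fix_le α β η hη, eventually_gt_atTop 0] with n hsum hn y
  have hn0 : (0 : ℝ) ≤ n := Nat.cast_nonneg _
  have hκ1 := min_le_left (ε / 2) ε'
  have hκ2 := min_le_right (ε / 2) ε'
  rw [mul_add, add_comm, Real.exp_add]
  refine hsum y _ _ (Real.exp_pos _).le (fun P => rivalBound_nonneg _ _ _) fun z => ?_
  rw [rivalBound, push_fst_emp2, push_snd_emp2]
  split_ifs with hz hI
  · rw [← Real.exp_add, ← mul_add]
    have h1 := hα (emp n y) (emp n y) (emp_isDist hn y) (emp_isDist hn y)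
      (fun b => by simp [hε'.le]) _ (coup_emp2 z y hz) hI
    have h2 := mutInf_emp2 z y
    rw [hz] at h2
    rw [hfun] at h1
    exact Real.exp_le_exp.2 (mul_le_mul_of_nonneg_left (by linarith) hn0)
  · rw [mul_one]
    have h2 := mutInf_emp2 z y
    rw [hz] at h2
    push Not at hI
    exact Real.exp_le_exp.2 (mul_le_mul_of_nonneg_left (by linarith) hn0)
  · rw [mul_zero]; exact (Real.exp_pos _).le

/-- Unless the competing codewords score too high, a triple contributes its share to the error
probability. -/
lemma le_error_term (hn : 0 < n) (hW : IsChannel W) {ε ε' : ℝ} (hε : 0 ≤ ε)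
    {c : Fin M → Fin n → α} (hc : ∀ k, emp n (c k) = Q) {i j : Fin M} (hij : i ≠ j)
    {y : Fin n → β} (hA : Adm Q W (emp n (tri (c i) (c j) y))) :
    Real.exp (n * (logLik W (emp n (tri (c i) (c j) y)) -
        gap Q g R (emp n (tri (c i) (c j) y)) - ε)) / 3 *
      (1 - ∑ k ∈ (univ.erase i).erase j, rivalBound n Q g R ε ε' (emp2 n (c k) y)) ≤
    Wn n W (c i) y * Real.exp ((n : ℝ) * g (emp2 n (c j) y)) /
      ∑ k : Fin M, Real.exp ((n : ℝ) * g (emp2 n (c k) y)) := by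
  set τ := emp n (tri (c i) (c j) y) with hτ
  set ρ := ∑ k ∈ (univ.erase i).erase j, rivalBound n Q g R ε ε' (emp2 n (c k) y) with hρ
  set e : Fin M → ℝ := fun k => Real.exp ((n : ℝ) * g (emp2 n (c k) y)) with he
  have he0 : ∀ k, 0 < e k := fun k => Real.exp_pos _
  have hS0 : 0 < ∑ k, e k := Finset.sum_pos (fun k _ => he0 k) ⟨i, mem_univ i⟩
  have hn0 : (0 : ℝ) ≤ n := Nat.cast_nonneg _
  have hρ0 : 0 ≤ ρ := Finset.sum_nonneg fun k _ => rivalBound_nonneg _ _ _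
  rcases le_or_gt 1 ρ with h1 | h1
  · refine le_trans (mul_nonpos_of_nonneg_of_nonpos (by positivity) (by linarith)) ?_
    exact div_nonneg (mul_nonneg (Wn_nonneg hW _ _) (he0 j).le) hS0.le
  have hr : ∀ k ∈ (univ.erase i).erase j, e k =
      Real.exp (n * (alphaF Q g R (emp n y) + ε)) *
        rivalBound n Q g R ε ε' (emp2 n (c k) y) := by
    intro k hk
    have hlt := (Finset.single_le_sum (f := fun k => rivalBound n Q g R ε ε' (emp2 n (c k) y))
      (fun k _ => rivalBound_nonneg _ _ _) hk).trans_lt h1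
    simp only [rivalBound, push_fst_emp2, push_snd_emp2, hc k, if_true] at hlt ⊢
    split_ifs at hlt ⊢ with hI
    · rw [← Real.exp_add]
      simp only [he]
      ring_nf
    · exact absurd hlt (lt_irrefl _)
  have hgapY : gap Q g R τ = max (max (g (emp2 n (c i) y)) (alphaF Q g R (emp n y)) -
      g (emp2 n (c j) y)) 0 := by
    rw [gap, hτ, margXY_tri, margXpY_tri, margY_tri, pos]
  set B := Real.exp (n * (g (emp2 n (c j) y) + gap Q g R τ + ε)) with hB
  have hle1 := le_max_left (max (g (emp2 n (c i) y)) (alphaF Q g R (emp n y)) -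
      g (emp2 n (c j) y)) 0
  have hle2 := le_max_right (max (g (emp2 n (c i) y)) (alphaF Q g R (emp n y)) -
      g (emp2 n (c j) y)) 0
  have hle3 := le_max_left (g (emp2 n (c i) y)) (alphaF Q g R (emp n y))
  have hle4 := le_max_right (g (emp2 n (c i) y)) (alphaF Q g R (emp n y))
  rw [← hgapY] at hle1 hle2
  have hSB : ∑ k, e k ≤ 3 * B := by
    have e1 : e i ≤ B := Real.exp_le_exp.2 (mul_le_mul_of_nonneg_left (by linarith) hn0)
    have e2 : e j ≤ B := Real.exp_le_exp.2 (mul_le_mul_of_nonneg_left (by linarith) hn0)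
    have e3 : Real.exp (n * (alphaF Q g R (emp n y) + ε)) ≤ B :=
      Real.exp_le_exp.2 (mul_le_mul_of_nonneg_left (by linarith) hn0)
    rw [← Finset.add_sum_erase _ _ (mem_univ i),
      ← Finset.add_sum_erase _ _ (mem_erase.2 ⟨hij.symm, mem_univ j⟩), Finset.sum_congr rfl hr,
      ← Finset.mul_sum, ← hρ]
    nlinarith [Real.exp_pos (n * (alphaF Q g R (emp n y) + ε))]
  rw [hA.Wn_eq hn hW, le_div_iff₀ hS0]
  calc _ ≤ Real.exp (n * (logLik W τ - gap Q g R τ - ε)) / 3 * 1 * (3 * B) := by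
        gcongr
        linarith
    _ = Real.exp (n * (logLik W τ - gap Q g R τ - ε)) * B := by ring
    _ = _ := by
        rw [hB, ← Real.exp_add, ← Real.exp_add, hτ]
        ring_nf

end Rivals

section Lower

variable {α β : Type} [Fintype α] [Fintype β] {Q : α → ℝ} {W : α → β → ℝ}
  {g : (α × β → ℝ) → ℝ} {R : ℝ} {n M : ℕ}

/-- Total score `r` of the competitors over all triples of type `τ` in a codebook. -/
def rivalSum (n : ℕ) (τ : α × α × β → ℝ) (r : (α × β → ℝ) → ℝ) (I J : Finset (Fin M))
    (c : Fin M → Fin n → α) : ℝ :=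
  ∑ i ∈ I, ∑ j ∈ J, ∑ k ∈ (univ.erase i).erase j, ∑ y,
    triInd n τ (c i) (c j) y * r (emp2 n (c k) y)

lemma Good.seqExp_rivalSum_le {δ η F B : ℝ} (hG : Good n Q R δ η F) {x₀ x₁ : Fin n → α}
    {y₀ : Fin n → β} (h₀ : emp n x₀ = Q) (h₁ : emp n x₁ = Q) {r : (α × β → ℝ) → ℝ}
    (hr : ∀ P, 0 ≤ r P) (hB : ∀ y : Fin n → β, ∑ z : Fin n → α, r (emp2 n z y) ≤ B)
    {I J : Finset (Fin (Mof R n))} (hIJ : ∀ i ∈ I, ∀ j ∈ J, i < j) :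
    seqExp (typeClass n Q) (okRel n (R + 2 * δ)) (Mof R n)
      (rivalSum n (emp n (tri x₀ x₁ y₀)) r I J) ≤
      I.card * J.card * Mof R n * (F⁻¹ ^ 3 * ((cls (tri x₀ x₁ y₀)).card * B)) := by
  set T := typeClass n Q
  set τ := emp n (tri x₀ x₁ y₀)
  have hF := hG.sparse.F_pos
  have hB0 : 0 ≤ B := (Finset.sum_nonneg fun z _ => hr _).trans (hB y₀)
  have hsum : ∑ x ∈ T, ∑ x' ∈ T, ∑ z ∈ T, ∑ y, triInd n τ x x' y * r (emp2 n z y) ≤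
      (cls (tri x₀ x₁ y₀)).card * B := by
    rw [← sum_sum_sum_triInd_mul h₀ h₁, Finset.sum_mul]
    refine Finset.sum_le_sum fun x _ => ?_
    rw [Finset.sum_mul]
    refine Finset.sum_le_sum fun x' _ => ?_
    rw [Finset.sum_comm, Finset.sum_mul]
    refine Finset.sum_le_sum fun y _ => ?_
    rw [← Finset.mul_sum]
    refine mul_le_mul_of_nonneg_left (le_trans ?_ (hB y)) (triInd_nonneg _ _ _ _)
    exact Finset.sum_le_sum_of_subset_of_nonneg (subset_univ _) fun z _ _ => hr _
  have hterm : ∀ i ∈ I, ∀ j ∈ J, ∀ k ∈ (univ.erase i).erase j,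
      seqExp T (okRel n (R + 2 * δ)) (Mof R n) (fun c => ∑ y,
        triInd n τ (c i) (c j) y * r (emp2 n (c k) y)) ≤
      F⁻¹ ^ 3 * ((cls (tri x₀ x₁ y₀)).card * B) := by
    intro i hi j hj k hk
    refine (hG.sparse.seqExp_three_le (hIJ i hi j hj).ne
      (ne_of_mem_erase (mem_of_mem_erase hk)).symm (ne_of_mem_erase hk).symm
      (fun x x' z => ∑ y, triInd n τ x x' y * r (emp2 n z y)) fun x x' z =>
        Finset.sum_nonneg fun y _ => mul_nonneg (triInd_nonneg _ _ _ _) (hr _)).trans ?_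
    gcongr
  unfold rivalSum
  rw [seqExp_sum]
  simp only [seqExp_sum J, seqExp_sum ((univ.erase _).erase _)]
  calc _ ≤ ∑ i ∈ I, ∑ j ∈ J, Mof R n * (F⁻¹ ^ 3 * ((cls (tri x₀ x₁ y₀)).card * B)) := by
        refine Finset.sum_le_sum fun i hi => Finset.sum_le_sum fun j hj => ?_
        refine (Finset.sum_le_sum fun k hk => hterm i hi j hj k hk).trans ?_
        refine (Finset.sum_le_sum_of_subset_of_nonneg (subset_univ _)
          fun _ _ _ => by positivity).trans (le_of_eq ?_)
        simp
    _ = _ := by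
        simp only [sum_const, nsmul_eq_mul]
        ring

lemma le_Pe_of_pairs (hn : 0 < n) (hW : IsChannel W) {ε ε' : ℝ} (hε : 0 ≤ ε)
    {x₀ x₁ : Fin n → α} {y₀ : Fin n → β} (hA : Adm Q W (emp n (tri x₀ x₁ y₀)))
    {c : Fin M → Fin n → α} (hc : ∀ k, emp n (c k) = Q)
    {I J : Finset (Fin M)} (hIJ : ∀ i ∈ I, ∀ j ∈ J, i < j) :
    (M : ℝ)⁻¹ * (Real.exp (n * (logLik W (emp n (tri x₀ x₁ y₀)) -
        gap Q g R (emp n (tri x₀ x₁ y₀)) - ε)) / 3 *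
      ((∑ i ∈ I, ∑ j ∈ J, pairInd n (emp2 n x₀ x₁) (c i) (c j)) *
        (∑ y, triInd n (emp n (tri x₀ x₁ y₀)) x₀ x₁ y) -
        rivalSum n (emp n (tri x₀ x₁ y₀)) (rivalBound n Q g R ε ε') I J c)) ≤
      Pe n W g c := by
  set τ := emp n (tri x₀ x₁ y₀) with hτ
  set A := Real.exp (n * (logLik W τ - gap Q g R τ - ε)) / 3 with hAdef
  have hnn : ∀ m m' : Fin M, 0 ≤ ∑ y : Fin n → β,
      Wn n W (c m) y * Real.exp ((n : ℝ) * g (emp2 n (c m') y)) /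
        ∑ m'' : Fin M, Real.exp ((n : ℝ) * g (emp2 n (c m'') y)) := fun m m' =>
    Finset.sum_nonneg fun y _ => div_nonneg (mul_nonneg (Wn_nonneg hW _ _) (Real.exp_pos _).le)
      (Finset.sum_nonneg fun _ _ => (Real.exp_pos _).le)
  have hterm : ∀ i ∈ I, ∀ j ∈ J, ∀ y : Fin n → β,
      A * (triInd n τ (c i) (c j) y - ∑ k ∈ (univ.erase i).erase j,
        triInd n τ (c i) (c j) y * rivalBound n Q g R ε ε' (emp2 n (c k) y)) ≤
      Wn n W (c i) y * Real.exp ((n : ℝ) * g (emp2 n (c j) y)) /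
        ∑ m'' : Fin M, Real.exp ((n : ℝ) * g (emp2 n (c m'') y)) := by
    intro i hi j hj y
    rw [← Finset.mul_sum, triInd]
    split_ifs with h
    · have hA' : Adm Q W (emp n (tri (c i) (c j) y)) := by rw [h]; exact hA
      have := le_error_term (g := g) (R := R) (ε' := ε') hn hW hε hc (hIJ i hi j hj).ne hA'
      rw [h] at this
      rwa [one_mul]
    · rw [zero_mul, sub_zero, mul_zero]
      exact div_nonneg (mul_nonneg (Wn_nonneg hW _ _) (Real.exp_pos _).le)
        (Finset.sum_nonneg fun _ _ => (Real.exp_pos _).le)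
  have hleft : (∑ i ∈ I, ∑ j ∈ J, pairInd n (emp2 n x₀ x₁) (c i) (c j)) *
        (∑ y, triInd n τ x₀ x₁ y) - rivalSum n τ (rivalBound n Q g R ε ε') I J c =
      ∑ i ∈ I, ∑ j ∈ J, ∑ y, (triInd n τ (c i) (c j) y - ∑ k ∈ (univ.erase i).erase j,
        triInd n τ (c i) (c j) y * rivalBound n Q g R ε ε' (emp2 n (c k) y)) := by
    simp only [Finset.sum_sub_distrib, rivalSum, Finset.sum_mul]
    congr 1
    · refine Finset.sum_congr rfl fun i _ => Finset.sum_congr rfl fun j _ => ?_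
      exact (sum_triInd _ _ _ _ _).symm
    · refine Finset.sum_congr rfl fun i _ => Finset.sum_congr rfl fun j _ => ?_
      rw [Finset.sum_comm]
  rw [hleft, Pe]
  refine mul_le_mul_of_nonneg_left ?_ (by positivity)
  simp only [Finset.mul_sum]
  refine le_trans (Finset.sum_le_sum fun i hi => ?_)
    (Finset.sum_le_sum_of_subset_of_nonneg (subset_univ I) fun m _ _ =>
      Finset.sum_nonneg fun m' _ => hnn m m')
  refine le_trans (Finset.sum_le_sum fun j hj => ?_)
    (Finset.sum_le_sum_of_subset_of_nonneg (s := J) (fun j hj =>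
      mem_erase.2 ⟨(hIJ i hi j hj).ne', mem_univ j⟩) fun m' _ _ => hnn i m')
  exact Finset.sum_le_sum fun y _ => hterm i hi j hj y

end Lower

section LowerProb

variable {α β : Type} [Fintype α] [Fintype β] {Q : α → ℝ} {W : α → β → ℝ}
  {g : (α × β → ℝ) → ℝ} {R : ℝ} {n M : ℕ}

/-- An index set splits into two halves of comparable size. -/
lemma exists_halves (hM : 2 ≤ M) : ∃ I J : Finset (Fin M), (∀ i ∈ I, ∀ j ∈ J, i < j) ∧
    (M : ℝ) / 4 ≤ I.card ∧ (M : ℝ) / 4 ≤ J.card := by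
  have hM' : (2 : ℝ) ≤ M := by exact_mod_cast hM
  have hk : M / 2 < M := by omega
  refine ⟨Finset.Iio ⟨M / 2, hk⟩, Finset.Ici ⟨M / 2, hk⟩, fun i hi j hj => ?_, ?_, ?_⟩
  · exact (Finset.mem_Iio.1 hi).trans_le (Finset.mem_Ici.1 hj)
  · rw [Fin.card_Iio]
    have : (M : ℝ) ≤ 4 * ((M / 2 : ℕ) : ℝ) := by
      exact_mod_cast (by omega : M ≤ 4 * (M / 2))
    linarith
  · rw [Fin.card_Ici]
    have : (M : ℝ) ≤ 4 * ((M - M / 2 : ℕ) : ℝ) := by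
      exact_mod_cast (by omega : M ≤ 4 * (M - M / 2))
    linarith

set_option maxHeartbeats 1000000 in
lemma Good.prob_Pe_lt {δ η F κ ε ε' : ℝ} (hG : Good n Q R δ η F) (hn : 0 < n)
    (hM : 2 ≤ Mof R n) (hW : IsChannel W) (hε : 0 ≤ ε) {x₀ x₁ : Fin n → α} {y₀ : Fin n → β}
    (hτ : emp n (tri x₀ x₁ y₀) ∈ lawSet Q W (R + 2 * δ))
    (hB : ∀ y : Fin n → β, ∑ z : Fin n → α, rivalBound n Q g R ε ε' (emp2 n z y) ≤
      Real.exp (n * (Ent Q - R - κ + η)))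
    (hcls : Real.exp (n * (Ent (emp n (tri x₀ x₁ y₀)) - η)) ≤ (cls (tri x₀ x₁ y₀)).card)
    (hfix : Real.exp (n * (Ent (emp2 n x₀ x₁) - Ent (emp n x₁) - η)) ≤
      (univ.filter fun z : Fin n → α => emp2 n z x₁ = emp2 n x₀ x₁).card) :
    seqExp (typeClass n Q) (okRel n (R + 2 * δ)) (Mof R n) (fun c =>
      if Pe n W g c <
        Real.exp (-(n * (expo Q W g R (emp n (tri x₀ x₁ y₀)) + ε + 3 * η))) / 192 then 1 else 0) ≤
      336 * Real.exp (-(n * δ)) + 1024 * Real.exp (-(n * (R - 2 * δ - 2 * η))) +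
        64 * Real.exp (-(n * (κ - 2 * η))) := by
  set T := typeClass n Q with hT
  set τ := emp n (tri x₀ x₁ y₀) with hτdef
  have h₀ : emp n x₀ = Q := by rw [← push_fst_tri x₀ x₁ y₀]; exact hτ.1.fst
  have h₁ : emp n x₁ = Q := by rw [← push_snd_tri x₀ x₁ y₀]; exact hτ.1.snd
  have hI₀ : mutInf (emp2 n x₀ x₁) < R + 2 * δ := by
    rw [← margXX_tri x₀ x₁ y₀]; exact hτ.2
  set s := ((univ.filter fun z : Fin n → α => emp2 n z x₁ = emp2 n x₀ x₁).card : ℝ) with hs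
  set v := ∑ y, triInd n τ x₀ x₁ y with hv
  set N := ((cls (tri x₀ x₁ y₀)).card : ℝ) with hN
  have hreg : Regular T (okRel n (R + 2 * δ)) (pairInd n (emp2 n x₀ x₁)) s :=
    regular_pairInd h₀ h₁ hI₀
  have hTpos : (0 : ℝ) < T.card := hG.sparse.card_pos
  have hF := hG.sparse.F_pos
  have hn0 : (0 : ℝ) ≤ n := Nat.cast_nonneg _
  have hspos : 0 < s := (Real.exp_pos _).trans_le hfix
  have hNpos : 0 < N := (Real.exp_pos _).trans_le hcls
  have hTsv : T.card * s * v = N := by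
    rw [hN, ← sum_sum_sum_triInd_mul h₀ h₁,
      Finset.sum_congr rfl fun x hx => Finset.sum_congr rfl fun x' _ => sum_triInd x₀ x₁ x x' y₀]
    simp only [← Finset.sum_mul]
    rw [Finset.sum_congr rfl hreg.row, sum_const, nsmul_eq_mul]
  have hvpos : 0 < v := by
    by_contra! h
    have := mul_nonpos_of_nonneg_of_nonpos (mul_pos hTpos hspos).le h
    linarith
  obtain ⟨I, J, hIJ, hIc, hJc⟩ := exists_halves hM
  set m := ((Mof R n : ℕ) : ℝ) with hm
  have hmpos : 0 < m := (Real.exp_pos _).trans_le hG.le_M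
  have hIpos : (0 : ℝ) < I.card := by linarith
  have hJpos : (0 : ℝ) < J.card := by linarith
  set μ := (I.card : ℝ) * J.card * (s / T.card) with hμ
  have hμpos : 0 < μ := by positivity
  have hμge : Real.exp (n * (R - 2 * δ - 2 * η)) / 16 ≤ μ := by
    have h1 : Real.exp (n * (R - 2 * δ - 2 * η)) * Real.exp (n * (Ent Q + η)) ≤
        Real.exp (n * R) * Real.exp (n * R) * s := by
      refine le_trans ?_ (mul_le_mul_of_nonneg_left hfix (by positivity))
      rw [← Real.exp_add, ← Real.exp_add, ← Real.exp_add, ← mul_add, ← mul_add, ← mul_add]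
      have h2 := mutInf_emp2 x₀ x₁
      rw [h₀, h₁] at h2
      rw [h₁]
      exact Real.exp_le_exp.2 (mul_le_mul_of_nonneg_left (by linarith) hn0)
    have h2 : Real.exp (n * (R - 2 * δ - 2 * η)) * T.card ≤ m * m * s :=
      calc _ ≤ Real.exp (n * (R - 2 * δ - 2 * η)) * Real.exp (n * (Ent Q + η)) := by
            gcongr; exact hG.card_le_exp
        _ ≤ Real.exp (n * R) * Real.exp (n * R) * s := h1
        _ ≤ m * m * s := by
            gcongr <;> exact hG.le_M
    have h3 : m / 4 * (m / 4) ≤ (I.card : ℝ) * J.card := by gcongr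
    rw [hμ, ← mul_div_assoc, div_le_div_iff₀ (by norm_num) hTpos]
    nlinarith
  have hcheb := hG.sparse.chebyshev (by positivity) (hG.rho_le.trans (by norm_num)) hG.small
    hG.card_le hspos hreg (card_pos.1 (by exact_mod_cast hIpos))
    (card_pos.1 (by exact_mod_cast hJpos)) hIJ hμ
  have hrival := hG.seqExp_rivalSum_le (y₀ := y₀) (r := rivalBound n Q g R ε ε') h₀ h₁
    (rivalBound_nonneg _ _) hB hIJ
  have hμv : μ * v = I.card * J.card * (N / T.card ^ 2) := by
    rw [← hTsv, hμ]; field_simp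
  have hK : (I.card : ℝ) * J.card * m * (F⁻¹ ^ 3 * (N * Real.exp (n * (Ent Q - R - κ + η)))) ≤
      16 * (μ * v) * Real.exp (-(n * (κ - 2 * η))) := by
    have h1 : (T.card : ℝ) * F⁻¹ ≤ 2 := by
      rw [← div_eq_mul_inv, div_le_iff₀ hF]; exact hG.card_le_two
    have h2 : F⁻¹ ≤ 2 * Real.exp (-(n * (Ent Q - η))) := by
      rw [Real.exp_neg, inv_le_iff_one_le_mul₀ hF, mul_assoc, mul_left_comm,
        le_inv_mul_iff₀ (Real.exp_pos _)]
      linarith [hG.le_card.trans hG.card_le_two]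
    calc _ = (μ * v) * ((T.card * F⁻¹) ^ 2 * (m * F⁻¹ * Real.exp (n * (Ent Q - R - κ + η)))) := by
          rw [hμv]; field_simp
      _ ≤ (μ * v) * (2 ^ 2 * (2 * Real.exp (n * R) * (2 * Real.exp (-(n * (Ent Q - η)))) *
            Real.exp (n * (Ent Q - R - κ + η)))) := by
          gcongr
          exact hG.M_le
      _ = 16 * (μ * v) * (Real.exp (n * R) * Real.exp (-(n * (Ent Q - η))) *
            Real.exp (n * (Ent Q - R - κ + η))) := by ring
      _ = _ := by
          rw [← Real.exp_add, ← Real.exp_add]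
          ring_nf
  have hmono : seqExp T (okRel n (R + 2 * δ)) (Mof R n) (fun c =>
      if Pe n W g c < Real.exp (-(n * (expo Q W g R τ + ε + 3 * η))) / 192 then 1 else 0) ≤
      seqExp T (okRel n (R + 2 * δ)) (Mof R n) (fun c =>
        (if ∑ i ∈ I, ∑ j ∈ J, pairInd n (emp2 n x₀ x₁) (c i) (c j) < μ / 2 then 1 else 0) +
        4 / (μ * v) * rivalSum n τ (rivalBound n Q g R ε ε') I J c) := by
    refine seqExp_mono fun c hc => ?_
    have hr0 : 0 ≤ rivalSum n τ (rivalBound n Q g R ε ε') I J c :=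
      Finset.sum_nonneg fun _ _ => Finset.sum_nonneg fun _ _ => Finset.sum_nonneg fun _ _ =>
        Finset.sum_nonneg fun _ _ => mul_nonneg (triInd_nonneg _ _ _ _) (rivalBound_nonneg _ _ _)
    have hr1 : 0 ≤ 4 / (μ * v) * rivalSum n τ (rivalBound n Q g R ε ε') I J c := by positivity
    split_ifs with hP hNc hNc
    · linarith
    · rw [zero_add]
      by_contra! hlt
      rw [div_mul_eq_mul_div, div_lt_one (by positivity)] at hlt
      push Not at hNc
      refine hP.not_ge (le_trans ?_ (le_Pe_of_pairs (g := g) (R := R) (ε' := ε') hn hW hε hτ.1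
        (emp_eq_of_seqProb_ne_zero hc) hIJ))
      have h1 : μ * v / 4 ≤ (∑ i ∈ I, ∑ j ∈ J, pairInd n (emp2 n x₀ x₁) (c i) (c j)) * v -
          rivalSum n τ (rivalBound n Q g R ε ε') I J c := by nlinarith
      have h2 : m * m / 16 * (N / T.card ^ 2) ≤ μ * v := by
        rw [hμv]
        have : m / 4 * (m / 4) ≤ (I.card : ℝ) * J.card := by gcongr
        gcongr
        linarith
      have h3 : Real.exp (n * (Ent τ - η - 2 * (Ent Q + η))) ≤ N / T.card ^ 2 := by
        rw [le_div_iff₀ (by positivity)]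
        refine le_trans ?_ hcls
        calc _ ≤ Real.exp (n * (Ent τ - η - 2 * (Ent Q + η))) *
              Real.exp (n * (Ent Q + η)) ^ 2 := by
              gcongr; exact hG.card_le_exp
          _ = _ := by rw [← Real.exp_nat_mul, ← Real.exp_add]; push_cast; ring_nf
      calc Real.exp (-(n * (expo Q W g R τ + ε + 3 * η))) / 192
          = m⁻¹ * (Real.exp (n * (logLik W τ - gap Q g R τ - ε)) / 3 *
            (m * Real.exp (n * R) / 16 *
              Real.exp (n * (Ent τ - η - 2 * (Ent Q + η))) / 4)) := by
            rw [show -(n * (expo Q W g R τ + ε + 3 * η)) = n * (logLik W τ - gap Q g R τ - ε) +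
              n * R + n * (Ent τ - η - 2 * (Ent Q + η)) by rw [expo]; ring, Real.exp_add,
              Real.exp_add]
            field_simp
            norm_num
        _ ≤ m⁻¹ * (Real.exp (n * (logLik W τ - gap Q g R τ - ε)) / 3 *
            (m * m / 16 * (N / T.card ^ 2) / 4)) := by
            gcongr
            exact hG.le_M
        _ ≤ _ := by
            refine mul_le_mul_of_nonneg_left (mul_le_mul_of_nonneg_left ?_ (by positivity))
              (by positivity)
            linarith
    · positivity
    · rw [zero_add]; exact hr1
  refine hmono.trans ?_
  rw [seqExp_add, seqExp_mul_left]
  refine add_le_add (hcheb.trans ?_) ?_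
  · have h1 : 64 / μ ≤ 1024 * Real.exp (-(n * (R - 2 * δ - 2 * η))) := by
      rw [Real.exp_neg, div_le_iff₀ hμpos]
      calc (64 : ℝ) = 1024 * (Real.exp (n * (R - 2 * δ - 2 * η)))⁻¹ *
            (Real.exp (n * (R - 2 * δ - 2 * η)) / 16) := by field_simp; norm_num
        _ ≤ _ := by gcongr
    linarith
  · calc _ ≤ 4 / (μ * v) * (16 * (μ * v) * Real.exp (-(n * (κ - 2 * η)))) := by
          gcongr
          exact hrival.trans hK
      _ = _ := by field_simp; norm_num

/-- With high probability the error probability is not much smaller than the typical exponent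
predicts. -/
lemma eventually_prob_Pe_lt (hQ : IsDist Q) (hW : IsChannel W) (hg : Continuous g) (hR : 0 < R)
    {D : ℕ} (hQD : IsTypeDist D Q) {δ ε ν : ℝ} (hδ : 0 < δ) (hδR : 2 * δ < R) (hε : 0 < ε)
    (hν : 0 < ν) :
    ∀ᶠ n : ℕ in atTop, D ∣ n →
      seqExp (typeClass n Q) (okRel n (R + 2 * δ)) (Mof R n) (fun c =>
        if Pe n W g c < Real.exp (-(n * (trcExp Q W g R (R + 2 * δ) + ε))) then 1 else 0) ≤ ν := by
  set L := trcExp Q W g R (R + 2 * δ) with hL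
  have hε8 : 0 < ε / 8 := by positivity
  obtain ⟨τ, hτ, hexpo⟩ := exists_expo_lt (g := g) (R := R) hQ hW
    (show 0 < R + 2 * δ by positivity) hε8
  obtain ⟨ε', hε', κ, hκ, hrival⟩ := eventually_sum_rivalBound_le (β := β) hQ hg hR hε8
  set η := min (δ / 2) (min (κ / 4) (min (ε / 24) ((R - 2 * δ) / 4))) with hη
  have hη0 : 0 < η := by
    have : 0 < R - 2 * δ := by linarith
    positivity
  have hη1 : η ≤ δ / 2 := min_le_left _ _
  have hη2 : η ≤ κ / 4 := (min_le_right _ _).trans (min_le_left _ _)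
  have hη3 : η ≤ ε / 24 :=
    (min_le_right _ _).trans ((min_le_right _ _).trans (min_le_left _ _))
  have hη4 : η ≤ (R - 2 * δ) / 4 :=
    (min_le_right _ _).trans ((min_le_right _ _).trans (min_le_right _ _))
  filter_upwards [eventually_good hQ hQD hR hδ hη0 (by linarith),
    eventually_exists_tri hQ hW hg hR hQD hε8 hτ, hrival η hη0,
    eventually_card_cls (α × α × β) η hη0, eventually_card_fix_ge α α η hη0,
    eventually_le_exp 2 hR, eventually_le_exp 192 hε8,
    eventually_mul_exp_le 336 hδ (show 0 < ν / 3 by positivity),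
    eventually_mul_exp_le 1024 (show 0 < R - 2 * δ - 2 * η by linarith)
      (show 0 < ν / 3 by positivity),
    eventually_mul_exp_le 64 (show 0 < κ - 2 * η by linarith) (show 0 < ν / 3 by positivity),
    eventually_gt_atTop 0]
    with n hgood htri hB hcls hfix h2 h192 b1 b2 b3 hn hDn
  obtain ⟨F, hG⟩ := hgood hDn
  obtain ⟨x₀, x₁, y₀, hlaw, hle⟩ := htri hDn
  have hM : 2 ≤ Mof R n := by exact_mod_cast h2.trans hG.le_M
  refine le_trans (seqExp_mono fun c _ => ?_)
    ((hG.prob_Pe_lt hn hM hW hε8.le hlaw hB (hcls _).1 (hfix x₁ x₀)).trans (by linarith))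
  have hn0 : (0 : ℝ) ≤ n := Nat.cast_nonneg _
  have hthr : Real.exp (-(n * (L + ε))) ≤
      Real.exp (-(n * (expo Q W g R (emp n (tri x₀ x₁ y₀)) + ε / 8 + 3 * η))) / 192 := by
    rw [le_div_iff₀ (by norm_num)]
    calc _ ≤ Real.exp (-(n * (L + ε))) * Real.exp (n * (ε / 8)) := by gcongr
      _ ≤ _ := by
          rw [← Real.exp_add, ← mul_neg, ← mul_neg, ← mul_add]
          exact Real.exp_le_exp.2 (mul_le_mul_of_nonneg_left (by linarith) hn0)
  by_cases h : Pe n W g c < Real.exp (-(n * (L + ε)))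
  · rw [if_pos h, if_pos (h.trans_le hthr)]
  · rw [if_neg h]; positivity

end LowerProb

section Limit

variable {α β : Type} [Fintype α] [Fintype β] {Q : α → ℝ} {W : α → β → ℝ}
  {g : (α × β → ℝ) → ℝ} {R : ℝ} {n : ℕ}

lemma rateCond_neg_mutInf (n : ℕ) (Q : α → ℝ) (R δ : ℝ) :
    RateCond n Q (fun P : α × α → ℝ => -mutInf P) (-(R + 2 * δ)) R δ := by
  rw [RateCond, EReal.le_sub_iff_add_le (Or.inl (EReal.coe_ne_bot _)) (Or.inl (EReal.coe_ne_top _)),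
    ← EReal.coe_add]
  refine le_sInf ?_
  rintro _ ⟨P, -, -, hP, rfl⟩
  exact EReal.coe_le_coe_iff.2 (neg_le_neg_iff.1 hP)

lemma eventually_le_Expnt (hQ : IsDist Q) (hW : IsChannel W) (hg : Continuous g) (hR : 0 < R)
    {D : ℕ} (hQD : IsTypeDist D Q) {δ ε : ℝ} (hδ : 0 < δ) (hε : 0 < ε) :
    ∀ᶠ n : ℕ in atTop, D ∣ n → trcExp Q W g R (R + 2 * δ) - ε ≤
      Expnt n Q (fun P : α × α → ℝ => -mutInf P) (-(R + 2 * δ)) W g R := by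
  set L := trcExp Q W g R (R + 2 * δ)
  obtain ⟨G, hGb⟩ := exists_abs_le hg
  filter_upwards [eventually_seqExp_Pe_le hQ hW hg hR hQD hδ hε,
    eventually_good hQ hQD hR hδ (half_pos hδ) (by linarith),
    eventually_le_exp 2 hR, eventually_gt_atTop 0] with n hPe hgood h2 hn hDn
  obtain ⟨F, hG⟩ := hgood hDn
  have hM : 2 ≤ Mof R n := by exact_mod_cast h2.trans hG.le_M
  have hn' : (0 : ℝ) < n := by exact_mod_cast hn
  rw [Expnt, expect_eq_seqExp, le_neg, div_le_iff₀ hn']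
  set S := Real.exp (-(n * (L - ε))) with hS
  have hS0 : 0 < S := Real.exp_pos _
  calc _ ≤ seqExp (typeClass n Q) (okRel n (R + 2 * δ)) (Mof R n) (fun c =>
        S⁻¹ * Pe n W g c + (-(n * (L - ε)) - 1) * 1) := by
        refine seqExp_mono fun c _ => ?_
        have hpos : 0 < Pe n W g c :=
          (by positivity : 0 < Real.exp (-(2 * (n * G))) / 2).trans_le (le_Pe hn hM hW hGb c)
        have := Real.log_le_sub_one_of_pos (mul_pos (inv_pos.2 hS0) hpos)
        rw [Real.log_mul (inv_pos.2 hS0).ne' hpos.ne', Real.log_inv, hS, Real.log_exp] at this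
        linarith
    _ = S⁻¹ * seqExp (typeClass n Q) (okRel n (R + 2 * δ)) (Mof R n) (fun c => Pe n W g c) +
        (-(n * (L - ε)) - 1) := by
        rw [seqExp_add, seqExp_mul_left, seqExp_mul_left, hG.sparse.seqExp_one le_rfl, mul_one]
    _ ≤ S⁻¹ * S + (-(n * (L - ε)) - 1) := by
        gcongr
        exact hPe hDn
    _ = -(L - ε) * n := by
        rw [inv_mul_cancel₀ hS0.ne']; ring

lemma eventually_Expnt_le (hQ : IsDist Q) (hW : IsChannel W) (hg : Continuous g) (hR : 0 < R)
    {D : ℕ} (hQD : IsTypeDist D Q) {δ ε : ℝ} (hδ : 0 < δ) (hδR : 2 * δ < R) (hε : 0 < ε) :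
    ∀ᶠ n : ℕ in atTop, D ∣ n →
      Expnt n Q (fun P : α × α → ℝ => -mutInf P) (-(R + 2 * δ)) W g R ≤
        trcExp Q W g R (R + 2 * δ) + ε := by
  set L := trcExp Q W g R (R + 2 * δ) with hL
  obtain ⟨G, hGb⟩ := exists_abs_le hg
  set B := 2 * |G| + 1 + |L| with hB
  have hB0 : 0 < B := by positivity
  have hε2 := half_pos hε
  filter_upwards [eventually_prob_Pe_lt hQ hW hg hR hQD hδ hδR hε2 (div_pos hε2 hB0),
    eventually_good hQ hQD hR hδ (half_pos hδ) (by linarith),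
    eventually_le_exp 2 hR, eventually_gt_atTop 0] with n hPe hgood h2 hn hDn
  obtain ⟨F, hG⟩ := hgood hDn
  have hM : 2 ≤ Mof R n := by exact_mod_cast h2.trans hG.le_M
  have hn1 : (1 : ℝ) ≤ n := by exact_mod_cast hn
  have hn' : (0 : ℝ) < n := by linarith
  rw [Expnt, expect_eq_seqExp, neg_le, le_div_iff₀ hn']
  have hlow : seqExp (typeClass n Q) (okRel n (R + 2 * δ)) (Mof R n) (fun c =>
      -(n * (L + ε / 2)) * 1 + -(n * B) *
        if Pe n W g c < Real.exp (-(n * (L + ε / 2))) then 1 else 0) ≤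
      seqExp (typeClass n Q) (okRel n (R + 2 * δ)) (Mof R n)
        (fun c => Real.log (Pe n W g c)) := by
    refine seqExp_mono fun c _ => ?_
    have hle := le_Pe hn hM hW hGb c
    have hpos : 0 < Pe n W g c :=
      (by positivity : 0 < Real.exp (-(2 * (n * G))) / 2).trans_le hle
    split_ifs with h
    · have h1 := Real.log_le_log (by positivity) hle
      rw [Real.log_div (Real.exp_pos _).ne' (by norm_num), Real.log_exp] at h1
      have h3 := Real.log_two_lt_d9
      have h4 : 0 ≤ n * (L + |L|) := mul_nonneg hn'.le (by linarith [neg_abs_le L])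
      have h5 : 0 ≤ n * (|G| - G) := mul_nonneg hn'.le (by linarith [le_abs_self G])
      have h6 : 0 ≤ n * ε := by positivity
      rw [hB]
      nlinarith
    · push Not at h
      have := Real.log_le_log (Real.exp_pos _) h
      rw [Real.log_exp] at this
      linarith
  refine le_trans ?_ hlow
  rw [seqExp_add, seqExp_mul_left, seqExp_mul_left, hG.sparse.seqExp_one le_rfl, mul_one]
  have hp := mul_le_mul_of_nonneg_left (hPe hDn) (by positivity : 0 ≤ n * B)
  have : n * B * (ε / 2 / B) = n * (ε / 2) := by field_simp
  linarith

lemma tendsto_Expnt (hQ : IsDist Q) (hW : IsChannel W) (hg : Continuous g) (hR : 0 < R)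
    {D : ℕ} (hD : 0 < D) (hQD : IsTypeDist D Q) {δ : ℝ} (hδ : 0 < δ) (hδR : 2 * δ < R) :
    Tendsto (fun t : ℕ =>
        Expnt (nseq D t) Q (fun P : α × α → ℝ => -mutInf P) (-(R + 2 * δ)) W g R)
      atTop (nhds (trcExp Q W g R (R + 2 * δ))) := by
  have hn : Tendsto (nseq D) atTop atTop :=
    tendsto_atTop_mono (fun t => show t ≤ D * (t + 1) by nlinarith) tendsto_id
  refine Metric.tendsto_nhds.2 fun ε hε => ?_
  filter_upwards [hn.eventually (eventually_le_Expnt hQ hW hg hR hQD hδ (half_pos hε)),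
    hn.eventually (eventually_Expnt_le hQ hW hg hR hQD hδ hδR (half_pos hε))] with t h1 h2
  have hdvd : D ∣ nseq D t := Dvd.intro _ rfl
  have e1 := h1 hdvd
  have e2 := h2 hdvd
  rw [Real.dist_eq, abs_lt]
  constructor <;> linarith

end Limit

end RGV

open RGV in
/-- With `d(P) = −I_P(X;X')` and `Δ = −(R+2δ)`, the rate condition holds
with parameter `δ` and, for all sufficiently small `δ > 0`, the TRC exponent of the RGV
ensemble is at least `E_ex(R,Q_X) − ε`. -/
theorem statement3 {α β : Type} [Fintype α] [Nonempty α] [Fintype β] [Nonempty β]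
    (Q : α → ℝ) (D : ℕ) (hD : 0 < D) (hQ : IsDist Q) (hQD : IsTypeDist D Q)
    (W : α → β → ℝ) (hW : IsChannel W)
    (g : (α × β → ℝ) → ℝ) (hg : Continuous g)
    (R : ℝ) (hR : 0 < R) (ε : ℝ) (hε : 0 < ε) :
    ∃ δ₀ : ℝ, 0 < δ₀ ∧ ∀ δ : ℝ, 0 < δ → δ < δ₀ →
      (∀ n : ℕ, RateCond n Q (fun P : α × α → ℝ => -mutInf P) (-(R + 2 * δ)) R δ) ∧
      ∃ L : ℝ,
        Filter.Tendsto
          (fun t : ℕ =>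
            Expnt (nseq D t) Q (fun P : α × α → ℝ => -mutInf P) (-(R + 2 * δ)) W g R)
          Filter.atTop (nhds L) ∧
        Eex Q W g R - ε ≤ L := by
  obtain ⟨δ₁, hδ₁, h⟩ := exists_Eex_le_trcExp hQ hW hg hR hε
  refine ⟨min δ₁ (R / 2), by positivity, fun δ hδ hδ₀ =>
    ⟨fun n => rateCond_neg_mutInf n Q R δ, _, tendsto_Expnt hQ hW hg hR hD hQD hδ ?_,
      h δ (hδ₀.trans_le (min_le_left _ _)) hδ⟩⟩
  have := hδ₀.trans_le (min_le_right δ₁ (R / 2))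
  linarith
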